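/- Let F be a field of characteristic 3 that is 3-reducible. Let A be a central simple F-algebra with exp A = 3 and ind A = 3^n for a positive integer n. Then λ_3(A) ≤ 2·3^{n−1} − 1. -/

import Mathlib

open scoped TensorProduct

/-- A finite-dimensional central simple algebra over a field `F`. -/
def IsCSA (F A : Type) [Field F] [Ring A] [Algebra F A] : Prop :=
  Algebra.IsCentral F A ∧ IsSimpleRing A ∧ FiniteDimensional F A

/-- An `F`-algebra is split if it is isomorphic to a matrix algebra over `F`. -/
def IsSplitAlg (F A : Type) [Field F] [Ring A] [Algebra F A] : Prop :=
  ∃ n : ℕ, 0 < n ∧ Nonempty (A ≃ₐ[F] Matrix (Fin n) (Fin n) F)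

/-- Brauer equivalence of two algebras over a field `F`. -/
def IsBrauerEquiv (F A B : Type) [Field F] [Ring A] [Algebra F A] [Ring B] [Algebra F B] :
    Prop :=
  ∃ n m : ℕ, 0 < n ∧ 0 < m ∧
    Nonempty ((Matrix (Fin n) (Fin n) A) ≃ₐ[F] (Matrix (Fin m) (Fin m) B))

/-- `A` has exponent `e`: `e` is the least positive integer such that the `e`-fold tensor
power of `A` over `F` is split. -/
def HasExponent (F A : Type) [Field F] [Ring A] [Algebra F A] (e : ℕ) : Prop :=
  0 < e ∧ IsSplitAlg F (⨂[F] _ : Fin e, A) ∧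
    ∀ k : ℕ, 0 < k → IsSplitAlg F (⨂[F] _ : Fin k, A) → e ≤ k

/-- `A` has (Schur) index `d`: `A` is isomorphic to a matrix algebra over a division
algebra of dimension `d ^ 2` over `F`. -/
def HasIndex (F A : Type) [Field F] [Ring A] [Algebra F A] (d : ℕ) : Prop :=
  ∃ (D : Type) (_ : DivisionRing D) (_ : Algebra F D) (m : ℕ), 0 < m ∧
    Nonempty (A ≃ₐ[F] Matrix (Fin m) (Fin m) D) ∧ Module.finrank F D = d ^ 2

/-- The (Schur) index of `A` is at most `d`. -/
def IndexLE (F A : Type) [Field F] [Ring A] [Algebra F A] (d : ℕ) : Prop :=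
  ∃ e : ℕ, e ≤ d ∧ HasIndex F A e

/-- `A` is the cyclic (symbol) algebra `[a, b)_{p,F}` of degree `p` in characteristic `p`:
it has dimension `p ^ 2` over `F` and is generated by elements `i`, `j` subject to
`i ^ p - i = a`, `j ^ p = b`, `j * i = (i - 1) * j`. -/
def IsCyclicAlgWith (p : ℕ) (F A : Type) [Field F] [Ring A] [Algebra F A] (a b : F) : Prop :=
  b ≠ 0 ∧ Module.finrank F A = p ^ 2 ∧
    ∃ i j : A, i ^ p - i = algebraMap F A a ∧ j ^ p = algebraMap F A b ∧
      j * i = (i - 1) * j ∧ Algebra.adjoin F {i, j} = ⊤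

/-- `A` is a cyclic algebra of degree `p`, i.e. of the form `[a, b)_{p,F}`. -/
def IsCyclicPAlg (p : ℕ) (F A : Type) [Field F] [Ring A] [Algebra F A] : Prop :=
  ∃ a b : F, IsCyclicAlgWith p F A a b

/-- The `p`-symbol length of `A` is at most `m`: `A` is Brauer equivalent to a tensor
product of at most `m` cyclic `F`-algebras of degree `p`. -/
def SymbolLengthLE (p : ℕ) (F A : Type) [Field F] [Ring A] [Algebra F A] (m : ℕ) : Prop :=
  ∃ k : ℕ, k ≤ m ∧ ∃ (D : Fin k → Type) (_ : ∀ i, Ring (D i)) (_ : ∀ i, Algebra F (D i)),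
    (∀ i, IsCyclicPAlg p F (D i)) ∧ IsBrauerEquiv F A (⨂[F] i, D i)

/-- `M` is a compositum `LK` of `L` and `K` over `F`: it is generated as an `F`-algebra by
the images of `L` and `K`. -/
def IsCompositum (F L K M : Type) [Field F] [Field L] [Field K] [Field M]
    [Algebra F L] [Algebra F K] [Algebra F M] [Algebra L M] [Algebra K M]
    [IsScalarTower F L M] [IsScalarTower F K M] : Prop :=
  (IsScalarTower.toAlgHom F L M).range ⊔ (IsScalarTower.toAlgHom F K M).range = ⊤

/-- A cyclic algebra of degree `m` over `F`: a central simple `F`-algebra of degree `m`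
containing a cyclic field extension of `F` of degree `m` (as a maximal subfield). -/
def IsCyclicAlgebra (F A : Type) [Field F] [Ring A] [Algebra F A] (m : ℕ) : Prop :=
  IsCSA F A ∧ Module.finrank F A = m ^ 2 ∧
  ∃ (L : Type) (_ : Field L) (_ : Algebra F L), IsGalois F L ∧ IsCyclic (L ≃ₐ[F] L) ∧
    Module.finrank F L = m ∧ Nonempty (L →ₐ[F] A)

/-- `L/F` is a `p`-extension: there is a tower of intermediate fields from `F` to `L`
each step of which is a cyclic extension of degree `p`. -/
def IsPExtension (p : ℕ) (F L : Type) [Field F] [Field L] [Algebra F L] : Prop :=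
  ∃ (n : ℕ) (T : Fin (n + 1) → IntermediateField F L),
    T 0 = ⊥ ∧ T (Fin.last n) = ⊤ ∧
    ∀ i : Fin n, ∃ h : T i.castSucc ≤ T i.succ,
      IsGalois (T i.castSucc) (IntermediateField.extendScalars h) ∧
      IsCyclic ((IntermediateField.extendScalars h) ≃ₐ[T i.castSucc]
        (IntermediateField.extendScalars h)) ∧
      Module.finrank (T i.castSucc) (IntermediateField.extendScalars h) = p

/-- `F` is `p`-cyclic reducible: for every central simple `F`-algebra `A` of exponent `p`
and every purely inseparable extension `K/F` with `K ^ p ⊆ F`, either `A_K` is split, or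
there is a separable extension `L/F` of degree `ind (A_K) / p` such that `A_{LK}` is
Brauer equivalent to a cyclic `LK`-algebra of degree `p`. -/
def IsPCyclicReducible (p : ℕ) (F : Type) [Field F] : Prop :=
  ∀ (A : Type) [Ring A] [Algebra F A], IsCSA F A → HasExponent F A p →
  ∀ (K : Type) [Field K] [Algebra F K], IsPurelyInseparable F K →
    (∀ z : K, z ^ p ∈ (algebraMap F K).range) →
    IsSplitAlg K (K ⊗[F] A) ∨
    ∃ d : ℕ, HasIndex K (K ⊗[F] A) (p * d) ∧
      ∃ (L : Type) (_ : Field L) (_ : Algebra F L), Algebra.IsSeparable F L ∧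
        Module.finrank F L = d ∧
        ∃ (M : Type) (_ : Field M) (_ : Algebra F M) (_ : Algebra L M) (_ : Algebra K M)
          (_ : IsScalarTower F L M) (_ : IsScalarTower F K M),
          IsCompositum F L K M ∧
          ∃ (C : Type) (_ : Ring C) (_ : Algebra M C),
            IsCyclicPAlg p M C ∧ IsBrauerEquiv M (M ⊗[F] A) C

/-- `F` is `p`-reducible: for every central simple `F`-algebra `A` of exponent `p`
and every purely inseparable extension `K/F` with `K ^ p ⊆ F`, either `A_K` is split, or
there is a separable extension `L/F` of degree `ind (A_K) / p` with `ind A_{LK} = p`. -/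
def IsPReducible (p : ℕ) (F : Type) [Field F] : Prop :=
  ∀ (A : Type) [Ring A] [Algebra F A], IsCSA F A → HasExponent F A p →
  ∀ (K : Type) [Field K] [Algebra F K], IsPurelyInseparable F K →
    (∀ z : K, z ^ p ∈ (algebraMap F K).range) →
    IsSplitAlg K (K ⊗[F] A) ∨
    ∃ d : ℕ, HasIndex K (K ⊗[F] A) (p * d) ∧
      ∃ (L : Type) (_ : Field L) (_ : Algebra F L), Algebra.IsSeparable F L ∧
        Module.finrank F L = d ∧
        ∃ (M : Type) (_ : Field M) (_ : Algebra F M) (_ : Algebra L M) (_ : Algebra K M)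
          (_ : IsScalarTower F L M) (_ : IsScalarTower F K M),
          IsCompositum F L K M ∧ HasIndex M (M ⊗[F] A) p

open scoped Matrix

section
variable {F A R : Type*} [Field F] [Ring A] [Algebra F A] [Algebra.IsCentral F A] [IsSimpleRing A]
  [Ring R] [Algebra F R]

/-- Elements commuting with the image of a central simple algebra are linearly independent over
that image as soon as they are linearly independent over the base field. -/
theorem eq_zero_of_sum_map_mul_eq_zero {ι : Type*} (f : A →ₐ[F] R) (x : ι → R)
    (hx : LinearIndependent F x) (hc : ∀ s a, Commute (x s) (f a)) (T : Finset ι) :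
    ∀ c : ι → A, ∑ s ∈ T, f (c s) * x s = 0 → ∀ s ∈ T, c s = 0 := by
  classical
  induction T using Finset.induction_on with
  | empty => simp
  | insert t T ht ih =>
    intro c hsum
    by_cases hct : c t = 0
    · intro s hs
      rw [Finset.sum_insert ht, hct, map_zero, zero_mul, zero_add] at hsum
      rcases Finset.mem_insert.1 hs with rfl | hs
      · exact hct
      · exact ih c hsum s hs
    · exfalso
      let I : TwoSidedIdeal A := TwoSidedIdeal.mk'
        {a | ∃ c : ι → A, ∑ s ∈ insert t T, f (c s) * x s = 0 ∧ c t = a}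
        ⟨0, by simp⟩
        (by
          rintro _ _ ⟨c, hc, rfl⟩ ⟨c', hc', rfl⟩
          refine ⟨c + c', ?_, rfl⟩
          simp only [Pi.add_apply, map_add, add_mul, Finset.sum_add_distrib, hc, hc', add_zero])
        (by
          rintro _ ⟨c, hc, rfl⟩
          refine ⟨-c, ?_, rfl⟩
          simp only [Pi.neg_apply, map_neg, neg_mul, Finset.sum_neg_distrib, hc, neg_zero])
        (by
          rintro a _ ⟨c, hc, rfl⟩
          refine ⟨fun s => a * c s, ?_, rfl⟩
          simp only [map_mul, mul_assoc, ← Finset.mul_sum, hc, mul_zero])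
        (by
          rintro _ a ⟨c, hc', rfl⟩
          refine ⟨fun s => c s * a, ?_, rfl⟩
          have : ∀ s, f (c s * a) * x s = (f (c s) * x s) * f a := fun s => by
            rw [map_mul, mul_assoc, ← (hc s a).eq, mul_assoc]
          simp only [this, ← Finset.sum_mul, hc', zero_mul])
      have hI : (1 : A) ∈ I := by
        apply IsSimpleRing.one_mem_of_ne_zero_mem I hct
        rw [TwoSidedIdeal.mem_mk']
        exact ⟨c, hsum, rfl⟩
      rw [TwoSidedIdeal.mem_mk'] at hI
      obtain ⟨e, he, het⟩ := hI
      have hcomm : ∀ s ∈ insert t T, ∃ l : F, e s = algebraMap F A l := by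
        have key : ∀ a, ∀ s ∈ T, a * e s - e s * a = 0 := by
          intro a
          apply ih (fun s => a * e s - e s * a)
          have h1 : ∑ s ∈ insert t T, f (a * e s - e s * a) * x s = 0 := by
            have : ∀ s, f (a * e s - e s * a) * x s
                = f a * (f (e s) * x s) - (f (e s) * x s) * f a := fun s => by
              rw [map_sub, map_mul, map_mul, sub_mul, mul_assoc, mul_assoc, mul_assoc,
                (hc s a).eq]
            simp only [this, Finset.sum_sub_distrib, ← Finset.mul_sum, ← Finset.sum_mul, he,
              mul_zero, zero_mul, sub_zero]
          rw [Finset.sum_insert ht, het] at h1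
          simpa using h1
        intro s hs
        rcases Finset.mem_insert.1 hs with rfl | hs
        · exact ⟨1, by simp [het]⟩
        · have : e s ∈ Subalgebra.center F A := by
            rw [Subalgebra.mem_center_iff]
            intro b
            exact sub_eq_zero.1 (key b s hs)
          exact Algebra.IsCentral.mem_center_iff F |>.1 this
      choose! l hl using hcomm
      have h2 : ∑ s ∈ insert t T, l s • x s = 0 := by
        rw [← he]
        refine Finset.sum_congr rfl fun s hs => ?_
        rw [hl s hs, AlgHom.commutes, Algebra.smul_def]
      have h3 := linearIndependent_iff'.1 hx _ _ h2 t (Finset.mem_insert_self _ _)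
      have h4 := hl t (Finset.mem_insert_self _ _)
      rw [h3, het, map_zero] at h4
      exact one_ne_zero h4

theorem lift_injective_of_central_simple {C : Type*} [Ring C] [Algebra F C]
    (f : A →ₐ[F] R) (g : C →ₐ[F] R) (hfg : ∀ a c, Commute (f a) (g c))
    (hg : Function.Injective g) :
    Function.Injective (Algebra.TensorProduct.lift f g hfg) := by
  classical
  rw [injective_iff_map_eq_zero]
  let b := Module.Free.chooseBasis F C
  have expand (z : A ⊗[F] C) : ∃ c : _ →₀ A, z = c.sum fun s a => a ⊗ₜ b s := by
    induction z with
    | zero => exact ⟨0, by simp⟩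
    | tmul a m =>
      refine ⟨(b.repr m).mapRange (fun l => l • a) (by simp), ?_⟩
      conv_lhs => rw [← b.linearCombination_repr m]
      rw [Finsupp.linearCombination_apply, Finsupp.sum_mapRange_index (by simp),
        Finsupp.sum, TensorProduct.tmul_sum, Finsupp.sum]
      simp [TensorProduct.smul_tmul]
    | add x y hx hy =>
      obtain ⟨c, rfl⟩ := hx
      obtain ⟨c', rfl⟩ := hy
      exact ⟨c + c', by rw [Finsupp.sum_add_index'] <;> simp [TensorProduct.add_tmul]⟩
  intro z hz
  obtain ⟨c, rfl⟩ := expand z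
  have := eq_zero_of_sum_map_mul_eq_zero f (fun s => g (b s))
    (b.linearIndependent.map' g.toLinearMap (LinearMap.ker_eq_bot.2 hg))
    (fun s a => (hfg a (b s)).symm) c.support c (by simpa [Finsupp.sum] using hz)
  exact Finset.sum_eq_zero fun s hs => by simp [this s hs]
end

section
variable {F A : Type*} [Field F] [Ring A] [Algebra F A] [Algebra.IsCentral F A] [IsSimpleRing A]

theorem isSimpleRing_tensorProduct (B : Type*) [Ring B] [Algebra F B] [IsSimpleRing B] :
    IsSimpleRing (A ⊗[F] B) := by
  have : IsSimpleOrder (TwoSidedIdeal (A ⊗[F] B)) := ⟨fun I => ?_⟩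
  · exact ⟨this⟩
  refine or_iff_not_imp_right.2 fun hI => ?_
  have hnt : Nontrivial I.ringCon.Quotient := by
    by_contra hnt
    rw [not_nontrivial_iff_subsingleton] at hnt
    apply hI
    rw [← TwoSidedIdeal.one_mem_iff]
    rw [TwoSidedIdeal.mem_iff]
    exact (RingCon.eq I.ringCon).1 (Subsingleton.elim _ _)
  let q := RingCon.mkₐ F I.ringCon
  let f : A →ₐ[F] I.ringCon.Quotient := q.comp Algebra.TensorProduct.includeLeft
  let g : B →ₐ[F] I.ringCon.Quotient := q.comp Algebra.TensorProduct.includeRight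
  have hfg : ∀ a c, Commute (f a) (g c) := fun a c => by
    have : Commute (a ⊗ₜ[F] (1 : B)) ((1 : A) ⊗ₜ[F] c) := by
      simp [Commute, SemiconjBy]
    exact this.map q
  have hinj := lift_injective_of_central_simple f g hfg (RingHom.injective g.toRingHom)
  have hq : Algebra.TensorProduct.lift f g hfg = q := by
    ext <;> simp [f, g]
  rw [hq] at hinj
  rw [eq_bot_iff]
  intro x hx
  rw [TwoSidedIdeal.mem_bot]
  apply hinj
  rw [map_zero]
  rw [TwoSidedIdeal.mem_iff] at hx
  exact (RingCon.eq I.ringCon).2 hx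

theorem isSimpleRing_baseChange (E : Type*) [Field E] [Algebra F E] :
    IsSimpleRing (E ⊗[F] A) := by
  have := isSimpleRing_tensorProduct (F := F) (A := A) E
  exact IsSimpleRing.of_ringEquiv (Algebra.TensorProduct.comm F A E).toRingEquiv this

/-- A linearly independent family of a central simple algebra stays linearly independent
after extension of scalars. -/
theorem linearIndependent_map_of_central_simple {E R ι : Type*} [Field E] [Algebra F E] [Ring R]
    [Nontrivial R] [Algebra F R] [Algebra E R] [IsScalarTower F E R] (f : A →ₐ[F] R) {a : ι → A}
    (ha : LinearIndependent F a) : LinearIndependent E (fun s => f (a s)) := by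
  classical
  rw [linearIndependent_iff']
  intro T w hw s hs
  have hfg : ∀ x (c : E), Commute (f x) (IsScalarTower.toAlgHom F E R c) := fun x c =>
    (Algebra.commutes c (f x)).symm
  have hinj := lift_injective_of_central_simple f (IsScalarTower.toAlgHom F E R) hfg
    (algebraMap E R).injective
  have h0 : ∑ t ∈ T, a t ⊗ₜ[F] w t = 0 := by
    apply hinj
    rw [map_sum, map_zero, ← hw]
    refine Finset.sum_congr rfl fun t _ => ?_
    simp [Algebra.smul_def, Algebra.commutes]
  obtain ⟨φ, hφ⟩ : ∃ φ : A →ₗ[F] F, ∀ t, φ (a t) = if t = s then 1 else 0 := by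
    obtain ⟨φ, hφ⟩ := LinearMap.exists_extend ((Finsupp.lapply s : (ι →₀ F) →ₗ[F] F).comp ha.repr)
    refine ⟨φ, fun t => ?_⟩
    have := LinearMap.congr_fun hφ ⟨a t, Submodule.subset_span ⟨t, rfl⟩⟩
    simp only [LinearMap.comp_apply, Submodule.subtype_apply, LinearEquiv.coe_coe] at this
    rw [this, ha.repr_eq_single t _ rfl]
    simp [Finsupp.single_apply]
  have h1 := congrArg (TensorProduct.lid F E ∘ φ.rTensor E) h0
  simpa [hφ, hs] using h1

theorem isCentral_baseChange (E : Type*) [Field E] [Algebra F E] :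
    Algebra.IsCentral E (E ⊗[F] A) := by
  classical
  refine ⟨fun x hx => ?_⟩
  rw [Subalgebra.mem_center_iff] at hx
  let b := Module.Free.chooseBasis F E
  let c := TensorProduct.equivFinsuppOfBasisLeft (N := A) b x
  have hc : x = c.sum fun t a => b t ⊗ₜ a := by
    rw [← TensorProduct.equivFinsuppOfBasisLeft_symm_apply]
    simp [c]
  have hcomm : ∀ t, ∃ l : F, c t = algebraMap F A l := by
    intro t
    have : c t ∈ Subalgebra.center F A := by
      rw [Subalgebra.mem_center_iff]
      intro a
      have h1 := congrArg (fun z => TensorProduct.equivFinsuppOfBasisLeft (N := A) b z t)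
        (hx (1 ⊗ₜ a))
      rw [hc] at h1
      have h2 : (if c t = 0 then 0 else a * c t) = if c t = 0 then 0 else c t * a := by
        simpa [Finsupp.sum, Finset.mul_sum, Finset.sum_mul, Finsupp.finsetSum_apply,
          TensorProduct.equivFinsuppOfBasisLeft_apply_tmul_apply, Finsupp.single_apply] using h1
      by_cases h0 : c t = 0
      · simp [h0]
      · simpa [h0] using h2
    exact (Algebra.IsCentral.mem_center_iff F).1 this
  choose l hl using hcomm
  rw [Algebra.mem_bot]
  refine ⟨∑ t ∈ c.support, l t • b t, ?_⟩
  rw [hc, Finsupp.sum, map_sum]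
  refine Finset.sum_congr rfl fun t _ => ?_
  rw [hl, Algebra.TensorProduct.algebraMap_apply, Algebra.algebraMap_self_apply,
    Algebra.algebraMap_eq_smul_one (A := A), TensorProduct.tmul_smul, TensorProduct.smul_tmul']

theorem exists_algHom_matrix_of_isAlgClosed [FiniteDimensional F A] (Ω : Type*) [Field Ω]
    [IsAlgClosed Ω] [Algebra F Ω] :
    ∃ d : ℕ, d ^ 2 = Module.finrank F A ∧ Nonempty (A →ₐ[F] Matrix (Fin d) (Fin d) Ω) := by
  have := isSimpleRing_baseChange (A := A) (F := F) Ω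
  obtain ⟨d, _, ⟨e⟩⟩ := IsSimpleRing.exists_algEquiv_matrix_of_isAlgClosed Ω (Ω ⊗[F] A)
  refine ⟨d, ?_, ⟨(e.toAlgHom.restrictScalars F).comp Algebra.TensorProduct.includeRight⟩⟩
  have := e.toLinearEquiv.finrank_eq
  simp [Module.finrank_matrix] at this
  rw [this, sq]
end

section
variable {E V D ι : Type*} [Field E] [AddCommGroup V] [Module E V] [Ring D] [Fintype ι]
  [DecidableEq ι]

/-- The image of a diagonal matrix unit acting on a module over a matrix ring. -/
def cornerSubmodule (f : Matrix ι ι D →+* Module.End E V) (o : ι) : Submodule E V :=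
  LinearMap.range (f (Matrix.single o o 1))

theorem mem_cornerSubmodule {f : Matrix ι ι D →+* Module.End E V} {o : ι} {v : V} :
    v ∈ cornerSubmodule f o ↔ f (Matrix.single o o 1) v = v := by
  constructor
  · rintro ⟨w, rfl⟩
    rw [← Module.End.mul_apply, ← map_mul]
    simp
  · intro h
    exact ⟨v, h⟩

theorem map_mem_cornerSubmodule {f : Matrix ι ι D →+* Module.End E V} {o k : ι} (v : V) :
    f (Matrix.single o k 1) v ∈ cornerSubmodule f o := by
  rw [mem_cornerSubmodule, ← Module.End.mul_apply, ← map_mul]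
  simp

/-- The action of the coefficient ring on a corner of a module over a matrix ring. -/
def cornerAction (f : Matrix ι ι D →+* Module.End E V) (o : ι) :
    D →+* Module.End E (cornerSubmodule f o) where
  toFun r := (f (Matrix.scalar ι r)).restrict (p := cornerSubmodule f o)
    (q := cornerSubmodule f o) fun v hv => by
      rw [mem_cornerSubmodule] at hv ⊢
      conv_rhs => rw [← hv]
      rw [← Module.End.mul_apply, ← map_mul, ← Module.End.mul_apply, ← map_mul]
      congr 2
      ext a b
      simp only [Matrix.scalar_apply, Matrix.mul_diagonal, Matrix.diagonal_mul, Matrix.single_apply]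
      split_ifs <;> simp
  map_one' := by ext; simp
  map_mul' r s := by ext; simp only [map_mul]; rfl
  map_zero' := by ext; simp
  map_add' r s := by ext; simp only [map_add]; rfl

@[simp]
theorem coe_cornerAction_apply (f : Matrix ι ι D →+* Module.End E V) (o : ι) (r : D)
    (v : cornerSubmodule f o) : (cornerAction f o r v : V) = f (Matrix.scalar ι r) v := rfl

/-- A module over a matrix ring is a sum of copies of a corner. -/
def cornerEquiv (f : Matrix ι ι D →+* Module.End E V) (o : ι) :
    V ≃ₗ[E] (ι → cornerSubmodule f o) where
  toFun v k := ⟨f (Matrix.single o k 1) v, map_mem_cornerSubmodule v⟩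
  map_add' v w := by ext; simp
  map_smul' c v := by ext; simp
  invFun w := ∑ k, f (Matrix.single k o 1) (w k)
  left_inv v := by
    simp only [← Module.End.mul_apply, ← map_mul, Matrix.single_mul_single_same, mul_one]
    rw [← LinearMap.sum_apply, ← map_sum]
    have : ∑ k : ι, Matrix.single k k (1 : D) = 1 := by
      rw [← Matrix.diagonal_one, ← Matrix.sum_single_eq_diagonal]
    rw [this]
    simp
  right_inv w := by
    ext k
    simp only [map_sum, ← Module.End.mul_apply, ← map_mul]
    rw [Finset.sum_eq_single k]
    · simpa using mem_cornerSubmodule.1 (w k).2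
    · intro b _ hb
      rw [Matrix.single_mul_single_of_ne _ _ _ _ hb.symm]
      simp
    · simp

theorem finrank_eq_card_mul_finrank_corner (f : Matrix ι ι D →+* Module.End E V) (o : ι) :
    Module.finrank E V = Fintype.card ι * Module.finrank E (cornerSubmodule f o) := by
  rw [(cornerEquiv f o).finrank_eq]
  by_cases h : Module.Finite E (cornerSubmodule f o)
  · rw [Module.finrank_pi_fintype]
    simp
  · have h' : ¬ Module.Finite E (ι → cornerSubmodule f o) := fun h' =>
      h (Module.Finite.of_surjective
        (LinearMap.proj o : (ι → cornerSubmodule f o) →ₗ[E] _) (LinearMap.proj_surjective o))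
    rw [Module.finrank_of_not_finite h, Module.finrank_of_not_finite h', mul_zero]
end

theorem card_mul_finrank_dvd_finrank {E V D ι : Type*} [Field E] [AddCommGroup V] [Module E V]
    [DivisionRing D] [Algebra E D] [Fintype ι] [DecidableEq ι] [Nonempty ι]
    (f : Matrix ι ι D →ₐ[E] Module.End E V) :
    Fintype.card ι * Module.finrank E D ∣ Module.finrank E V := by
  obtain ⟨o⟩ := ‹Nonempty ι›
  rw [finrank_eq_card_mul_finrank_corner f.toRingHom o]
  apply mul_dvd_mul_left
  let _ : Module D (cornerSubmodule f.toRingHom o) :=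
    Module.compHom _ (cornerAction f.toRingHom o)
  have hs : IsScalarTower E D (cornerSubmodule f.toRingHom o) := ⟨fun c r v => by
    change cornerAction f.toRingHom o (c • r) v = c • cornerAction f.toRingHom o r v
    ext
    have : Matrix.scalar ι (c • r) = c • Matrix.scalar ι r := by
      ext a b
      simp [Matrix.diagonal_apply]
    change f (Matrix.scalar ι (c • r)) v = c • f (Matrix.scalar ι r) v
    rw [this, map_smul]
    rfl⟩
  rw [← Module.finrank_mul_finrank E D (cornerSubmodule f.toRingHom o)]
  exact dvd_mul_right _ _

section
variable {R : Type*} [Ring R] {i j : R}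

theorem mul_mul_pow_sub_pow_mul (hij : j * i = (i - 1) * j) (f : ℕ) :
    i * j ^ f - j ^ f * i = (f : R) * j ^ f := by
  induction f with
  | zero => simp
  | succ f ih =>
    have h1 : i * j - j * i = j := by rw [hij]; noncomm_ring
    have h2 : i * j ^ (f + 1) - j ^ (f + 1) * i
        = (i * j ^ f - j ^ f * i) * j + j ^ f * (i * j - j * i) := by
      rw [pow_succ]; noncomm_ring
    rw [h2, ih, h1, Nat.cast_succ, mul_assoc, ← pow_succ, add_mul, one_mul]

theorem eq_zero_of_sum_mul_pow_eq_zero [CharP R 3] (hij : j * i = (i - 1) * j) (hj : IsUnit j)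
    (x : Fin 3 × Fin 3 → R) (hxi : ∀ e, Commute (x e) i) (hxj : ∀ e, Commute (x e) j)
    (h : ∑ e, x e * (i ^ (e.1 : ℕ) * j ^ (e.2 : ℕ)) = 0) : x = 0 := by
  have h3 : (3 : R) = 0 := by exact_mod_cast CharP.cast_eq_zero R 3
  have h2 : (2 : R) = -1 := by
    rw [eq_neg_iff_add_eq_zero, ← h3]; norm_num
  -- finite differences in `i`
  have inner (y : Fin 3 → R) (hyi : ∀ e, Commute (y e) i) (hyj : ∀ e, Commute (y e) j)
      (h0 : y 0 + y 1 * i + y 2 * i ^ 2 = 0) : y 0 = 0 ∧ y 1 = 0 ∧ y 2 = 0 := by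
    have shift (z : R) (hz : z * j = 0) : z = 0 := by
      obtain ⟨u, rfl⟩ := hj
      simpa using congrArg (· * (↑u⁻¹ : R)) hz
    have e1 : y 0 + y 1 * (i - 1) + y 2 * (i - 1) ^ 2 = 0 := by
      apply shift
      have : (y 0 + y 1 * (i - 1) + y 2 * (i - 1) ^ 2) * j
          = y 0 * j + y 1 * (j * i) + y 2 * ((i - 1) * (j * i)) := by
        rw [hij]; noncomm_ring
      rw [this, ← mul_assoc (i - 1), ← hij]
      have : j * (y 0 + y 1 * i + y 2 * i ^ 2) = 0 := by rw [h0, mul_zero]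
      rw [← this]
      simp only [mul_add, ← mul_assoc, pow_two, (hyj _).eq]
    have e2 : y 2 * i + y 2 - y 1 = 0 := by
      have : y 2 * i + y 2 - y 1 = (y 0 + y 1 * (i - 1) + y 2 * (i - 1) ^ 2)
          - (y 0 + y 1 * i + y 2 * i ^ 2) + y 2 * i * 3 := by noncomm_ring
      rw [this, e1, h0, h3]; simp
    have e3 : y 2 * (i - 1) + y 2 - y 1 = 0 := by
      apply shift
      have : (y 2 * (i - 1) + y 2 - y 1) * j = j * (y 2 * i + y 2 - y 1) := by
        simp only [sub_mul, add_mul, mul_add, mul_sub, ← mul_assoc, ← (hyj _).eq]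
        rw [mul_assoc (y 2) j i, hij]
        noncomm_ring
      rw [this, e2, mul_zero]
    have e4 : y 2 = 0 := by
      have : y 2 = (y 2 * i + y 2 - y 1) - (y 2 * (i - 1) + y 2 - y 1) := by noncomm_ring
      rw [this, e2, e3, sub_zero]
    have e5 : y 1 = 0 := by simpa [e4] using e2
    exact ⟨by simpa [e4, e5] using h0, e5, e4⟩
  let X : Fin 3 → R := fun f => x (0, f) + x (1, f) * i + x (2, f) * i ^ 2
  have hXi : ∀ f, Commute (X f) i := fun f =>
    ((hxi _).add_left ((hxi _).mul_left (Commute.refl i))).add_left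
      ((hxi _).mul_left ((Commute.refl i).pow_left 2))
  have hS : X 0 + X 1 * j + X 2 * j ^ 2 = 0 := by
    rw [← h, Fintype.sum_prod_type_right]
    simp [Fin.sum_univ_three, X, add_mul, mul_assoc]
    try abel
  have c1 : i * j - j * i = j := by simpa using mul_mul_pow_sub_pow_mul hij 1
  have c2 : i * j ^ 2 - j ^ 2 * i = - j ^ 2 := by
    rw [mul_mul_pow_sub_pow_mul hij 2]; simp [h2]
  have key (Y Z W : R) (hY : Commute Y i) (hZ : Commute Z i) (hW : Commute W i)
      (h0 : Y + Z * j + W * j ^ 2 = 0) : Z * j - W * j ^ 2 = 0 := by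
    have : Z * j - W * j ^ 2 = i * (Y + Z * j + W * j ^ 2) - (Y + Z * j + W * j ^ 2) * i := by
      have a1 : i * (Z * j) - Z * j * i = Z * j := by
        rw [← mul_assoc, ← hZ.eq, mul_assoc, mul_assoc, ← mul_sub, c1]
      have a2 : i * (W * j ^ 2) - W * j ^ 2 * i = - (W * j ^ 2) := by
        rw [← mul_assoc, ← hW.eq, mul_assoc, mul_assoc, ← mul_sub, c2, mul_neg]
      have a3 : i * Y - Y * i = 0 := by rw [hY.eq, sub_self]
      have a4 : i * (Y + Z * j + W * j ^ 2) - (Y + Z * j + W * j ^ 2) * i = (i * Y - Y * i)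
          + (i * (Z * j) - Z * j * i) + (i * (W * j ^ 2) - W * j ^ 2 * i) := by
        noncomm_ring
      rw [a4, a1, a2, a3]
      abel
    rw [this, h0, mul_zero, zero_mul, sub_zero]
  have k1 := key _ _ _ (hXi 0) (hXi 1) (hXi 2) hS
  have k2 := key 0 (X 1) (- X 2) (Commute.zero_left i) (hXi 1) (hXi 2).neg_left (by
    rw [zero_add, neg_mul, ← sub_eq_add_neg, k1])
  have hX1 : X 1 = 0 := by
    have : X 1 * j = 0 := by
      have : X 1 * j = X 1 * j * 3 - (X 1 * j - X 2 * j ^ 2) - (X 1 * j - -X 2 * j ^ 2) := by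
        noncomm_ring
      rw [this, k1, k2, h3]; simp
    obtain ⟨u, rfl⟩ := hj
    simpa using congrArg (· * (↑u⁻¹ : R)) this
  have hX2 : X 2 = 0 := by
    have : X 2 * j ^ 2 = 0 := by simpa [hX1] using k1
    obtain ⟨u, rfl⟩ := hj
    simpa [← Units.val_pow_eq_pow_val] using congrArg (· * (↑(u ^ 2)⁻¹ : R)) this
  have hX0 : X 0 = 0 := by simpa [hX1, hX2] using hS
  have fin (f : Fin 3) (hf : X f = 0) := inner (fun e => x (e, f)) (fun _ => hxi _)
    (fun _ => hxj _) hf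
  ext ⟨e, f⟩
  fin_cases f <;> fin_cases e
  exacts [(fin 0 hX0).1, (fin 0 hX0).2.1, (fin 0 hX0).2.2, (fin 1 hX1).1, (fin 1 hX1).2.1,
    (fin 1 hX1).2.2, (fin 2 hX2).1, (fin 2 hX2).2.1, (fin 2 hX2).2.2]

theorem LinearIndependent.mul_pow_mul_pow {E ι : Type*} [Field E] [Algebra E R] [CharP R 3]
    (hij : j * i = (i - 1) * j) (hj : IsUnit j) {u : ι → R} (hu : LinearIndependent E u)
    (hui : ∀ s, Commute (u s) i) (huj : ∀ s, Commute (u s) j) :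
    LinearIndependent E
      (fun q : ι × (Fin 3 × Fin 3) => u q.1 * (i ^ (q.2.1 : ℕ) * j ^ (q.2.2 : ℕ))) := by
  classical
  rw [linearIndependent_iff]
  intro c hc
  let T := c.support.image Prod.fst
  have hsum : ∑ e : Fin 3 × Fin 3, (∑ s ∈ T, c (s, e) • u s) * (i ^ (e.1 : ℕ) * j ^ (e.2 : ℕ))
      = 0 := by
    rw [Finsupp.linearCombination_apply, Finsupp.sum_of_support_subset (s := T ×ˢ Finset.univ)] at hc
    · rw [← hc, Finset.sum_product_right]
      simp [Finset.sum_mul]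
    · intro q hq
      exact Finset.mem_product.2 ⟨Finset.mem_image_of_mem _ hq, Finset.mem_univ _⟩
    · simp
  have h0 := eq_zero_of_sum_mul_pow_eq_zero hij hj
    (fun e => ∑ s ∈ T, c (s, e) • u s)
    (fun e => Commute.sum_left _ _ _ fun s _ => (hui s).smul_left _)
    (fun e => Commute.sum_left _ _ _ fun s _ => (huj s).smul_left _) hsum
  ext ⟨s, e⟩
  by_cases hs : s ∈ T
  · exact linearIndependent_iff'.1 hu T _ (congrFun h0 e) s hs
  · by_contra hne
    exact hs (Finset.mem_image.2 ⟨(s, e), Finsupp.mem_support_iff.2 hne, rfl⟩)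

theorem linearIndependent_pow_mul_pow {E : Type*} [Field E] [Algebra E R] [CharP R 3]
    (hij : j * i = (i - 1) * j) (hj : IsUnit j) :
    LinearIndependent E (fun q : Fin 3 × Fin 3 => i ^ (q.1 : ℕ) * j ^ (q.2 : ℕ)) := by
  have : Nontrivial R := CharP.nontrivial_of_char_ne_one (v := 3) (by norm_num)
  have := LinearIndependent.mul_pow_mul_pow (E := E) (u := fun _ : Unit => (1 : R)) hij hj
    (by simp) (fun _ => Commute.one_left _) (fun _ => Commute.one_left _)
  simpa [Function.comp_def] using this.comp (fun q : Fin 3 × Fin 3 => ((), q))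
    (fun a b h => by simpa using h)

theorem mem_span_pow_mul_pow {E : Type*} [Field E] [Algebra E R] (hij : j * i = (i - 1) * j)
    {a b : E} (hi : i ^ 3 - i = algebraMap E R a) (hj3 : j ^ 3 = algebraMap E R b)
    {x : R} (hx : x ∈ Algebra.adjoin E {i, j}) :
    x ∈ Submodule.span E
      (Set.range fun q : Fin 3 × Fin 3 => i ^ (q.1 : ℕ) * j ^ (q.2 : ℕ)) := by
  set S := Submodule.span E
      (Set.range fun q : Fin 3 × Fin 3 => i ^ (q.1 : ℕ) * j ^ (q.2 : ℕ)) with hS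
  have mem (e f : ℕ) (he : e < 3) (hf : f < 3) : i ^ e * j ^ f ∈ S :=
    Submodule.subset_span ⟨(⟨e, he⟩, ⟨f, hf⟩), rfl⟩
  have hi3 : i ^ 3 = i + a • 1 := by
    rw [← Algebra.algebraMap_eq_smul_one, ← hi]; abel
  have hj3' : j ^ 3 = b • 1 := by rw [hj3, Algebra.algebraMap_eq_smul_one]
  have hi_mul : ∀ y ∈ S, i * y ∈ S := by
    intro y hy
    induction hy using Submodule.span_induction with
    | mem y hy =>
      obtain ⟨⟨e, f⟩, rfl⟩ := hy
      fin_cases e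
      · simpa [pow_succ] using mem 1 f (by norm_num) f.2
      · simpa [pow_succ, mul_assoc] using mem 2 f (by norm_num) f.2
      · have : i * (i ^ 2 * j ^ (f : ℕ)) = i ^ 1 * j ^ (f : ℕ) + a • (i ^ 0 * j ^ (f : ℕ)) := by
          rw [← mul_assoc, ← pow_succ', hi3]
          simp [add_mul]
        change i * (i ^ 2 * j ^ (f : ℕ)) ∈ S
        rw [this]
        exact S.add_mem (mem _ _ (by norm_num) f.2) (S.smul_mem _ (mem _ _ (by norm_num) f.2))
    | zero => simp
    | add y z _ _ hy hz => rw [mul_add]; exact S.add_mem hy hz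
    | smul c y _ hy => rw [mul_smul_comm]; exact S.smul_mem _ hy
  have hj_pow : ∀ f : ℕ, f < 3 → ∀ e, e < 3 → i ^ e * j ^ (f + 1) ∈ S := by
    intro f hf e he
    by_cases h : f + 1 < 3
    · exact mem _ _ he h
    · obtain rfl : f = 2 := by omega
      rw [hj3', mul_smul_comm]
      exact S.smul_mem _ (by simpa using mem e 0 he (by norm_num))
  have hj_mul : ∀ y ∈ S, j * y ∈ S := by
    intro y hy
    induction hy using Submodule.span_induction with
    | mem y hy =>
      obtain ⟨⟨e, f⟩, rfl⟩ := hy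
      have h0 := hj_pow f f.2
      fin_cases e
      · simpa [pow_succ'] using h0 0 (by norm_num)
      · have : j * (i ^ 1 * j ^ (f : ℕ)) = i * (i ^ 0 * j ^ (f + 1 : ℕ)) - i ^ 0 * j ^ (f + 1 : ℕ) := by
          rw [pow_one, ← mul_assoc, hij, pow_succ']
          noncomm_ring
        change j * (i ^ 1 * j ^ (f : ℕ)) ∈ S
        rw [this]
        exact S.sub_mem (hi_mul _ (h0 0 (by norm_num))) (h0 0 (by norm_num))
      · have : j * (i ^ 2 * j ^ (f : ℕ)) = i * (i * (i ^ 0 * j ^ (f + 1 : ℕ)) -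
            i ^ 0 * j ^ (f + 1 : ℕ)) - (i * (i ^ 0 * j ^ (f + 1 : ℕ)) - i ^ 0 * j ^ (f + 1 : ℕ)) := by
          have : j * (i ^ 2 * j ^ (f : ℕ)) = (j * i) * i * j ^ (f : ℕ) := by noncomm_ring
          rw [this, hij, mul_assoc (i - 1), hij, pow_succ']
          noncomm_ring
        change j * (i ^ 2 * j ^ (f : ℕ)) ∈ S
        rw [this]
        have h1 := S.sub_mem (hi_mul _ (h0 0 (by norm_num))) (h0 0 (by norm_num))
        exact S.sub_mem (hi_mul _ h1) h1
    | zero => simp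
    | add y z _ _ hy hz => rw [mul_add]; exact S.add_mem hy hz
    | smul c y _ hy => rw [mul_smul_comm]; exact S.smul_mem _ hy
  have hall : ∀ y ∈ S, x * y ∈ S := by
    induction hx using Algebra.adjoin_induction with
    | mem z hz =>
      rcases hz with rfl | rfl
      exacts [hi_mul, hj_mul]
    | algebraMap r => intro y hy; rw [← Algebra.smul_def]; exact S.smul_mem _ hy
    | add p q _ _ hp hq => intro y hy; rw [add_mul]; exact S.add_mem (hp y hy) (hq y hy)
    | mul p q _ _ hp hq => intro y hy; rw [mul_assoc]; exact hp _ (hq y hy)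
  simpa using hall 1 (by simpa using mem 0 0 (by norm_num) (by norm_num))
end

theorem Matrix.pow_three_eq_of_fin_three {R : Type*} [CommRing R] (X : Matrix (Fin 3) (Fin 3) R) :
    X ^ 3 = X.trace • X ^ 2 - X.adjugate.trace • X + X.det • 1 := by
  ext a b
  fin_cases a <;> fin_cases b <;>
  simp [pow_succ, Matrix.mul_apply, Fin.sum_univ_three, Matrix.trace, Matrix.det_fin_three,
    Matrix.adjugate_fin_three] <;> ring

theorem Matrix.pow_three_eq_of_trace_eq_zero {R : Type*} [CommRing R]
    {X Y : Matrix (Fin 3) (Fin 3) R} (hXY : X * Y = 1) (hX : X.trace = 0) (hY : Y.trace = 0) :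
    X ^ 3 = X.det • 1 := by
  have h : X.adjugate = X.det • Y := by
    calc X.adjugate = X.adjugate * (X * Y) := by rw [hXY, mul_one]
      _ = X.det • Y := by rw [← mul_assoc, Matrix.adjugate_mul, Matrix.smul_mul, one_mul]
  rw [Matrix.pow_three_eq_of_fin_three, h, Matrix.trace_smul, hX, hY]
  simp

section
variable {E D : Type*} [Field E] [DivisionRing D] [Algebra E D]

theorem inv_mem_of_mem_of_finite (S : Subalgebra E D) [FiniteDimensional E S] {t : D}
    (ht : t ∈ S) (h0 : t ≠ 0) : t⁻¹ ∈ S := by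
  have hinj : Function.Injective (LinearMap.mulLeft E (⟨t, ht⟩ : S)) := by
    intro x y hxy
    ext
    exact mul_left_cancel₀ h0 (congrArg Subtype.val hxy)
  obtain ⟨z, hz⟩ := LinearMap.surjective_of_injective hinj 1
  have hz' : t * (z : D) = 1 := congrArg Subtype.val hz
  rw [← eq_inv_of_mul_eq_one_right hz']
  exact z.2

theorem finrank_adjoin_singleton_le [FiniteDimensional E D] {u : D} {n : ℕ}
    {p : Polynomial E} (hp : p ≠ 0)
    (hpn : p.natDegree ≤ n) (hpu : Polynomial.aeval u p = 0) :
    Module.finrank E (Algebra.adjoin E {u}) ≤ n := by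
  have hle : Subalgebra.toSubmodule (Algebra.adjoin E {u}) ≤
      (Polynomial.degreeLT E n).map (Polynomial.aeval u).toLinearMap := by
    intro x hx
    rw [Algebra.adjoin_singleton_eq_range_aeval] at hx
    obtain ⟨q, rfl⟩ := hx
    refine ⟨q % p, ?_, ?_⟩
    · rw [SetLike.mem_coe, Polynomial.mem_degreeLT]
      exact (Polynomial.degree_mod_lt q hp).trans_le
        (Polynomial.degree_le_of_natDegree_le hpn)
    · have := congrArg (Polynomial.aeval u) (EuclideanDomain.mod_add_div q p)
      rw [map_add, map_mul, hpu, zero_mul, add_zero] at this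
      exact this
  have hf : FiniteDimensional E (Polynomial.degreeLT E n) :=
    (Polynomial.degreeLTEquiv E n).symm.finiteDimensional
  calc Module.finrank E (Algebra.adjoin E {u}) ≤ _ := Submodule.finrank_mono hle
    _ ≤ Module.finrank E (Polynomial.degreeLT E n) := Submodule.finrank_map_le _ _
    _ = n := by rw [(Polynomial.degreeLTEquiv E n).finrank_eq]; simp
end

section
variable {E D : Type*} [Field E] [Ring D] [IsSimpleRing D] [Algebra E D] [Algebra.IsCentral E D]

/-- The span of the additive commutators of an algebra. -/
def commutatorSpan (E D : Type*) [Field E] [Ring D] [Algebra E D] : Submodule E D :=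
  Submodule.span E {z | ∃ x y : D, z = x * y - y * x}

theorem span_range_eq_top_of_finrank {Ω : Type*} [Field Ω] [Algebra E Ω] [FiniteDimensional E D]
    {n : ℕ} (hn : n ^ 2 = Module.finrank E D) [Nontrivial (Matrix (Fin n) (Fin n) Ω)]
    (γ : D →ₐ[E] Matrix (Fin n) (Fin n) Ω) :
    Submodule.span Ω (Set.range γ) = ⊤ := by
  let b := Module.finBasis E D
  have hli := linearIndependent_map_of_central_simple (E := Ω) γ b.linearIndependent
  have := hli.span_eq_top_of_card_eq_finrank' (by
    rw [Module.finrank_matrix, ← hn]; simp [sq])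
  rw [eq_top_iff, ← this]
  exact Submodule.span_mono (by rintro _ ⟨s, rfl⟩; exact ⟨_, rfl⟩)

theorem trace_eq_zero_of_mem_commutatorSpan {E D Ω : Type*} [Field E] [Ring D] [Algebra E D]
    [Field Ω] [Algebra E Ω] {n : ℕ}
    (γ : D →ₐ[E] Matrix (Fin n) (Fin n) Ω) {z : D} (hz : z ∈ commutatorSpan E D) :
    (γ z).trace = 0 := by
  induction hz using Submodule.span_induction with
  | mem z hz =>
    obtain ⟨x, y, rfl⟩ := hz
    rw [map_sub, map_mul, map_mul, Matrix.trace_sub, Matrix.trace_mul_comm, sub_self]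
  | zero => simp
  | add y z _ _ hy hz => rw [map_add, Matrix.trace_add, hy, hz, add_zero]
  | smul c y _ hy => rw [map_smul, Matrix.trace_smul, hy, smul_zero]

theorem finrank_le_finrank_commutatorSpan_add_one {Ω : Type*} [Field Ω] [Algebra E Ω]
    [FiniteDimensional E D] {n : ℕ} (hn : n ^ 2 = Module.finrank E D) (hn0 : n ≠ 0)
    (γ : D →ₐ[E] Matrix (Fin n) (Fin n) Ω) :
    Module.finrank E D ≤ Module.finrank E (commutatorSpan E D) + 1 := by
  have : NeZero n := ⟨hn0⟩
  let W := Submodule.span Ω (γ '' (commutatorSpan E D : Set D))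
  have hcomm : ∀ X Y : Matrix (Fin n) (Fin n) Ω, X * Y - Y * X ∈ W := by
    have htop := span_range_eq_top_of_finrank hn γ
    intro X Y
    have hX : X ∈ Submodule.span Ω (Set.range γ) := htop ▸ Submodule.mem_top
    have hY : Y ∈ Submodule.span Ω (Set.range γ) := htop ▸ Submodule.mem_top
    induction hX using Submodule.span_induction with
    | mem X hX =>
      obtain ⟨x, rfl⟩ := hX
      induction hY using Submodule.span_induction with
      | mem Y hY =>
        obtain ⟨y, rfl⟩ := hY
        refine Submodule.subset_span ⟨x * y - y * x, Submodule.subset_span ⟨x, y, rfl⟩, ?_⟩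
        simp
      | zero => simp
      | add y z _ _ hy hz =>
        have : γ x * (y + z) - (y + z) * γ x = (γ x * y - y * γ x) + (γ x * z - z * γ x) := by
          noncomm_ring
        rw [this]; exact W.add_mem hy hz
      | smul c y _ hy =>
        rw [mul_smul_comm, smul_mul_assoc, ← smul_sub]; exact W.smul_mem _ hy
    | zero => simp
    | add y z _ _ hy hz =>
      have : (y + z) * Y - Y * (y + z) = (y * Y - Y * y) + (z * Y - Y * z) := by
        noncomm_ring
      rw [this]; exact W.add_mem hy hz
    | smul c y _ hy =>
      rw [mul_smul_comm, smul_mul_assoc, ← smul_sub]; exact W.smul_mem _ hy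
  let e : Matrix (Fin n) (Fin n) Ω := Matrix.single 0 0 1
  have htop : W ⊔ Submodule.span Ω {e} = ⊤ := by
    rw [eq_top_iff]
    intro X _
    rw [Matrix.matrix_eq_sum_single X]
    refine Submodule.sum_mem _ fun k _ => Submodule.sum_mem _ fun l _ => ?_
    have hsingle : Matrix.single k l (1 : Ω) ∈ W ⊔ Submodule.span Ω {e} := by
      by_cases hkl : k = l
      · subst hkl
        have h1 := hcomm (Matrix.single k 0 1) (Matrix.single 0 k 1)
        rw [Matrix.single_mul_single_same, Matrix.single_mul_single_same, mul_one] at h1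
        have := Submodule.add_mem_sup h1 (Submodule.mem_span_singleton_self e)
        simpa [e] using this
      · have h1 := hcomm (Matrix.single k k 1) (Matrix.single k l 1)
        rw [Matrix.single_mul_single_same, Matrix.single_mul_single_of_ne _ _ _ _ (Ne.symm hkl)] at h1
        exact Submodule.mem_sup_left (by simpa using h1)
    have := Submodule.smul_mem _ (X k l) hsingle
    simpa using this
  have hW : Module.finrank Ω W ≤ Module.finrank E (commutatorSpan E D) := by
    let b := Module.finBasis E (commutatorSpan E D)
    have : W ≤ Submodule.span Ω (Set.range fun s => γ (b s)) := by
      rw [Submodule.span_le]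
      rintro _ ⟨z, hz, rfl⟩
      have := congrArg (fun z : commutatorSpan E D => γ (z : D)) (b.sum_repr ⟨z, hz⟩)
      simp only [Submodule.coe_sum, Submodule.coe_smul, map_sum, map_smul] at this
      rw [← this]
      refine Submodule.sum_mem _ fun s _ => ?_
      rw [← algebraMap_smul Ω]
      exact Submodule.smul_mem _ _ (Submodule.subset_span ⟨s, rfl⟩)
    calc _ ≤ _ := Submodule.finrank_mono this
      _ ≤ _ := finrank_range_le_card _
      _ = _ := by simp
  have h1 := Submodule.finrank_add_le_finrank_add_finrank W (Submodule.span Ω {e})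
  rw [htop, finrank_top, Module.finrank_matrix, Module.finrank_self] at h1
  rw [← hn, sq]
  simp only [Fintype.card_fin, mul_one] at h1
  have h3 : Module.finrank Ω (Submodule.span Ω {e}) ≤ 1 :=
    (finrank_span_le_card ({e} : Set _)).trans (by simp)
  omega
end

section
variable {E D : Type*} [Field E] [DivisionRing D] [Algebra E D]

theorem exists_mem_commutatorSpan_inv_mem [FiniteDimensional E D]
    (hD : Module.finrank E D = 9) (S : Subalgebra E D) (hS2 : 2 ≤ Module.finrank E S)
    (hS3 : Module.finrank E S ≤ 3) (hH : 8 ≤ Module.finrank E (commutatorSpan E D)) :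
    ∃ x : D, x ∉ (⊥ : Subalgebra E D) ∧ x ∈ commutatorSpan E D ∧ x⁻¹ ∈ commutatorSpan E D := by
  have hQ : Module.finrank E (D ⧸ commutatorSpan E D) ≤ 1 := by
    have := Submodule.finrank_quotient_add_finrank (commutatorSpan E D)
    omega
  let f : D →ₗ[E] S →ₗ[E] (D ⧸ commutatorSpan E D) :=
    LinearMap.mk₂ E (fun y s => Submodule.Quotient.mk ((s : D) * y))
      (by intros; simp [mul_add]) (by intros; simp) (by intros; simp [add_mul])
      (by intros; simp)
  have hker : 6 ≤ Module.finrank E (LinearMap.ker f) := by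
    have h1 := LinearMap.finrank_range_add_finrank_ker f
    have h2 := Submodule.finrank_le (LinearMap.range f)
    rw [Module.finrank_linearMap] at h2
    have h3 : Module.finrank E S * Module.finrank E (D ⧸ commutatorSpan E D) ≤ 3 * 1 :=
      Nat.mul_le_mul hS3 hQ
    omega
  obtain ⟨y, hy, hyS⟩ : ∃ y ∈ LinearMap.ker f, y ∉ S := by
    by_contra! h
    have : LinearMap.ker f ≤ Subalgebra.toSubmodule S := h
    have h1 := Submodule.finrank_mono this
    have h2 : Module.finrank E (Subalgebra.toSubmodule S) = Module.finrank E S := rfl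
    omega
  have hy0 : y ≠ 0 := fun h => hyS (h ▸ S.zero_mem)
  let g : S →ₗ[E] (D ⧸ commutatorSpan E D) :=
    (commutatorSpan E D).mkQ ∘ₗ LinearMap.mulLeft E y⁻¹ ∘ₗ (Subalgebra.toSubmodule S).subtype
  obtain ⟨t, ht, ht0⟩ : ∃ t ∈ LinearMap.ker g, t ≠ 0 := by
    apply Submodule.exists_mem_ne_zero_of_ne_bot
    intro h
    have := LinearMap.finrank_le_finrank_of_injective (LinearMap.ker_eq_bot.1 h)
    omega
  have ht0' : (t : D) ≠ 0 := fun h => ht0 (Subtype.ext h)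
  have hy' : ∀ s ∈ S, s * y ∈ commutatorSpan E D := fun s hs => by
    have := LinearMap.congr_fun (LinearMap.mem_ker.1 hy) ⟨s, hs⟩
    exact (Submodule.Quotient.mk_eq_zero _).1 this
  refine ⟨(t : D)⁻¹ * y, fun hx => hyS ?_, hy' _ (inv_mem_of_mem_of_finite S t.2 ht0'), ?_⟩
  · have : y = t * ((t : D)⁻¹ * y) := by rw [mul_inv_cancel_left₀ ht0']
    rw [this]
    exact S.mul_mem t.2 ((bot_le : ⊥ ≤ S) hx)
  · rw [mul_inv_rev, inv_inv]
    exact (Submodule.Quotient.mk_eq_zero _).1 (LinearMap.mem_ker.1 ht)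

variable [Algebra.IsCentral E D]

theorem exists_pow_three_mem_bot (hD : Module.finrank E D = 9) :
    ∃ x : D, x ∉ (⊥ : Subalgebra E D) ∧ x ^ 3 ∈ (⊥ : Subalgebra E D) := by
  have : FiniteDimensional E D := Module.finite_of_finrank_pos (by omega)
  obtain ⟨n, hn, ⟨γ⟩⟩ := exists_algHom_matrix_of_isAlgClosed (F := E) (A := D) (AlgebraicClosure E)
  obtain rfl : n = 3 := by
    rw [hD] at hn
    exact Nat.pow_left_injective (n := 2) (by norm_num) (by simpa using hn)
  have hH := finrank_le_finrank_commutatorSpan_add_one hn (by norm_num) γ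
  obtain ⟨u, hu⟩ : ∃ u : D, u ∉ (⊥ : Subalgebra E D) := by
    by_contra! h
    have : (⊥ : Subalgebra E D) = ⊤ := eq_top_iff.2 fun x _ => h x
    have h1 := Subalgebra.finrank_bot (F := E) (E := D)
    rw [this, subalgebra_top_finrank_eq_submodule_top_finrank, finrank_top] at h1
    omega
  have hS2 : 2 ≤ Module.finrank E (Algebra.adjoin E {u}) := by
    by_contra! h
    have h1 : 0 < Module.finrank E (Algebra.adjoin E {u}) := Module.finrank_pos
    have h2 := Subalgebra.eq_bot_of_finrank_one (S := Algebra.adjoin E {u}) (by omega)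
    exact hu (h2 ▸ Algebra.self_mem_adjoin_singleton E u)
  have hS3 : Module.finrank E (Algebra.adjoin E {u}) ≤ 3 := by
    have hdep : ¬ LinearIndependent E (fun k : Fin 4 => u ^ (k : ℕ)) := by
      intro h
      have h1 := linearIndependent_map_of_central_simple (E := AlgebraicClosure E) γ h
      rw [Fintype.linearIndependent_iff] at h1
      have h2 := h1 ![-(γ u).det, (γ u).adjugate.trace, -(γ u).trace, 1] (by
        have := Matrix.pow_three_eq_of_fin_three (γ u)
        simp only [Fin.sum_univ_four, map_pow]
        simp [this]
        abel) 3
      simp at h2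
    rw [Fintype.not_linearIndependent_iff] at hdep
    obtain ⟨g, hg, k, hk⟩ := hdep
    refine finrank_adjoin_singleton_le (p := ∑ k : Fin 4, Polynomial.monomial (k : ℕ) (g k))
      ?_ ?_ ?_
    · intro h
      apply hk
      have := congrArg (fun p => Polynomial.coeff p (k : ℕ)) h
      simpa [Polynomial.finsetSum_coeff, Polynomial.coeff_monomial, Fin.val_inj] using this
    · refine Polynomial.natDegree_sum_le_of_forall_le _ _ fun k _ => ?_
      exact (Polynomial.natDegree_monomial_le _).trans (by omega)
    · rw [map_sum, ← hg]
      simp [Polynomial.aeval_monomial, Algebra.smul_def]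
  obtain ⟨x, hx, hx1, hx2⟩ := exists_mem_commutatorSpan_inv_mem hD _ hS2 hS3 (by omega)
  refine ⟨x, hx, ?_⟩
  have hx0 : x ≠ 0 := fun h => hx (h ▸ (⊥ : Subalgebra E D).zero_mem)
  have h3 := Matrix.pow_three_eq_of_trace_eq_zero (X := γ x) (Y := γ x⁻¹)
    (by rw [← map_mul, mul_inv_cancel₀ hx0, map_one])
    (trace_eq_zero_of_mem_commutatorSpan γ hx1) (trace_eq_zero_of_mem_commutatorSpan γ hx2)
  apply Algebra.IsCentral.out
  rw [Subalgebra.mem_center_iff]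
  intro b
  apply RingHom.injective γ.toRingHom
  simp [map_mul, map_pow, h3]

theorem exists_artin_schreier_element [CharP E 3] {x : D} (hx : x ∉ (⊥ : Subalgebra E D))
    (hx3 : x ^ 3 ∈ (⊥ : Subalgebra E D)) : ∃ i : D, x * i = (i - 1) * x := by
  have : CharP D 3 := charP_of_injective_algebraMap (algebraMap E D).injective 3
  have h3 : (3 : D) = 0 := by exact_mod_cast CharP.cast_eq_zero D 3
  have hcub : ∀ v, x ^ 3 * v = v * x ^ 3 := fun v => by
    obtain ⟨c, hc⟩ := Algebra.mem_bot.1 hx3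
    rw [← hc, Algebra.commutes]
  obtain ⟨w, hw⟩ : ∃ w, x * w - w * x ≠ 0 := by
    by_contra! h
    refine hx (Algebra.IsCentral.out (Subalgebra.mem_center_iff.2 fun b => ?_))
    exact (sub_eq_zero.1 (h b)).symm
  obtain ⟨v, hv, hv2⟩ : ∃ v, x * v - v * x ≠ 0 ∧
      x * (x * v - v * x) - (x * v - v * x) * x = 0 := by
    by_cases h : x * (x * w - w * x) - (x * w - w * x) * x = 0
    · exact ⟨w, hw, h⟩
    · refine ⟨_, h, ?_⟩
      have : x * (x * (x * w - w * x) - (x * w - w * x) * x)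
          - (x * (x * w - w * x) - (x * w - w * x) * x) * x
          = (x ^ 3 * w - w * x ^ 3) + 3 * (x * w * x ^ 2 - x ^ 2 * w * x) := by
        noncomm_ring
      rw [this, hcub, h3]; simp
  set u := x * v - v * x with hu
  have hxu : Commute x u⁻¹ := Commute.inv_right₀ (sub_eq_zero.1 hv2)
  refine ⟨-(v * u⁻¹ * x), ?_⟩
  have hxv : x * v = v * x + u := by rw [hu]; abel
  have h1 : x * (v * u⁻¹ * x) = v * u⁻¹ * x * x + x := by
    calc x * (v * u⁻¹ * x) = x * v * u⁻¹ * x := by noncomm_ring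
      _ = v * (x * u⁻¹) * x + u * u⁻¹ * x := by rw [hxv]; noncomm_ring
      _ = _ := by rw [hxu.eq, mul_inv_cancel₀ hv]; noncomm_ring
  rw [mul_neg, h1]
  noncomm_ring

/-- A central division algebra of degree `3` in characteristic `3` is cyclic. -/
theorem exists_cyclic_generators [CharP E 3] (hD : Module.finrank E D = 9) :
    ∃ (i j : D) (a b : E), i ^ 3 - i = algebraMap E D a ∧ j ^ 3 = algebraMap E D b ∧
      j * i = (i - 1) * j ∧ j ≠ 0 ∧ Algebra.adjoin E {i, j} = ⊤ := by
  have : CharP D 3 := charP_of_injective_algebraMap (algebraMap E D).injective 3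
  have h3 : (3 : D) = 0 := by exact_mod_cast CharP.cast_eq_zero D 3
  have : FiniteDimensional E D := Module.finite_of_finrank_pos (by omega)
  obtain ⟨x, hx, hx3⟩ := exists_pow_three_mem_bot hD
  obtain ⟨i, hi⟩ := exists_artin_schreier_element hx hx3
  have hx0 : x ≠ 0 := fun h => hx (h ▸ (⊥ : Subalgebra E D).zero_mem)
  have hspan := (linearIndependent_pow_mul_pow (E := E) hi
    hx0.isUnit).span_eq_top_of_card_eq_finrank' (by simp [hD])
  have hadj : Algebra.adjoin E {i, x} = ⊤ := by
    rw [← Algebra.toSubmodule_eq_top, eq_top_iff, ← hspan, Submodule.span_le]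
    rintro _ ⟨q, rfl⟩
    rw [SetLike.mem_coe, Subalgebra.mem_toSubmodule]
    exact mul_mem (pow_mem (Algebra.subset_adjoin (by simp)) _)
      (pow_mem (Algebra.subset_adjoin (by simp)) _)
  have hcent : i ^ 3 - i ∈ (⊥ : Subalgebra E D) := by
    refine Algebra.IsCentral.out (Subalgebra.mem_center_iff.2 fun b => ?_)
    have hb : b ∈ Algebra.adjoin E {i, x} := hadj ▸ Algebra.mem_top
    have hci : Commute i (i ^ 3 - i) := ((Commute.refl i).pow_right 3).sub_right (Commute.refl i)
    have hcx : Commute x (i ^ 3 - i) := by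
      have e1 : x * (i ^ 3 - i) = (i - 1) * ((i - 1) * ((i - 1) * x)) - (i - 1) * x := by
        rw [← hi, ← mul_assoc (i - 1) x, ← hi, ← mul_assoc (i - 1), ← mul_assoc (i - 1), ← hi]
        noncomm_ring
      have e2 : (i - 1) * ((i - 1) * ((i - 1) * x)) - (i - 1) * x
          = (i ^ 3 - i) * x + 3 * (i * x - i ^ 2 * x) := by
        noncomm_ring
      rw [Commute, SemiconjBy, e1, e2, h3]; simp
    induction hb using Algebra.adjoin_induction with
    | mem z hz =>
      rcases hz with rfl | rfl
      exacts [hci, hcx]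
    | algebraMap r => exact Algebra.commutes r _
    | add p q _ _ hp hq => rw [add_mul, mul_add, hp, hq]
    | mul p q _ _ hp hq => rw [mul_assoc, hq, ← mul_assoc, hp, mul_assoc]
  obtain ⟨a, ha⟩ := Algebra.mem_bot.1 hcent
  obtain ⟨b, hb⟩ := Algebra.mem_bot.1 hx3
  exact ⟨i, x, a, b, ha.symm, hb.symm, hi, hx0, hadj⟩
end

section
variable {E D Ω V : Type*} [Field E] [Ring D] [Algebra E D] [Field Ω] [Algebra E Ω]
  [AddCommGroup V] [Module Ω V]

/-- The matrix representation attached to a basis of a module on which an algebra acts. -/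
noncomputable def matrixRepr {ι : Type*} [Fintype ι] [DecidableEq ι] (h : D →+* Module.End Ω V)
    (hc : ∀ (c : E) v, h (algebraMap E D c) v = algebraMap E Ω c • v) (bs : Module.Basis ι Ω V) :
    D →ₐ[E] Matrix ι ι Ω where
  toRingHom := ((LinearMap.toMatrixAlgEquiv bs).toAlgHom.toRingHom).comp h
  commutes' c := by
    have : h (algebraMap E D c) = algebraMap Ω (Module.End Ω V) (algebraMap E Ω c) := by
      ext v; rw [hc]; simp
    change LinearMap.toMatrixAlgEquiv bs (h (algebraMap E D c)) = _
    rw [this, AlgEquiv.commutes]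
    rfl

theorem matrixRepr_apply {ι : Type*} [Fintype ι] [DecidableEq ι] (h : D →+* Module.End Ω V)
    (hc : ∀ (c : E) v, h (algebraMap E D c) v = algebraMap E Ω c • v) (bs : Module.Basis ι Ω V)
    (r : D) (k l : ι) : matrixRepr h hc bs r k l = bs.repr (h r (bs l)) k :=
  LinearMap.toMatrixAlgEquiv_apply bs (h r) k l

theorem AlgHom.entries_mem_of_adjoin_eq_top {ι : Type*} [Fintype ι] [DecidableEq ι]
    (ρ : D →ₐ[E] Matrix ι ι Ω) (N : IntermediateField E Ω) {s : Set D}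
    (hs : Algebra.adjoin E s = ⊤) (h : ∀ r ∈ s, ∀ k l, ρ r k l ∈ N) (r : D) (k l : ι) :
    ρ r k l ∈ N := by
  have hr : r ∈ Algebra.adjoin E s := hs ▸ Algebra.mem_top
  induction hr using Algebra.adjoin_induction generalizing k l with
  | mem z hz => exact h z hz k l
  | algebraMap c =>
    rw [AlgHom.commutes, Matrix.algebraMap_matrix_apply]
    split_ifs
    exacts [N.algebraMap_mem c, N.zero_mem]
  | add p q _ _ hp hq => rw [map_add]; exact N.add_mem (hp k l) (hq k l)
  | mul p q _ _ hp hq =>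
    rw [map_mul, Matrix.mul_apply]
    exact N.sum_mem fun t _ => N.mul_mem (hp k t) (hq t l)

theorem exists_algHom_entries_mem {i j : D} {a : E} (hi : i ^ 3 - i = algebraMap E D a)
    (hij : j * i = (i - 1) * j) (hadj : Algebra.adjoin E {i, j} = ⊤)
    (h : D →+* Module.End Ω V)
    (hc : ∀ (c : E) v, h (algebraMap E D c) v = algebraMap E Ω c • v)
    (bs : Module.Basis (Fin 3) Ω V) (h1 : bs 1 = h i (bs 0)) (h2 : bs 2 = h i (bs 1))
    {x y z : Ω} (hj : h j (bs 0) = x • bs 0 + y • bs 1 + z • bs 2)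
    (N : IntermediateField E Ω) (hx : x ∈ N) (hy : y ∈ N) (hz : z ∈ N) :
    ∃ ρ : D →ₐ[E] Matrix (Fin 3) (Fin 3) Ω, ∀ r k l, ρ r k l ∈ N := by
  refine ⟨matrixRepr h hc bs, AlgHom.entries_mem_of_adjoin_eq_top _ N hadj ?_⟩
  let Λ : AddSubgroup V :=
    { carrier := {w | ∀ k, bs.repr w k ∈ N}
      add_mem' := fun hv hw k => by simpa using N.add_mem (hv k) (hw k)
      zero_mem' := fun k => by simp
      neg_mem' := fun hv k => by simpa using N.neg_mem (hv k) }
  have hΛs : ∀ c ∈ N, ∀ w ∈ Λ, c • w ∈ Λ := fun c hc w hw k => by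
    simpa using N.mul_mem hc (hw k)
  have hbs : ∀ l, bs l ∈ Λ := fun l k => by
    rw [Module.Basis.repr_self, Finsupp.single_apply]
    split_ifs
    exacts [N.one_mem, N.zero_mem]
  have h3 : h i (bs 2) = bs 1 + algebraMap E Ω a • bs 0 := by
    have : i ^ 3 = i + algebraMap E D a := by rw [← hi]; abel
    rw [h2, h1, ← Module.End.mul_apply, ← Module.End.mul_apply, ← map_mul, ← map_mul,
      ← pow_three', this, map_add, LinearMap.add_apply, hc]
  have hΛi : ∀ w ∈ Λ, h i w ∈ Λ := fun w hw => by
    rw [← bs.sum_repr w, map_sum]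
    refine Λ.sum_mem fun l _ => ?_
    rw [map_smul]
    refine hΛs _ (hw l) _ ?_
    fin_cases l
    · exact h1 ▸ hbs 1
    · exact h2 ▸ hbs 2
    · exact h3 ▸ Λ.add_mem (hbs 1) (hΛs _ (N.algebraMap_mem a) _ (hbs 0))
  have hji : ∀ w, h j (h i w) = h i (h j w) - h j w := fun w => by
    rw [← Module.End.mul_apply, ← map_mul, hij]
    simp [sub_mul]
  have hj0 : h j (bs 0) ∈ Λ := hj ▸ Λ.add_mem (Λ.add_mem (hΛs _ hx _ (hbs 0))
    (hΛs _ hy _ (hbs 1))) (hΛs _ hz _ (hbs 2))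
  have hj1 : h j (bs 1) ∈ Λ := by
    rw [h1, hji]; exact Λ.sub_mem (hΛi _ hj0) hj0
  have hj2 : h j (bs 2) ∈ Λ := by
    rw [h2, hji]; exact Λ.sub_mem (hΛi _ hj1) hj1
  intro r hr k l
  rw [matrixRepr_apply]
  rcases hr with rfl | rfl
  · exact hΛi _ (hbs l) k
  · fin_cases l
    exacts [hj0 k, hj1 k, hj2 k]

theorem norm_eq_of_cyclic_basis [CharP E 3] {i j : D} {a b : E}
    (hi : i ^ 3 - i = algebraMap E D a)
    (hb : j ^ 3 = algebraMap E D b)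
    (hij : j * i = (i - 1) * j) (h : D →+* Module.End Ω V)
    (hc : ∀ (c : E) v, h (algebraMap E D c) v = algebraMap E Ω c • v)
    (bs : Module.Basis (Fin 3) Ω V) (h1 : bs 1 = h i (bs 0)) (h2 : bs 2 = h i (bs 1))
    {x y z : Ω} (hj : h j (bs 0) = x • bs 0 + y • bs 1 + z • bs 2) :
    x ^ 3 - x ^ 2 * z - x * y ^ 2 + x * z ^ 2 + algebraMap E Ω a * y ^ 3
      - algebraMap E Ω a * y * z ^ 2 + (algebraMap E Ω a) ^ 2 * z ^ 3 = algebraMap E Ω b := by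
  set α := algebraMap E Ω a with hα
  have : CharP Ω 3 := charP_of_injective_algebraMap (algebraMap E Ω).injective 3
  have hthree : (3 : Ω) = 0 := by exact_mod_cast CharP.cast_eq_zero Ω 3
  have h3 : h i (bs 2) = bs 1 + α • bs 0 := by
    have : i ^ 3 = i + algebraMap E D a := by rw [← hi]; abel
    rw [h2, h1, ← Module.End.mul_apply, ← Module.End.mul_apply, ← map_mul, ← map_mul,
      ← pow_three', this, map_add, LinearMap.add_apply, hc]
  have hji : ∀ w, h j (h i w) = h i (h j w) - h j w := fun w => by
    rw [← Module.End.mul_apply, ← map_mul, hij]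
    simp [sub_mul]
  have hj1 : h j (bs 1) = (α * z - x) • bs 0 + (x - y + z) • bs 1 + (y - z) • bs 2 := by
    rw [h1, hji, hj]
    simp only [map_add, map_smul, ← h1, ← h2, h3]
    module
  have hj2 : h j (bs 2) = (α * (y - z) - (α * z - x)) • bs 0
      + ((α * z - x) - (x - y + z) + (y - z)) • bs 1 + ((x - y + z) - (y - z)) • bs 2 := by
    rw [h2, hji, hj1]
    simp only [map_add, map_smul, ← h1, ← h2, h3]
    module
  have hjjj : h j (h j (h j (bs 0))) = algebraMap E Ω b • bs 0 := by
    rw [← Module.End.mul_apply, ← Module.End.mul_apply, ← map_mul, ← map_mul,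
      ← pow_three', hb, hc]
  have h0 := congrArg (fun w => bs.repr w 0) hjjj
  rw [hj] at h0
  simp only [map_add, map_smul, hj, hj1, hj2, Module.Basis.repr_self, Finsupp.add_apply,
    Finsupp.smul_apply, Finsupp.single_apply, smul_eq_mul] at h0
  simp only [Fin.isValue, one_ne_zero, if_true, if_false, mul_one, mul_zero, add_zero,
    Fin.reduceEq] at h0
  linear_combination h0 + (2 * x * z * y - 2 * x * z * y * α - x * z ^ 2 + 3 * x * z ^ 2 * α
    - x * y ^ 2 - 2 * x ^ 2 * z + x ^ 2 * y + 2 * z * y ^ 2 * α - 4 * z ^ 2 * y * α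
    + 2 * z ^ 3 * α) * hthree
end

theorem mem_of_quadratic {E Ω : Type*} [Field E] [Field Ω] [Algebra E Ω] [CharP Ω 3]
    (N : IntermediateField E Ω) {x α β γ : Ω} (hx : x ^ 3 ∈ N) (hα : α ∈ N) (hβ : β ∈ N)
    (hγ : γ ∈ N) (h : α * x ^ 2 + β * x + γ = 0) (h0 : α ≠ 0 ∨ β ≠ 0) : x ∈ N := by
  have hthree : (3 : Ω) = 0 := by exact_mod_cast CharP.cast_eq_zero Ω 3
  by_cases hα0 : α = 0
  · have hβ0 : β ≠ 0 := by tauto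
    have : x = -γ / β := by
      rw [eq_div_iff hβ0]
      linear_combination h - x ^ 2 * hα0
    rw [this]
    exact N.div_mem (N.neg_mem hγ) hβ
  · by_cases hd : α * γ - β ^ 2 = 0
    · have : (α * x - β) ^ 2 = 0 := by
        linear_combination α * h - hd - α * β * x * hthree
      have hx' : x = β / α := by
        rw [eq_div_iff hα0]
        linear_combination pow_eq_zero_iff (two_ne_zero) |>.1 this
      rw [hx']
      exact N.div_mem hβ hα
    · have : x = (β * γ - α ^ 2 * x ^ 3) / (α * γ - β ^ 2) := by
        rw [eq_div_iff hd]
        linear_combination (α * x - β) * h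
      rw [this]
      exact N.div_mem (N.sub_mem (N.mul_mem hβ hγ) (N.mul_mem (pow_mem hα 2) hx))
        (N.sub_mem (N.mul_mem hα hγ) (pow_mem hβ 2))

section
variable {Ω V : Type*} [Field Ω] [AddCommGroup V] [Module Ω V]

theorem exists_cyclic_basis (I : Module.End Ω V) (hV : Module.finrank Ω V = 3) (v : V)
    (hv : ∀ c₀ c₁ c₂ : Ω, c₀ • v + c₁ • I v + c₂ • I (I v) = 0 → c₀ = 0 ∧ c₁ = 0 ∧ c₂ = 0) :
    ∃ bs : Module.Basis (Fin 3) Ω V, bs 0 = v ∧ bs 1 = I (bs 0) ∧ bs 2 = I (bs 1) := by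
  have hli : LinearIndependent Ω ![v, I v, I (I v)] := by
    rw [Fintype.linearIndependent_iff]
    intro g hg
    obtain ⟨h0, h1, h2⟩ := hv (g 0) (g 1) (g 2) (by simpa [Fin.sum_univ_three] using hg)
    intro k
    fin_cases k <;> assumption
  exact ⟨basisOfLinearIndependentOfCardEqFinrank hli (by simp [hV]), by simp, by simp, by simp⟩

theorem exists_cyclic_basis_of_no_root (I : Module.End Ω V) (hV : Module.finrank Ω V = 3) {a : Ω}
    (hI : ∀ v, I (I (I v)) = I v + a • v) (ha : ∀ θ : Ω, θ ^ 3 - θ ≠ a) :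
    ∃ bs : Module.Basis (Fin 3) Ω V, bs 1 = I (bs 0) ∧ bs 2 = I (bs 1) := by
  have : Nontrivial V := Module.nontrivial_of_finrank_pos (R := Ω) (by omega)
  obtain ⟨v, hv⟩ := exists_ne (0 : V)
  obtain ⟨bs, -, h⟩ := exists_cyclic_basis I hV v (by
    intro c₀ c₁ c₂ h
    by_contra hne
    let P : Polynomial Ω := Polynomial.X ^ 3 - Polynomial.X - Polynomial.C a
    let Q : Polynomial Ω := Polynomial.C c₀ + Polynomial.C c₁ * Polynomial.X
      + Polynomial.C c₂ * Polynomial.X ^ 2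
    have hPdeg : P.natDegree = 3 := by
      simp only [P]; compute_degree!
    have hirr : Irreducible P := by
      rw [Polynomial.irreducible_iff_roots_eq_zero_of_degree_le_three (by omega) (by omega)]
      rw [Multiset.eq_zero_iff_forall_notMem]
      intro θ hθ
      have := (Polynomial.mem_roots'.1 hθ).2
      simp only [P, Polynomial.IsRoot, Polynomial.eval_sub, Polynomial.eval_pow,
        Polynomial.eval_X, Polynomial.eval_C] at this
      exact ha θ (sub_eq_zero.1 this)
    have hQ : Q ≠ 0 := by
      intro hQ
      apply hne
      have e0 := congrArg (Polynomial.coeff · 0) hQ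
      have e1 := congrArg (Polynomial.coeff · 1) hQ
      have e2 := congrArg (Polynomial.coeff · 2) hQ
      simp [Q, Polynomial.coeff_X, Polynomial.coeff_C] at e0 e1 e2
      exact ⟨e0, e1, e2⟩
    have hcop : IsCoprime P Q := by
      refine (hirr.coprime_iff_not_dvd).2 fun hdvd => ?_
      have h1 := Polynomial.natDegree_le_of_dvd hdvd hQ
      have h2 : Q.natDegree ≤ 2 := by simp only [Q]; compute_degree
      omega
    obtain ⟨U, W, hUW⟩ := hcop
    apply hv
    have hP0 : Polynomial.aeval I P v = 0 := by
      simp [P, pow_succ, hI]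
    have hQ0 : Polynomial.aeval I Q v = 0 := by
      simpa [Q, pow_succ] using h
    have := congrArg (fun p => Polynomial.aeval I p v) hUW
    simpa [hP0, hQ0] using this.symm)
  exact ⟨bs, h⟩

theorem exists_cyclic_basis_of_eigenvector [CharP Ω 3] (I J : Module.End Ω V)
    (hV : Module.finrank Ω V = 3)
    (hJI : ∀ v, J (I v) = I (J v) - J v) {β : Ω} (hβ : β ≠ 0) {v : V} (hv : v ≠ 0)
    (hJ : J v = β • v) :
    ∃ bs : Module.Basis (Fin 3) Ω V, bs 0 = v ∧ bs 1 = I (bs 0) ∧ bs 2 = I (bs 1) := by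
  have hthree : (3 : Ω) = 0 := by exact_mod_cast CharP.cast_eq_zero Ω 3
  refine exists_cyclic_basis I hV v fun c₀ c₁ c₂ h => ?_
  have h1 : J (I v) = β • (I v - v) := by rw [hJI, hJ, map_smul, smul_sub]
  have h2 : J (I (I v)) = β • (I (I v) - (2 : Ω) • I v + v) := by
    rw [hJI, h1, map_smul, map_sub]; module
  have e1 : c₁ • v = c₂ • v + c₂ • I v := by
    have := congrArg J h
    simp only [map_add, map_smul, hJ, h1, h2, map_zero] at this
    have h4 : β • ((c₀ • v + c₁ • I v + c₂ • I (I v)) - c₁ • v - (2 * c₂) • I v + c₂ • v) = 0 := by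
      rw [← this]; module
    rw [h, smul_eq_zero_iff_right hβ] at h4
    have h5 : c₁ • v = c₂ • v + c₂ • I v - ((3 : Ω) * c₂) • I v := by
      have : c₁ • v = c₂ • v + c₂ • I v - ((3 : Ω) * c₂) • I v
        - ((0 : V) - c₁ • v - (2 * c₂) • I v + c₂ • v) := by module
      rwa [h4, sub_zero] at this
    rw [h5, hthree]; simp
  have e2 : c₂ = 0 := by
    have := congrArg J e1
    simp only [map_add, map_smul, hJ, h1] at this
    have h4 : β • (c₁ • v - (c₂ • v + c₂ • I v) + c₂ • v) = 0 := by
      have h5 : β • (c₁ • v - (c₂ • v + c₂ • I v) + c₂ • v) =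
        c₁ • β • v - (c₂ • β • v + c₂ • β • (I v - v)) := by module
      rw [h5, this, sub_self]
    rw [e1, sub_self, zero_add, smul_eq_zero_iff_right hβ, smul_eq_zero_iff_left hv] at h4
    exact h4
  have e3 : c₁ = 0 := by
    rw [e2] at e1
    simpa [hv] using e1
  have e4 : c₀ = 0 := by
    rw [e2, e3] at h
    simpa [hv] using h
  exact ⟨e4, e3, e2⟩
end

section
variable {F A M : Type} [Field F] [Ring A] [Algebra F A] [Field M] [Algebra F M]

theorem isCentral_of_matrix {D : Type*} [Ring D] [Algebra M D] {m : ℕ} [NeZero m]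
    (h : Algebra.IsCentral M (Matrix (Fin m) (Fin m) D)) : Algebra.IsCentral M D := by
  refine ⟨fun c hc => ?_⟩
  rw [Subalgebra.mem_center_iff] at hc
  have : Matrix.scalar (Fin m) c ∈ Subalgebra.center M (Matrix (Fin m) (Fin m) D) := by
    rw [Subalgebra.mem_center_iff]
    intro X
    ext k l
    simp [hc]
  obtain ⟨r, hr⟩ := (Algebra.IsCentral.mem_center_iff M).1 this
  rw [Algebra.mem_bot]
  refine ⟨r, ?_⟩
  have := congrFun (congrFun hr 0) 0
  simpa [Matrix.algebraMap_matrix_apply] using this.symm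

theorem exists_algHom_of_algEquiv_matrix {D Ω : Type} [Ring D] [Algebra M D] [Field Ω]
    [Algebra F Ω] [Algebra M Ω] [IsScalarTower F M Ω] {m q : ℕ}
    (e : M ⊗[F] A ≃ₐ[M] Matrix (Fin m) (Fin m) D) (N : Set Ω)
    (ρ : D →ₐ[M] Matrix (Fin q) (Fin q) Ω) (hρ : ∀ r k l, ρ r k l ∈ N) :
    ∃ ρ' : A →ₐ[F] Matrix (Fin (m * q)) (Fin (m * q)) Ω, ∀ a k l, ρ' a k l ∈ N := by
  let φ : M ⊗[F] A →ₐ[M] Matrix (Fin (m * q)) (Fin (m * q)) Ω :=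
    ((Matrix.reindexAlgEquiv M Ω finProdFinEquiv).toAlgHom.comp
      ((Matrix.compAlgEquiv (Fin m) (Fin q) Ω M).toAlgHom.comp ρ.mapMatrix)).comp e.toAlgHom
  refine ⟨(φ.restrictScalars F).comp Algebra.TensorProduct.includeRight, fun a k l => ?_⟩
  exact hρ _ _ _

variable [Algebra.IsCentral F A] [IsSimpleRing A] [FiniteDimensional F A]

theorem exists_division_action {Ω : Type} [Field Ω] [Algebra F Ω]
    [Algebra M Ω] [IsScalarTower F M Ω] {d q : ℕ} (hd : d ^ 2 = Module.finrank F A)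
    (hidx : HasIndex M (M ⊗[F] A) q) (f : A →ₐ[F] Matrix (Fin d) (Fin d) Ω) :
    ∃ (D : Type) (_ : DivisionRing D) (_ : Algebra M D) (m : ℕ)
      (_ : M ⊗[F] A ≃ₐ[M] Matrix (Fin m) (Fin m) D) (V : Type) (_ : AddCommGroup V)
      (_ : Module Ω V) (h : D →+* Module.End Ω V),
      Algebra.IsCentral M D ∧ Module.finrank M D = q ^ 2 ∧ d = m * q ∧ Module.finrank Ω V = q ∧
      ∀ (c : M) v, h (algebraMap M D c) v = algebraMap M Ω c • v := by
  obtain ⟨D, _, _, m, hm, ⟨e⟩, hD⟩ := hidx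
  have : NeZero m := ⟨hm.ne'⟩
  have hcent : Algebra.IsCentral M (Matrix (Fin m) (Fin m) D) := by
    have := isCentral_baseChange (F := F) (A := A) M
    exact Algebra.IsCentral.of_algEquiv M _ _ e
  have hdm : d = m * q := by
    have h1 := e.toLinearEquiv.finrank_eq
    rw [Module.finrank_matrix, hD, Module.finrank_baseChange, ← hd] at h1
    apply Nat.pow_left_injective (n := 2) (by norm_num)
    change d ^ 2 = (m * q) ^ 2
    rw [h1]; simp; ring
  let φ : M ⊗[F] A →ₐ[M] Matrix (Fin d) (Fin d) Ω :=
    Algebra.TensorProduct.lift (Algebra.ofId M _) f (fun c a => Algebra.commutes c (f a))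
  let g : Matrix (Fin m) (Fin m) D →+* Module.End Ω (Fin d → Ω) :=
    (Matrix.toLinAlgEquiv' (R := Ω) (n := Fin d)).toAlgHom.toRingHom.comp
      (φ.comp e.symm.toAlgHom).toRingHom
  refine ⟨D, inferInstance, inferInstance, m, e, cornerSubmodule g 0, inferInstance,
    inferInstance, cornerAction g 0, isCentral_of_matrix hcent, hD, hdm, ?_, ?_⟩
  · have := finrank_eq_card_mul_finrank_corner g 0
    simp only [Module.finrank_fin_fun, Fintype.card_fin] at this
    exact Nat.eq_of_mul_eq_mul_left hm (this.symm.trans hdm)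
  · intro c v
    ext1
    rw [coe_cornerAction_apply]
    have : Matrix.scalar (Fin m) (algebraMap M D c)
        = algebraMap M (Matrix (Fin m) (Fin m) D) c := rfl
    rw [this]
    change Matrix.toLinAlgEquiv' (φ (e.symm (algebraMap M _ c))) v = _
    rw [AlgEquiv.commutes, AlgHom.commutes,
      IsScalarTower.algebraMap_apply M Ω (Matrix (Fin d) (Fin d) Ω), AlgEquiv.commutes]
    simp [Module.algebraMap_end_apply]

theorem exists_split_adjoin_one [CharP F 3] {Ω : Type} [Field Ω] [IsAlgClosed Ω] [Algebra F Ω]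
    [Algebra M Ω] [IsScalarTower F M Ω] {d : ℕ} (hd : d ^ 2 = Module.finrank F A)
    (hidx : HasIndex M (M ⊗[F] A) 3) (f : A →ₐ[F] Matrix (Fin d) (Fin d) Ω) :
    ∃ β : Ω, β ^ 3 ∈ Set.range (algebraMap M Ω) ∧ ∃ ρ : A →ₐ[F] Matrix (Fin d) (Fin d) Ω,
      ∀ a k l, ρ a k l ∈ IntermediateField.adjoin M {β} := by
  have hM3 : CharP M 3 := charP_of_injective_algebraMap (algebraMap F M).injective 3
  have hΩ3 : CharP Ω 3 := charP_of_injective_algebraMap (algebraMap F Ω).injective 3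
  obtain ⟨D, _, _, m, e, V, _, _, h, _, hD, rfl, hV, hc⟩ := exists_division_action hd hidx f
  obtain ⟨i, j, a, b, hi, hj, hij, hj0, hadj⟩ := exists_cyclic_generators (E := M) (D := D) hD
  obtain ⟨β, hβ⟩ := IsAlgClosed.exists_pow_nat_eq (algebraMap M Ω b) (n := 3) (by norm_num)
  refine ⟨β, ⟨b, hβ.symm⟩, ?_⟩
  have hb0 : b ≠ 0 := by
    rintro rfl
    rw [map_zero] at hj
    exact hj0 (pow_eq_zero_iff (by norm_num) |>.1 hj)
  have hβ0 : β ≠ 0 := by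
    rintro rfl
    rw [zero_pow (by norm_num), eq_comm, map_eq_zero] at hβ
    exact hb0 hβ
  have hnt : Nontrivial V := Module.nontrivial_of_finrank_pos (R := Ω) (by omega)
  have hend : CharP (Module.End Ω V) 3 :=
    charP_of_injective_algebraMap (algebraMap Ω (Module.End Ω V)).injective 3
  obtain ⟨v, hv, hJ⟩ : ∃ v : V, v ≠ 0 ∧ h j v = β • v := by
    by_contra! hne
    have hinj : Function.Injective (h j - algebraMap Ω (Module.End Ω V) β) := by
      rw [injective_iff_map_eq_zero]
      intro v hv
      by_contra hv0
      exact hne v hv0 (sub_eq_zero.1 (by simpa using hv))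
    have hnil : (h j - algebraMap Ω (Module.End Ω V) β) ^ 3 = 0 := by
      rw [sub_pow_char_of_commute (p := 3) (Algebra.commutes β (h j)).symm, ← map_pow, hj,
        ← map_pow, hβ]
      ext v
      simp [hc]
    obtain ⟨v, hv⟩ := exists_ne (0 : V)
    apply hv
    apply (hinj.comp (hinj.comp hinj))
    have := LinearMap.congr_fun hnil v
    simpa [pow_succ] using this
  have hji : ∀ w, h j (h i w) = h i (h j w) - h j w := fun w => by
    rw [← Module.End.mul_apply, ← map_mul, hij]
    simp [sub_mul]
  obtain ⟨bs, h0, h1, h2⟩ := exists_cyclic_basis_of_eigenvector (h i) (h j) hV hji hβ0 hv hJ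
  obtain ⟨ρ, hρ⟩ := exists_algHom_entries_mem hi hij hadj h hc bs h1 h2
    (x := β) (y := 0) (z := 0) (by simp [h0, hJ]) (IntermediateField.adjoin M {β})
    (IntermediateField.mem_adjoin_simple_self M β) (zero_mem _) (zero_mem _)
  exact exists_algHom_of_algEquiv_matrix e (IntermediateField.adjoin M {β} : Set Ω) ρ hρ

theorem exists_algHom_matrix_lift {F A E Ω : Type*} [Field F] [Ring A] [Algebra F A] [Field E]
    [Field Ω] [Algebra F E] [Algebra F Ω] {d : ℕ} (ι : E →ₐ[F] Ω)
    (ρ : A →ₐ[F] Matrix (Fin d) (Fin d) Ω) (h : ∀ a k l, ρ a k l ∈ Set.range ι) :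
    ∃ ρ' : A →ₐ[F] Matrix (Fin d) (Fin d) E, ∀ a k l, ι (ρ' a k l) = ρ a k l := by
  have hinj : Function.Injective (ι.mapMatrix : Matrix (Fin d) (Fin d) E →ₐ[F] _) := by
    intro X Y hXY
    ext k l
    exact ι.injective (congrFun (congrFun hXY k) l)
  choose g hg using h
  let ρ₁ := ρ.codRestrict (ι.mapMatrix : Matrix (Fin d) (Fin d) E →ₐ[F] _).range
    (fun a => ⟨Matrix.of (g a), by ext k l; exact hg a k l⟩)
  refine ⟨(AlgEquiv.ofInjective _ hinj).symm.toAlgHom.comp ρ₁, fun a k l => ?_⟩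
  have := congrArg Subtype.val ((AlgEquiv.ofInjective _ hinj).apply_symm_apply (ρ₁ a))
  exact congrFun (congrFun this k) l

theorem exists_split_adjoin_two [CharP F 3] {Ω : Type} [Field Ω] [Algebra F Ω]
    [Algebra M Ω] [IsScalarTower F M Ω] {d : ℕ} (hd : d ^ 2 = Module.finrank F A)
    (hidx : HasIndex M (M ⊗[F] A) 3) (f : A →ₐ[F] Matrix (Fin d) (Fin d) Ω)
    (E : IntermediateField M Ω) (hE : ∀ t ∈ E, t ^ 3 ∈ Set.range (algebraMap M Ω))
    (hf : ∀ a k l, f a k l ∈ E) :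
    ∃ x₁ ∈ E, ∃ x₂ ∈ E, ∃ ρ : A →ₐ[F] Matrix (Fin d) (Fin d) Ω,
      ∀ a k l, ρ a k l ∈ IntermediateField.adjoin M {x₁, x₂} := by
  have hM3 : CharP M 3 := charP_of_injective_algebraMap (algebraMap F M).injective 3
  have hE3 : CharP E 3 := charP_of_injective_algebraMap (algebraMap F E).injective 3
  obtain ⟨f', -⟩ := exists_algHom_matrix_lift (E.val.restrictScalars F) f
    (fun a k l => ⟨⟨_, hf a k l⟩, rfl⟩)
  obtain ⟨D, _, _, m, e, V, _, _, h, _, hD, rfl, hV, hc⟩ := exists_division_action hd hidx f'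
  obtain ⟨i, j, a, b, hi, hj, hij, hj0, hadj⟩ := exists_cyclic_generators (E := M) (D := D) hD
  have hD3 : CharP D 3 := charP_of_injective_algebraMap (algebraMap M D).injective 3
  have hcube : ∀ t : E, ∃ r : M, algebraMap M E r = t ^ 3 := fun t => by
    obtain ⟨r, hr⟩ := hE t t.2
    exact ⟨r, Subtype.ext hr⟩
  have hroot : ∀ θ : E, θ ^ 3 - θ ≠ algebraMap M E a := by
    intro θ hθ
    obtain ⟨r, hr⟩ := hcube θ
    have hθ' : θ = algebraMap M E (r - a) := by
      rw [map_sub, hr, ← hθ]; ring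
    have hs : (r - a) ^ 3 - (r - a) = a := by
      apply (algebraMap M E).injective
      rw [map_sub, map_pow, ← hθ', hθ]
    set s := r - a
    set w := i - algebraMap M D s with hw
    have hcomm : Commute i (algebraMap M D s) := (Algebra.commutes s i).symm
    have hw3 : w ^ 3 = w := by
      rw [hw, sub_pow_char_of_commute (p := 3) hcomm, ← map_pow, ← sub_eq_zero]
      have : i ^ 3 - algebraMap M D (s ^ 3) - (i - algebraMap M D s)
          = (i ^ 3 - i) - algebraMap M D (s ^ 3 - s) := by
        rw [map_sub (algebraMap M D) (s ^ 3) s]; abel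
      rw [this, hi, hs, sub_self]
    have hprod : w * ((w - 1) * (w + 1)) = 0 := by
      have : w * ((w - 1) * (w + 1)) = w ^ 3 - w := by noncomm_ring
      rw [this, hw3, sub_self]
    have hbot : i ∈ (⊥ : Subalgebra M D) := by
      have hi' : i = w + algebraMap M D s := by rw [hw]; abel
      rw [hi']
      refine Subalgebra.add_mem _ ?_ (Subalgebra.algebraMap_mem _ s)
      rcases mul_eq_zero.1 hprod with h0 | h0
      · rw [h0]; exact Subalgebra.zero_mem _
      · rcases mul_eq_zero.1 h0 with h0 | h0
        · rw [sub_eq_zero.1 h0]; exact Subalgebra.one_mem _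
        · rw [eq_neg_of_add_eq_zero_left h0]
          exact Subalgebra.neg_mem _ (Subalgebra.one_mem _)
    obtain ⟨t, ht⟩ := Algebra.mem_bot.1 hbot
    have h1 : j * i = i * j := by rw [← ht, Algebra.commutes]
    rw [h1, sub_mul, one_mul, eq_comm, sub_eq_self] at hij
    exact hj0 hij
  have hI : ∀ v, h i (h i (h i v)) = h i v + algebraMap M E a • v := fun v => by
    have : i ^ 3 = i + algebraMap M D a := by rw [← hi]; abel
    rw [← Module.End.mul_apply, ← Module.End.mul_apply, ← map_mul, ← map_mul,
      ← pow_three', this, map_add, LinearMap.add_apply, hc]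
  obtain ⟨bs, h1, h2⟩ := exists_cyclic_basis_of_no_root (h i) hV hI hroot
  obtain ⟨x, y, z, hxyz⟩ : ∃ x y z : E, h j (bs 0) = x • bs 0 + y • bs 1 + z • bs 2 :=
    ⟨_, _, _, by rw [← bs.sum_repr (h j (bs 0)), Fin.sum_univ_three]⟩
  have hnorm := norm_eq_of_cyclic_basis hi hj hij h hc bs h1 h2 hxyz
  obtain ⟨x₁, x₂, hx, hy, hz⟩ : ∃ x₁ x₂ : E, x ∈ IntermediateField.adjoin M {x₁, x₂} ∧
      y ∈ IntermediateField.adjoin M {x₁, x₂} ∧ z ∈ IntermediateField.adjoin M {x₁, x₂} := by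
    by_cases hyz : y = 0 ∧ z = 0
    · refine ⟨x, x, IntermediateField.subset_adjoin _ _ (by simp), ?_, ?_⟩
      · rw [hyz.1]; exact zero_mem _
      · rw [hyz.2]; exact zero_mem _
    · set N := IntermediateField.adjoin M {y, z} with hN
      have hy : y ∈ N := IntermediateField.subset_adjoin _ _ (by simp)
      have hz : z ∈ N := IntermediateField.subset_adjoin _ _ (by simp)
      have hx3 : x ^ 3 ∈ N := by
        obtain ⟨r, hr⟩ := hcube x
        rw [← hr]; exact N.algebraMap_mem r
      have ha := N.algebraMap_mem a
      have hb := N.algebraMap_mem b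
      refine ⟨y, z, mem_of_quadratic N hx3 (α := -z) (β := z ^ 2 - y ^ 2)
        (γ := x ^ 3 + algebraMap M E a * y ^ 3 - algebraMap M E a * y * z ^ 2
          + (algebraMap M E a) ^ 2 * z ^ 3 - algebraMap M E b) (neg_mem hz)
        (sub_mem (pow_mem hz 2) (pow_mem hy 2)) ?_ ?_ ?_, hy, hz⟩
      · exact sub_mem (add_mem (sub_mem (add_mem hx3 (mul_mem ha (pow_mem hy 3)))
          (mul_mem (mul_mem ha hy) (pow_mem hz 2))) (mul_mem (pow_mem ha 2) (pow_mem hz 3))) hb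
      · linear_combination hnorm
      · by_contra! hcon
        apply hyz
        have hz0 : z = 0 := by simpa using hcon.1
        refine ⟨?_, hz0⟩
        simpa [hz0] using hcon.2
  obtain ⟨ρ, hρ⟩ := exists_algHom_entries_mem hi hij hadj h hc bs h1 h2 hxyz
    (IntermediateField.adjoin M {x₁, x₂}) hx hy hz
  refine ⟨x₁, x₁.2, x₂, x₂.2, exists_algHom_of_algEquiv_matrix e
    (IntermediateField.adjoin M {(x₁ : Ω), (x₂ : Ω)} : Set Ω)
    (E.val.mapMatrix.comp ρ) fun r k l => ?_⟩
  have hmap : (IntermediateField.adjoin M {x₁, x₂}).map E.val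
      = IntermediateField.adjoin M {(x₁ : Ω), (x₂ : Ω)} := by
    rw [IntermediateField.adjoin_map]
    congr 1
    simp [Set.image_pair]
  rw [SetLike.mem_coe, ← hmap]
  exact ⟨_, hρ r k l, rfl⟩
end

section
variable {E E₁ : Type*} [Field E] [Field E₁] [Algebra E E₁]

theorem exists_derivation_of_pow_basis [CharP E 3] {y : E₁} {b : E} (hy : y ^ 3 = algebraMap E E₁ b)
    (bs : Module.Basis (Fin 3) E E₁) (hbs : ∀ k, bs k = y ^ (k : ℕ)) :
    ∃ δ : Derivation E E₁ E₁, δ y = y ∧ ∀ x, δ x = 0 → x ∈ Set.range (algebraMap E E₁) := by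
  have : CharP E₁ 3 := charP_of_injective_algebraMap (algebraMap E E₁).injective 3
  have h3 : (3 : E₁) = 0 := by exact_mod_cast CharP.cast_eq_zero E₁ 3
  let L : E₁ →ₗ[E] E₁ := bs.constr E fun k : Fin 3 => ((k : ℕ) : E₁) * y ^ (k : ℕ)
  have hLb : ∀ k : Fin 3, L (bs k) = ((k : ℕ) : E₁) * y ^ (k : ℕ) := fun k => by
    simp [L]
  have hL : ∀ m : ℕ, L (y ^ m) = (m : E₁) * y ^ m := by
    intro m
    induction m using Nat.strong_induction_on with
    | _ m ih =>
      by_cases hm : m < 3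
      · have := hLb ⟨m, hm⟩
        rwa [hbs] at this
      · obtain ⟨r, rfl⟩ := Nat.exists_eq_add_of_le (not_lt.1 hm)
        rw [pow_add, hy, ← Algebra.smul_def, map_smul, ih r (by omega), Algebra.smul_def,
          Algebra.smul_def]
        push_cast
        rw [h3]; ring
  have hleib : ∀ x z, L (x * z) = x • L z + z • L x := by
    intro x z
    induction bs.mem_span x using Submodule.span_induction with
    | zero => simp
    | add x x' _ _ h h' => simp only [add_mul, map_add, h, h', smul_eq_mul]; ring
    | smul c x _ h =>
      rw [smul_mul_assoc, map_smul, h, map_smul]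
      simp only [smul_eq_mul, Algebra.smul_def]; ring
    | mem x hx =>
      obtain ⟨k, rfl⟩ := hx
      induction bs.mem_span z using Submodule.span_induction with
      | zero => simp
      | add x x' _ _ h h' => simp only [mul_add, map_add, h, h', smul_eq_mul]; ring
      | smul c x _ h =>
        rw [mul_smul_comm, map_smul, h, map_smul]
        simp only [smul_eq_mul, Algebra.smul_def]; ring
      | mem x hx =>
        obtain ⟨l, rfl⟩ := hx
        rw [hbs, hbs, ← pow_add, hL, hL, hL]
        push_cast
        simp only [smul_eq_mul]; ring
  refine ⟨Derivation.mk' L hleib, ?_, fun x hx => ?_⟩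
  · have := hL 1
    simpa using this
  · replace hx : L x = 0 := hx
    have hsum := bs.sum_repr x
    have hLx : L x = bs.repr x 1 • bs 1 + (2 * bs.repr x 2) • bs 2 := by
      conv_lhs => rw [← hsum, map_sum]
      simp only [Fin.sum_univ_three, map_smul, hLb]
      simp only [hbs, Algebra.smul_def, map_mul]
      simp only [Fin.val_zero, Fin.val_one, Fin.val_two, map_ofNat]
      push_cast
      ring
    have hli := Fintype.linearIndependent_iff.1 bs.linearIndependent
      ![0, bs.repr x 1, 2 * bs.repr x 2] (by
        rw [Fin.sum_univ_three]
        simpa using hLx.symm.trans hx)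
    have h1 : bs.repr x 1 = 0 := by simpa using hli 1
    have h2' : 2 * bs.repr x 2 = 0 := by simpa using hli 2
    have hE3 : (3 : E) = 0 := by exact_mod_cast CharP.cast_eq_zero E 3
    have h2 : bs.repr x 2 = 0 := by linear_combination bs.repr x 2 * hE3 - h2'
    refine ⟨bs.repr x 0, ?_⟩
    conv_rhs => rw [← hsum, Fin.sum_univ_three, h1, h2, hbs]
    simp [Algebra.smul_def]

/-- A derivation of a matrix ring which is linear over the centre is inner. -/
theorem exists_matrix_eq_commutator {n : Type*} [Fintype n] [DecidableEq n] [Nonempty n]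
    (Δ : Matrix n n E₁ →ₗ[E₁] Matrix n n E₁) (hΔ : ∀ x z, Δ (x * z) = Δ x * z + x * Δ z) :
    ∃ m : Matrix n n E₁, ∀ x, m * x - x * m = Δ x := by
  obtain ⟨o⟩ := ‹Nonempty n›
  refine ⟨∑ k, Δ (Matrix.single k o 1) * Matrix.single o k 1, fun x => ?_⟩
  have hone : ∑ k : n, Matrix.single k k (1 : E₁) = 1 := Matrix.sum_single_one
  have hcol : ∀ k, x * Matrix.single k o 1 = ∑ l, x l k • Matrix.single l o (1 : E₁) := by
    intro k
    ext p q
    simp [Matrix.sum_apply, Matrix.single_apply, Matrix.mul_apply]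
    by_cases h : o = q <;> simp [h]
  have hrow : ∀ l, ∑ k, x l k • Matrix.single o k (1 : E₁) = Matrix.single o l 1 * x := by
    intro l
    ext p q
    simp [Matrix.sum_apply, Matrix.single_apply, Matrix.mul_apply]
    by_cases h : o = p <;> simp [h]
  have h1 : ∀ k, x * Δ (Matrix.single k o 1)
      = ∑ l, x l k • Δ (Matrix.single l o 1) - Δ x * Matrix.single k o 1 := by
    intro k
    rw [eq_sub_iff_add_eq', ← hΔ, hcol, map_sum]
    simp only [map_smul]
  have h2 : x * ∑ k, Δ (Matrix.single k o 1) * Matrix.single o k 1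
      = (∑ l, Δ (Matrix.single l o 1) * Matrix.single o l 1) * x - Δ x := by
    rw [Finset.mul_sum]
    simp only [← mul_assoc, h1, sub_mul, Finset.sum_sub_distrib]
    congr 1
    · simp only [Finset.sum_mul]
      rw [Finset.sum_comm]
      refine Finset.sum_congr rfl fun l _ => ?_
      rw [mul_assoc, ← hrow, Finset.mul_sum]
      simp only [smul_mul_assoc, mul_smul_comm]
    · simp only [mul_assoc, Matrix.single_mul_single_same, mul_one, ← Finset.mul_sum, hone]
  rw [h2]; abel
end

section
variable {E E₁ : Type*} [Field E] [Field E₁] [Algebra E E₁]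

/-- The action of a matrix ring over an algebra on column vectors, considered over the base
field. -/
def mulVecAlgHom (E E₁ n : Type*) [Field E] [Ring E₁] [Algebra E E₁] [Fintype n]
    [DecidableEq n] : Matrix n n E₁ →ₐ[E] Module.End E (n → E₁) where
  toFun X :=
    { toFun := X.mulVec
      map_add' := Matrix.mulVec_add X
      map_smul' := fun c v => Matrix.mulVec_smul X c v }
  map_one' := LinearMap.ext Matrix.one_mulVec
  map_mul' X Y := LinearMap.ext fun v => (Matrix.mulVec_mulVec v X Y).symm
  map_zero' := by ext; simp
  map_add' X Y := by ext; simp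
  commutes' c := by
    ext v k
    simp [Matrix.algebraMap_eq_diagonal, Matrix.mulVec_diagonal, Algebra.smul_def]

@[simp]
theorem mulVecAlgHom_apply {n : Type*} [Fintype n] [DecidableEq n] (X : Matrix n n E₁)
    (v : n → E₁) : mulVecAlgHom E E₁ n X v = X.mulVec v := rfl

theorem Derivation.map_mulVec {n : Type*} [Fintype n] (δ : Derivation E E₁ E₁)
    (X : Matrix n n E₁) (v : n → E₁) :
    (fun k => δ (X.mulVec v k)) = (X.map δ).mulVec v + X.mulVec (fun k => δ (v k)) := by
  ext k
  simp [Matrix.mulVec, dotProduct, map_sum, Finset.sum_add_distrib, mul_comm, add_comm]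

theorem exists_matrix_eq_derivation {B κ n : Type*} [Semiring B] [Algebra E B] [Fintype κ] [Fintype n]
    [DecidableEq n] [Nonempty n] (δ : Derivation E E₁ E₁) (β : Module.Basis κ E B)
    (Ψ : B →ₐ[E] Matrix n n E₁) (bs : Module.Basis κ E₁ (Matrix n n E₁))
    (hbs : ∀ s, bs s = Ψ (β s)) :
    ∃ m : Matrix n n E₁, ∀ x, m * Ψ x - Ψ x * m = (Ψ x).map δ := by
  classical
  let D : Matrix n n E₁ →ₗ[E] Matrix n n E₁ :=
    { toFun := fun X => ∑ s, δ (bs.repr X s) • bs s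
      map_add' := fun X Y => by simp [add_smul, Finset.sum_add_distrib]
      map_smul' := fun c X => by
        have h : bs.repr (c • X) = algebraMap E E₁ c • bs.repr X := by
          rw [← algebraMap_smul E₁ c X, map_smul]
        rw [RingHom.id_apply, Finset.smul_sum]
        refine Finset.sum_congr rfl fun s _ => ?_
        rw [h, Finsupp.smul_apply, algebraMap_smul, δ.map_smul, smul_assoc] }
  have hDΨ : ∀ (a : E₁) x, D (a • Ψ x) = δ a • Ψ x := by
    intro a x
    have hx : Ψ x = ∑ s, algebraMap E E₁ (β.repr x s) • bs s := by
      conv_lhs => rw [← β.sum_repr x, map_sum]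
      simp [hbs]
    have hr : ∀ s, bs.repr (Ψ x) s = algebraMap E E₁ (β.repr x s) := fun s => by
      rw [hx, bs.repr_sum_self]
    have : D (a • Ψ x) = ∑ s, δ (a * algebraMap E E₁ (β.repr x s)) • bs s := by
      simp [D, hr]
    rw [this, hx, Finset.smul_sum]
    refine Finset.sum_congr rfl fun s _ => ?_
    rw [smul_smul, Derivation.leibniz, Derivation.map_algebraMap]
    simp [mul_comm]
  have hDsmul : ∀ (a : E₁) X, D (a • X) = δ a • X + a • D X := by
    intro a X
    have : D (a • X) = ∑ s, δ (a * bs.repr X s) • bs s := by simp [D]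
    rw [this]
    conv_rhs => enter [1, 2]; rw [← bs.sum_repr X]
    have h : D X = ∑ s, δ (bs.repr X s) • bs s := rfl
    rw [h, Finset.smul_sum, Finset.smul_sum, ← Finset.sum_add_distrib]
    refine Finset.sum_congr rfl fun s _ => ?_
    rw [Derivation.leibniz, smul_smul, smul_smul, ← add_smul]
    simp only [smul_eq_mul]
    congr 1
    ring
  have hDmul : ∀ X Y, D (X * Y) = D X * Y + X * D Y := by
    intro X Y
    induction bs.mem_span X using Submodule.span_induction with
    | zero => simp
    | add X X' _ _ h h' => simp only [add_mul, map_add, h, h']; abel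
    | smul c X _ h =>
      rw [smul_mul_assoc, hDsmul, h, hDsmul]
      simp only [add_mul, smul_mul_assoc, smul_add, add_assoc]
    | mem X hX =>
      obtain ⟨s, rfl⟩ := hX
      have hD0 : ∀ x, D (Ψ x) = 0 := fun x => by simpa using hDΨ 1 x
      rw [hbs, hD0, zero_mul, zero_add]
      induction bs.mem_span Y using Submodule.span_induction with
      | zero => simp
      | add X X' _ _ h h' => simp only [mul_add, map_add, h, h']
      | smul c X _ h =>
        rw [mul_smul_comm, hDsmul, h, hDsmul]
        simp only [mul_add, mul_smul_comm]
      | mem Y hY =>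
        obtain ⟨t, rfl⟩ := hY
        rw [hbs, ← map_mul, hD0, hD0, mul_zero]
  let Δ : Matrix n n E₁ →ₗ[E₁] Matrix n n E₁ :=
    { toFun := fun X => X.map δ - D X
      map_add' := fun X Y => by ext; simp; ring
      map_smul' := fun c X => by
        rw [hDsmul]
        ext; simp; ring }
  obtain ⟨m, hm⟩ := exists_matrix_eq_commutator Δ (fun X Y => by
    change (X * Y).map δ - D (X * Y) = (X.map δ - D X) * Y + X * (Y.map δ - D Y)
    have : (X * Y).map δ = X.map δ * Y + X * Y.map δ := by
      ext k l
      simp [Matrix.mul_apply, map_sum, Finset.sum_add_distrib, mul_comm, add_comm]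
    rw [this, hDmul]; noncomm_ring)
  refine ⟨m, fun x => ?_⟩
  rw [hm]
  have := hDΨ 1 x
  simp only [one_smul, Derivation.map_one_eq_zero, zero_smul] at this
  change (Ψ x).map δ - D (Ψ x) = _
  rw [this, sub_zero]


theorem exists_cyclic_pair [CharP E 3] {y : E₁} {b : E} (hy : y ^ 3 = algebraMap E E₁ b)
    (yb : Module.Basis (Fin 3) E E₁) (hyb : ∀ k, yb k = y ^ (k : ℕ))
    {B κ n : Type*} [Semiring B] [Algebra E B] [Fintype κ] [Fintype n]
    [DecidableEq n] [Nonempty n] (β : Module.Basis κ E B)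
    (Ψ : B →ₐ[E] Matrix n n E₁) (bs : Module.Basis κ E₁ (Matrix n n E₁))
    (hbs : ∀ s, bs s = Ψ (β s)) :
    ∃ (i j : Module.End E (n → E₁)) (c : E), i ^ 3 - i = algebraMap E _ c ∧
      j ^ 3 = algebraMap E _ b ∧ j * i = (i - 1) * j ∧
      (∀ x, Commute i (mulVecAlgHom E E₁ n (Ψ x))) ∧
      ∀ X, Commute j (mulVecAlgHom E E₁ n X) := by
  obtain ⟨δ, hδy, hδ0⟩ := exists_derivation_of_pow_basis hy yb hyb
  obtain ⟨m, hm⟩ := exists_matrix_eq_derivation δ β Ψ bs hbs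
  let θ := mulVecAlgHom E E₁ n
  let d : Module.End E (n → E₁) :=
    { toFun := fun v k => δ (v k)
      map_add' := fun v w => by ext; simp
      map_smul' := fun c v => by ext; simp }
  have hd : ∀ X, d * θ X = θ (X.map δ) + θ X * d := fun X => by
    apply LinearMap.ext
    intro v
    exact δ.map_mulVec X v
  let i : Module.End E (n → E₁) := d - θ m
  let j : Module.End E (n → E₁) := θ (algebraMap E₁ _ y)
  have : CharP E₁ 3 := charP_of_injective_algebraMap (algebraMap E E₁).injective 3
  have hscal : ∀ (c : E₁) X, Commute (θ (algebraMap E₁ _ c)) (θ X) := fun c X =>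
    (Algebra.commute_algebraMap_left c X).map θ
  have hδc : ∀ c : E₁, (algebraMap E₁ (Matrix n n E₁) c).map δ = algebraMap E₁ _ (δ c) := by
    intro c
    ext k l
    by_cases hkl : k = l <;> simp [Matrix.algebraMap_matrix_apply, hkl]
  have hic : ∀ c, i * θ (algebraMap E₁ _ c)
      = θ (algebraMap E₁ _ (δ c)) + θ (algebraMap E₁ _ c) * i := by
    intro c
    simp only [i]
    rw [sub_mul, hd, hδc, mul_sub, (hscal c m).eq]; abel
  have hij : j * i = (i - 1) * j := by
    rw [sub_mul, hic, hδy, one_mul]; abel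
  have hiΨ : ∀ x, Commute i (θ (Ψ x)) := by
    intro x
    simp only [i, commute_iff_eq]
    rw [sub_mul, hd, ← hm, map_sub, map_mul, map_mul, mul_sub]; abel
  have hchar : CharP (Module.End E (n → E₁)) 3 :=
    charP_of_injective_algebraMap (algebraMap E _).injective 3
  have hjz : Commute j (i ^ 3 - i) := by
    have h1 : j * i ^ 3 = (i - 1) ^ 3 * j := by
      have : SemiconjBy j i (i - 1) := hij
      exact this.pow_right 3
    rw [sub_pow_char_of_commute (p := 3) (Commute.one_right i), one_pow] at h1
    rw [commute_iff_eq, mul_sub, h1, hij, ← sub_mul, sub_sub_sub_cancel_right]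
  set z := i ^ 3 - i with hz
  have hziΨ : ∀ x, Commute z (θ (Ψ x)) := fun x => ((hiΨ x).pow_left 3).sub_left (hiΨ x)
  have hzc : ∀ c, Commute z (θ (algebraMap E₁ _ c)) := by
    intro c
    induction yb.mem_span c using Submodule.span_induction with
    | zero => simp
    | add x x' _ _ h h' => simpa using h.add_right h'
    | smul r x _ h =>
      have : θ (algebraMap E₁ _ (r • x)) = r • θ (algebraMap E₁ _ x) := by
        rw [← map_smul]
        congr 1
        ext; simp [Matrix.algebraMap_matrix_apply]
      rw [this]
      exact h.smul_right r
    | mem x hx =>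
      obtain ⟨k, rfl⟩ := hx
      rw [hyb, map_pow, map_pow]
      exact hjz.symm.pow_right _
  have hzX : ∀ X, Commute z (θ X) := by
    intro X
    induction bs.mem_span X using Submodule.span_induction with
    | zero => simp
    | add x x' _ _ h h' => simpa using h.add_right h'
    | smul r x _ h =>
      rw [Algebra.smul_def, map_mul]
      exact (hzc r).mul_right h
    | mem x hx =>
      obtain ⟨k, rfl⟩ := hx
      rw [hbs]
      exact hziΨ _
  obtain ⟨c₁, hc₁⟩ : ∃ c₁ : E₁, z = θ (algebraMap E₁ _ c₁) := by
    let z' : (n → E₁) →ₗ[E₁] (n → E₁) :=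
      { toFun := z
        map_add' := map_add z
        map_smul' := fun c v => by
          have := LinearMap.congr_fun (hzc c) v
          simpa [θ, Algebra.algebraMap_eq_smul_one, Matrix.smul_mulVec] using this }
    have hθ : θ (LinearMap.toMatrix' z') = z := by
      apply LinearMap.ext
      intro v
      simp only [θ, mulVecAlgHom_apply, LinearMap.toMatrix'_mulVec]
      rfl
    have hinj : Function.Injective θ := RingHom.injective θ.toRingHom
    obtain ⟨c₁, hc₁⟩ := Matrix.mem_range_scalar_of_commute_single (M := LinearMap.toMatrix' z')
      (fun k l _ => by
        apply hinj
        rw [map_mul, map_mul, hθ]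
        exact (hzX _).symm.eq)
    refine ⟨c₁, ?_⟩
    rw [← hθ, ← hc₁]
    rfl
  obtain ⟨c, rfl⟩ := hδ0 c₁ (by
    have h1 : Commute i z := ((Commute.refl i).pow_right 3).sub_right (Commute.refl i)
    have h2 := hic c₁
    rw [← hc₁, h1.eq] at h2
    have h3 : θ (algebraMap E₁ _ (δ c₁)) = 0 := by simpa using h2
    obtain ⟨o⟩ := ‹Nonempty n›
    have := congrFun (LinearMap.congr_fun h3 (Pi.single o 1)) o
    simpa [θ, Matrix.algebraMap_matrix_apply] using this)
  refine ⟨i, j, c, ?_, ?_, hij, hiΨ, hscal y⟩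
  · rw [← hz, hc₁, ← IsScalarTower.algebraMap_apply, AlgHom.commutes]
  · simp only [j]
    rw [← map_pow, ← map_pow, hy, ← IsScalarTower.algebraMap_apply, AlgHom.commutes]
end

theorem List.prod_ofFn_mul {R : Type*} [Monoid R] {k : ℕ} (x y : Fin k → R)
    (h : ∀ s t, s ≠ t → Commute (x s) (y t)) :
    (List.ofFn fun t => x t * y t).prod = (List.ofFn x).prod * (List.ofFn y).prod := by
  induction k with
  | zero => simp
  | succ k ih =>
    simp only [List.ofFn_succ, List.prod_cons]
    rw [ih _ _ fun s t hst => h _ _ (by simpa using hst)]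
    have hc : Commute (List.ofFn fun t : Fin k => x t.succ).prod (y 0) := by
      apply Commute.list_prod_left
      intro z hz
      obtain ⟨t, rfl⟩ := List.mem_ofFn.1 hz
      exact h _ _ (Fin.succ_ne_zero t)
    simp only [mul_assoc]
    rw [← mul_assoc (y 0), ← hc.eq, mul_assoc]

/-- Pairwise commuting pairs of elements satisfying the relations of the symbol algebras
`[c t, b t)`. -/
structure IsSymbolFamily {E R : Type*} [Field E] [Ring R] [Algebra E R] {k : ℕ}
    (i j : Fin k → R) (c b : Fin k → E) : Prop where
  pow_sub : ∀ t, i t ^ 3 - i t = algebraMap E R (c t)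
  pow : ∀ t, j t ^ 3 = algebraMap E R (b t)
  ne_zero : ∀ t, b t ≠ 0
  mul : ∀ t, j t * i t = (i t - 1) * j t
  commute_left : ∀ s t, s ≠ t → Commute (i s) (i t)
  commute_mixed : ∀ s t, s ≠ t → Commute (i s) (j t)
  commute_right : ∀ s t, s ≠ t → Commute (j s) (j t)

namespace IsSymbolFamily
variable {E R : Type*} [Field E] [Ring R] [Algebra E R] {k : ℕ} {i j : Fin k → R} {c b : Fin k → E}

theorem isUnit_right (h : IsSymbolFamily i j c b) (t : Fin k) : IsUnit (j t) := by
  have : IsUnit (j t ^ 3) := by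
    rw [h.pow]
    exact (h.ne_zero t).isUnit.map (algebraMap E R)
  exact (isUnit_pow_iff (by norm_num)).1 this

theorem commute_adjoin (h : IsSymbolFamily i j c b) {s t : Fin k} (hst : s ≠ t) {x y : R}
    (hx : x ∈ Algebra.adjoin E {i s, j s}) (hy : y ∈ Algebra.adjoin E {i t, j t}) :
    Commute x y := by
  have h1 : ∀ z ∈ ({i t, j t} : Set R), Commute x z := by
    intro z hz
    refine (Algebra.commute_of_mem_adjoin_of_forall_mem_commute hx ?_).symm
    intro w hw
    rcases hz with rfl | rfl <;> rcases hw with rfl | rfl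
    · exact h.commute_left _ _ hst.symm
    · exact h.commute_mixed _ _ hst.symm
    · exact (h.commute_mixed _ _ hst).symm
    · exact h.commute_right _ _ hst.symm
  exact Algebra.commute_of_mem_adjoin_of_forall_mem_commute hy h1

/-- The subalgebra generated by a pair of a symbol family. -/
abbrev factor (E : Type*) [Field E] [Algebra E R] (i j : Fin k → R) (t : Fin k) :
    Subalgebra E R :=
  Algebra.adjoin E {i t, j t}

/-- The algebra homomorphism from the tensor product of the factors of a symbol family. -/
noncomputable def tensorHom (h : IsSymbolFamily i j c b) :
    (⨂[E] t, factor E i j t) →ₐ[E] R :=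
  PiTensorProduct.liftAlgHom
    ((MultilinearMap.mkPiAlgebraFin E k R).compLinearMap
      fun t => (factor E i j t).val.toLinearMap)
    (by simp [MultilinearMap.mkPiAlgebraFin_apply])
    (fun x y => by
      simp only [MultilinearMap.compLinearMap_apply, MultilinearMap.mkPiAlgebraFin_apply,
        Pi.mul_apply, AlgHom.toLinearMap_apply, map_mul]
      exact List.prod_ofFn_mul _ _ fun s t hst => h.commute_adjoin hst (x s).2 (y t).2)

theorem tensorHom_tprod (h : IsSymbolFamily i j c b) (x : ∀ t, factor E i j t) :
    h.tensorHom (PiTensorProduct.tprod E x) = (List.ofFn fun t => (x t : R)).prod := by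
  simp [tensorHom, MultilinearMap.mkPiAlgebraFin_apply]

theorem commute_tensorHom (h : IsSymbolFamily i j c b) {z : R} (hi : ∀ t, Commute z (i t))
    (hj : ∀ t, Commute z (j t)) (x : ⨂[E] t, factor E i j t) : Commute z (h.tensorHom x) := by
  induction x using PiTensorProduct.induction_on with
  | smul_tprod r x =>
    rw [map_smul, tensorHom_tprod]
    refine Commute.smul_right (Commute.list_prod_right _ _ fun w hw => ?_) r
    obtain ⟨t, rfl⟩ := List.mem_ofFn.1 hw
    refine Algebra.commute_of_mem_adjoin_of_forall_mem_commute (x t).2 ?_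
    rintro w (rfl | rfl)
    exacts [hi t, hj t]
  | add x y hx hy => rw [map_add]; exact hx.add_right hy

variable [CharP R 3]

theorem exists_basis_factor (h : IsSymbolFamily i j c b) (t : Fin k) :
    ∃ bs : Module.Basis (Fin 3 × Fin 3) E (factor E i j t),
      ∀ q, (bs q : R) = i t ^ (q.1 : ℕ) * j t ^ (q.2 : ℕ) := by
  have hmem : ∀ q : Fin 3 × Fin 3, i t ^ (q.1 : ℕ) * j t ^ (q.2 : ℕ) ∈ factor E i j t := fun q =>
    mul_mem (pow_mem (Algebra.subset_adjoin (by simp)) _)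
      (pow_mem (Algebra.subset_adjoin (by simp)) _)
  let v : Fin 3 × Fin 3 → factor E i j t := fun q => ⟨_, hmem q⟩
  have hv : LinearIndependent E v := by
    apply LinearIndependent.of_comp (factor E i j t).val.toLinearMap
    exact linearIndependent_pow_mul_pow (h.mul t) (h.isUnit_right t)
  have hsp : ⊤ ≤ Submodule.span E (Set.range v) := by
    rintro ⟨x, hx⟩ -
    have := mem_span_pow_mul_pow (h.mul t) (h.pow_sub t) (h.pow t) hx
    have hr : (Set.range fun q : Fin 3 × Fin 3 => i t ^ (q.1 : ℕ) * j t ^ (q.2 : ℕ))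
        = (factor E i j t).val.toLinearMap '' Set.range v := by
      rw [← Set.range_comp]; rfl
    rw [hr, Submodule.span_image] at this
    obtain ⟨y, hy, hxy⟩ := this
    have hyx : y = ⟨x, hx⟩ := Subtype.ext hxy
    exact hyx ▸ hy
  exact ⟨Module.Basis.mk hv hsp, fun q => by simp [v]⟩

theorem isCyclicPAlg_factor {E R : Type} [Field E] [Ring R] [Algebra E R] {k : ℕ} {i j : Fin k → R}
    {c b : Fin k → E} [CharP R 3] (h : IsSymbolFamily i j c b) (t : Fin k) :
    IsCyclicPAlg 3 E (factor E i j t) := by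
  obtain ⟨bs, -⟩ := h.exists_basis_factor t
  have hi : i t ∈ factor E i j t := Algebra.subset_adjoin (by simp)
  have hj : j t ∈ factor E i j t := Algebra.subset_adjoin (by simp)
  refine ⟨c t, b t, h.ne_zero t, ?_, ⟨i t, hi⟩, ⟨j t, hj⟩, ?_, ?_, ?_, ?_⟩
  · rw [Module.finrank_eq_card_basis bs]; simp
  · exact Subtype.ext (h.pow_sub t)
  · exact Subtype.ext (h.pow t)
  · exact Subtype.ext (h.mul t)
  · rw [← Algebra.adjoin_adjoin_coe_preimage]
    congr 1
    ext x
    simp [Subtype.ext_iff]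

theorem linearIndependent_prod {E' ι : Type*} [Field E'] [Algebra E' R] {u : ι → R}
    (h : IsSymbolFamily i j c b) (hu : LinearIndependent E' u)
    (hui : ∀ s t, Commute (u s) (i t)) (huj : ∀ s t, Commute (u s) (j t)) :
    LinearIndependent E' fun q : ι × (Fin k → Fin 3 × Fin 3) =>
      u q.1 * (List.ofFn fun t => i t ^ ((q.2 t).1 : ℕ) * j t ^ ((q.2 t).2 : ℕ)).prod := by
  induction k generalizing ι with
  | zero =>
    simpa [Function.comp_def] using hu.comp (fun q : ι × (Fin 0 → Fin 3 × Fin 3) => q.1)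
      (fun q q' hq => Prod.ext hq (Subsingleton.elim _ _))
  | succ k ih =>
    have hu' := LinearIndependent.mul_pow_mul_pow (h.mul 0) (h.isUnit_right 0) hu
      (fun s => hui s 0) (fun s => huj s 0)
    have h' : IsSymbolFamily (fun t : Fin k => i t.succ) (fun t => j t.succ) (fun t => c t.succ)
        (fun t => b t.succ) :=
      ⟨fun t => h.pow_sub _, fun t => h.pow _, fun t => h.ne_zero _, fun t => h.mul _,
        fun s t hst => h.commute_left _ _ (by simpa using hst),
        fun s t hst => h.commute_mixed _ _ (by simpa using hst),
        fun s t hst => h.commute_right _ _ (by simpa using hst)⟩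
    have hne : ∀ t : Fin k, (0 : Fin (k + 1)) ≠ t.succ := fun t => (Fin.succ_ne_zero t).symm
    have := ih h' hu'
      (fun s t => (hui _ _).mul_left (((h.commute_left _ _ (hne t)).pow_left _).mul_left
        ((h.commute_mixed _ _ (hne t).symm).symm.pow_left _)))
      (fun s t => (huj _ _).mul_left (((h.commute_mixed _ _ (hne t)).pow_left _).mul_left
        ((h.commute_right _ _ (hne t)).pow_left _)))
    let e : ι × (Fin (k + 1) → Fin 3 × Fin 3) → (ι × (Fin 3 × Fin 3)) × (Fin k → Fin 3 × Fin 3) :=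
      fun q => ((q.1, q.2 0), fun t => q.2 t.succ)
    have he : Function.Injective e := by
      rintro ⟨s, q⟩ ⟨s', q'⟩ hq
      simp only [e, Prod.mk.injEq] at hq
      obtain ⟨⟨rfl, h0⟩, h1⟩ := hq
      refine Prod.ext rfl (funext fun t => ?_)
      refine Fin.cases h0 (fun t => congrFun h1 t) t
    convert this.comp e he using 1
    funext q
    simp [e, List.ofFn_succ, mul_assoc]

/-- The homomorphism to the ambient ring from the tensor product of a commuting algebra with the
factors of a symbol family. -/
theorem exists_basis_tensor {C ι : Type*} [Ring C] [Algebra E C] (h : IsSymbolFamily i j c b)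
    (f : C →ₐ[E] R) (hfi : ∀ x t, Commute (f x) (i t)) (hfj : ∀ x t, Commute (f x) (j t))
    (bC : Module.Basis ι E C) {E' : Type*} [Field E'] [Algebra E' R]
    (hf : LinearIndependent E' fun s => f (bC s)) :
    ∃ (Φ : C ⊗[E] (⨂[E] t, factor E i j t) →ₐ[E] R)
      (β : Module.Basis (ι × (Fin k → Fin 3 × Fin 3)) E (C ⊗[E] (⨂[E] t, factor E i j t))),
      (∀ x, Φ (x ⊗ₜ 1) = f x) ∧ (∀ x, Φ (1 ⊗ₜ x) = h.tensorHom x) ∧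
      LinearIndependent E' fun q => Φ (β q) := by
  choose bs hbs using h.exists_basis_factor
  let Φ := Algebra.TensorProduct.lift f h.tensorHom
    fun x y => h.commute_tensorHom (hfi x) (hfj x) y
  refine ⟨Φ, bC.tensorProduct (Basis.piTensorProduct bs), ?_, ?_, ?_⟩
  · intro x; simp [Φ]
  · intro x; simp [Φ]
  · convert h.linearIndependent_prod hf (fun s t => hfi _ t) (fun s t => hfj _ t) using 1
    funext q
    obtain ⟨s, q⟩ := q
    rw [Module.Basis.tensorProduct_apply]
    simp [Φ, tensorHom_tprod, hbs]

end IsSymbolFamily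

theorem List.prod_ofFn_ite {R : Type*} [Monoid R] {k : ℕ} (t : Fin k) (x : R) :
    (List.ofFn fun s => if s = t then x else 1).prod = x := by
  induction k with
  | zero => exact t.elim0
  | succ k ih =>
    rw [List.ofFn_succ, List.prod_cons]
    refine Fin.cases ?_ (fun t => ?_) t
    · simp [Fin.succ_ne_zero]
    · simpa [(Fin.succ_ne_zero t).symm] using ih t

theorem IsSymbolFamily.mem_range_tensorHom {E R : Type*} [Field E] [Ring R] [Algebra E R] {k : ℕ}
    {i j : Fin k → R} {c b : Fin k → E} (h : IsSymbolFamily i j c b) (t : Fin k) {x : R}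
    (hx : x ∈ factor E i j t) : ∃ z, h.tensorHom z = x := by
  refine ⟨PiTensorProduct.tprod E fun s => if hs : s = t then ⟨x, hs ▸ hx⟩ else 1, ?_⟩
  rw [tensorHom_tprod]
  conv_rhs => rw [← List.prod_ofFn_ite t x]
  congr 2
  funext s
  split_ifs <;> rfl

theorem IsSymbolFamily.map {E R R' : Type*} [Field E] [Ring R] [Algebra E R] [Ring R']
    [Algebra E R'] {k : ℕ} {i j : Fin k → R} {c b : Fin k → E} (h : IsSymbolFamily i j c b)
    (f : R →ₐ[E] R') : IsSymbolFamily (fun t => f (i t)) (fun t => f (j t)) c b where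
  pow_sub t := by rw [← map_pow, ← map_sub, h.pow_sub, AlgHom.commutes]
  pow t := by rw [← map_pow, h.pow, AlgHom.commutes]
  ne_zero := h.ne_zero
  mul t := by rw [← map_mul, h.mul, map_mul, map_sub, map_one]
  commute_left s t hst := (h.commute_left s t hst).map f
  commute_mixed s t hst := (h.commute_mixed s t hst).map f
  commute_right s t hst := (h.commute_right s t hst).map f

theorem IsSymbolFamily.cons {E R : Type*} [Field E] [Ring R] [Algebra E R] {k : ℕ}
    {i j : Fin k → R} {c b : Fin k → E} (h : IsSymbolFamily i j c b) {i₀ j₀ : R} {c₀ b₀ : E}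
    (hi : i₀ ^ 3 - i₀ = algebraMap E R c₀) (hj : j₀ ^ 3 = algebraMap E R b₀) (hb : b₀ ≠ 0)
    (hij : j₀ * i₀ = (i₀ - 1) * j₀) (hii : ∀ t, Commute i₀ (i t)) (hij' : ∀ t, Commute i₀ (j t))
    (hji : ∀ t, Commute j₀ (i t)) (hjj : ∀ t, Commute j₀ (j t)) :
    IsSymbolFamily (Fin.cons i₀ i : Fin (k + 1) → R) (Fin.cons j₀ j : Fin (k + 1) → R)
      (Fin.cons c₀ c : Fin (k + 1) → E) (Fin.cons b₀ b : Fin (k + 1) → E) where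
  pow_sub t := by
    refine Fin.cases ?_ (fun t => ?_) t
    · simpa using hi
    · simpa using h.pow_sub t
  pow t := by
    refine Fin.cases ?_ (fun t => ?_) t
    · simpa using hj
    · simpa using h.pow t
  ne_zero t := by
    refine Fin.cases ?_ (fun t => ?_) t
    · simpa using hb
    · simpa using h.ne_zero t
  mul t := by
    refine Fin.cases ?_ (fun t => ?_) t
    · simpa using hij
    · simpa using h.mul t
  commute_left s t := by
    refine Fin.cases (Fin.cases ?_ (fun t => ?_) t) (fun s => Fin.cases ?_ (fun t => ?_) t) s
    · simp
    · simpa using fun _ => hii t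
    · simpa using (hii s).symm
    · simpa using h.commute_left s t
  commute_mixed s t := by
    refine Fin.cases (Fin.cases ?_ (fun t => ?_) t) (fun s => Fin.cases ?_ (fun t => ?_) t) s
    · simp
    · simpa using fun _ => hij' t
    · simpa using (hji s).symm
    · simpa using h.commute_mixed s t
  commute_right s t := by
    refine Fin.cases (Fin.cases ?_ (fun t => ?_) t) (fun s => Fin.cases ?_ (fun t => ?_) t) s
    · simp
    · simpa using fun _ => hjj t
    · simpa using (hjj s).symm
    · simpa using h.commute_right s t

/-- Over `E`, the tensor product of `A` with `k` symbol algebras whose second slots are in `F` is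
split, as witnessed by matrices of size `d * 3 ^ k`. -/
def IsSplitBySymbols (F A E : Type*) [Field F] [Ring A] [Algebra F A] [Field E] [Algebra F E]
    (d k : ℕ) : Prop :=
  ∃ (ρ : A →ₐ[F] Matrix (Fin (d * 3 ^ k)) (Fin (d * 3 ^ k)) E)
    (i j : Fin k → Matrix (Fin (d * 3 ^ k)) (Fin (d * 3 ^ k)) E) (c : Fin k → E) (b : Fin k → F),
    IsSymbolFamily i j c (fun t => algebraMap F E (b t)) ∧
      (∀ x t, Commute (ρ x) (i t)) ∧ ∀ x t, Commute (ρ x) (j t)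

section
variable {F A E : Type*} [Field F] [Ring A] [Algebra F A] [Field E] [Algebra F E]

theorem IsSplitBySymbols.map {E' : Type*} [Field E'] [Algebra F E'] {d k : ℕ}
    (h : IsSplitBySymbols F A E d k) (φ : E →ₐ[F] E') : IsSplitBySymbols F A E' d k := by
  obtain ⟨ρ, i, j, c, b, hs, hi, hj⟩ := h
  have hφ : ∀ x, φ.mapMatrix (m := Fin (d * 3 ^ k)) (algebraMap E _ x) = algebraMap E' _ (φ x) := by
    intro x
    ext k l
    by_cases hkl : k = l <;> simp [Matrix.algebraMap_matrix_apply, hkl]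
  refine ⟨φ.mapMatrix.comp ρ, fun t => φ.mapMatrix (i t), fun t => φ.mapMatrix (j t),
    fun t => φ (c t), b, ⟨?_, ?_, ?_, ?_, ?_, ?_, ?_⟩, fun x t => (hi x t).map φ.mapMatrix,
    fun x t => (hj x t).map φ.mapMatrix⟩
  · intro t
    rw [← map_pow, ← map_sub, hs.pow_sub, hφ]
  · intro t
    rw [← map_pow, hs.pow, hφ, AlgHom.commutes]
  · intro t
    have := hs.ne_zero t
    simpa using this
  · intro t
    rw [← map_mul, hs.mul, map_mul, map_sub, map_one]
  · exact fun s t hst => (hs.commute_left s t hst).map φ.mapMatrix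
  · exact fun s t hst => (hs.commute_mixed s t hst).map φ.mapMatrix
  · exact fun s t hst => (hs.commute_right s t hst).map φ.mapMatrix

theorem pow_three_mem_range_of_pow_basis {E E₁ : Type*} [Field E] [Field E₁] [Algebra E E₁]
    [CharP E 3] {y : E₁} {b : E} (hy : y ^ 3 = algebraMap E E₁ b)
    (yb : Module.Basis (Fin 3) E E₁) (hyb : ∀ k, yb k = y ^ (k : ℕ)) (x : E₁) :
    x ^ 3 ∈ Set.range (algebraMap E E₁) := by
  have : CharP E₁ 3 := charP_of_injective_algebraMap (algebraMap E E₁).injective 3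
  change x ^ 3 ∈ (algebraMap E E₁).range
  induction yb.mem_span x using Submodule.span_induction with
  | zero => simp
  | add x z _ _ hx hz => rw [add_pow_char (p := 3)]; exact add_mem hx hz
  | smul r x _ hx =>
    rw [smul_pow, Algebra.smul_def]
    exact mul_mem ⟨_, rfl⟩ hx
  | mem x hx =>
    obtain ⟨k, rfl⟩ := hx
    rw [hyb, ← pow_mul, mul_comm, pow_mul, hy, ← map_pow]
    exact ⟨_, rfl⟩

theorem IsSplitBySymbols.descend [Algebra.IsCentral F A] [IsSimpleRing A] [FiniteDimensional F A]
    [CharP F 3] {d k : ℕ} (hd : d ^ 2 = Module.finrank F A) {E₁ : Type*} [Field E₁]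
    [Algebra F E₁] [Algebra E E₁] [IsScalarTower F E E₁] {y : E₁} {a : F}
    (hy : y ^ 3 = algebraMap F E₁ a) (hy0 : y ≠ 0)
    (yb : Module.Basis (Fin 3) E E₁) (hyb : ∀ k, yb k = y ^ (k : ℕ))
    (h : IsSplitBySymbols F A E₁ d k) : IsSplitBySymbols F A E d (k + 1) := by
  have hE3 : CharP E 3 := charP_of_injective_algebraMap (algebraMap F E).injective 3
  have hE13 : CharP E₁ 3 := charP_of_injective_algebraMap (algebraMap F E₁).injective 3
  have hyE : y ^ 3 = algebraMap E E₁ (algebraMap F E a) := by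
    rw [hy, ← IsScalarTower.algebraMap_apply]
  have hdpos : 0 < d := by
    have : 0 < Module.finrank F A := Module.finrank_pos
    rw [← hd] at this
    exact Nat.pos_of_ne_zero (by rintro rfl; simp at this)
  obtain ⟨N, hN⟩ : ∃ N, N = d * 3 ^ k := ⟨_, rfl⟩
  unfold IsSplitBySymbols at h
  rw [← hN] at h
  obtain ⟨ρ, i, j, c, b, hs, hi, hj⟩ := h
  have : NeZero N := ⟨by rw [hN]; positivity⟩
  choose c' hc' using fun t => pow_three_mem_range_of_pow_basis hyE yb hyb (c t)
  have hMchar : CharP (Matrix (Fin N) (Fin N) E₁) 3 :=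
    charP_of_injective_algebraMap (algebraMap E₁ _).injective 3
  let i' : Fin k → Matrix (Fin N) (Fin N) E₁ := fun t => i t + algebraMap E₁ _ (c t)
  have hcc : ∀ t X, Commute (algebraMap E₁ (Matrix (Fin N) (Fin N) E₁) (c t)) X := fun t X =>
    Algebra.commute_algebraMap_left (c t) X
  have hs' : IsSymbolFamily (E := E) i' j c' fun t => algebraMap F E (b t) := by
    refine ⟨?_, ?_, ?_, ?_, ?_, ?_, ?_⟩
    · intro t
      simp only [i']
      rw [add_pow_char_of_commute (p := 3) (hcc t _).symm, IsScalarTower.algebraMap_apply E E₁,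
        hc', map_pow]
      have := hs.pow_sub t
      rw [← this]; abel
    · intro t
      rw [hs.pow, ← IsScalarTower.algebraMap_apply, ← IsScalarTower.algebraMap_apply]
    · intro t
      have := hs.ne_zero t
      simpa using this
    · intro t
      simp only [i']
      rw [mul_add, hs.mul, ← (hcc t _).eq]; noncomm_ring
    · exact fun s t hst => ((hs.commute_left s t hst).add_left (hcc s _)).add_right
        ((hcc t _).symm)
    · exact fun s t hst => (hs.commute_mixed s t hst).add_left (hcc s _)
    · exact hs.commute_right
  let f : E ⊗[F] A →ₐ[E] Matrix (Fin N) (Fin N) E₁ :=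
    Algebra.TensorProduct.lift (Algebra.ofId E _) ρ fun x z => Algebra.commutes x _
  have hfc : ∀ {X : Matrix (Fin N) (Fin N) E₁}, (∀ x, Commute (ρ x) X) → ∀ x, Commute (f x) X := by
    intro X hX x
    induction x using TensorProduct.induction_on with
    | zero => simp
    | add x z hx hz => rw [map_add]; exact hx.add_left hz
    | tmul e x =>
      simp only [f]
      exact (Algebra.commute_algebraMap_left e X).mul_left (hX x)
  have := isCentral_baseChange (F := F) (A := A) E
  have := isSimpleRing_baseChange (F := F) (A := A) E
  let bC := Module.finBasis E (E ⊗[F] A)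
  obtain ⟨Φ, β, hΦf, hΦT, hΦβ⟩ := hs'.exists_basis_tensor f
    (fun x t => hfc (fun x => (hi x t).add_right (hcc t _).symm) x)
    (fun x t => hfc (fun x => hj x t) x) bC (E' := E₁)
    (linearIndependent_map_of_central_simple f bC.linearIndependent)
  have hcard : Fintype.card (Fin (Module.finrank E (E ⊗[F] A)) × (Fin k → Fin 3 × Fin 3))
      = Module.finrank E₁ (Matrix (Fin N) (Fin N) E₁) := by
    rw [Module.finrank_matrix]
    simp [← hd, hN]
    have : (9 : ℕ) ^ k = 3 ^ k * 3 ^ k := by rw [← mul_pow]; norm_num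
    rw [this]; ring
  let bs := Module.Basis.mk hΦβ (hΦβ.span_eq_top_of_card_eq_finrank' hcard).ge
  obtain ⟨i₀, j₀, c₀, hi₀, hj₀, hij₀, hiΦ, hjX⟩ := exists_cyclic_pair hyE yb hyb β Φ bs
    (fun s => by simp [bs])
  have : Module.Finite E E₁ := .of_basis yb
  have hVdim : Module.finrank E (Fin N → E₁) = d * 3 ^ (k + 1) := by
    rw [Module.finrank_pi_fintype]
    simp [Module.finrank_eq_card_basis yb, hN]; ring
  let bV := (Module.finBasis E (Fin N → E₁)).reindex (finCongr hVdim)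
  let θ' := LinearMap.toMatrixAlgEquiv bV
  let θ : Matrix (Fin N) (Fin N) E₁ →ₐ[E] _ := θ'.toAlgHom.comp (mulVecAlgHom E E₁ (Fin N))
  have hi'Φ : ∀ t, ∃ x, Φ x = i' t := by
    intro t
    obtain ⟨z, hz⟩ := hs'.mem_range_tensorHom t (x := i' t) (Algebra.subset_adjoin (by simp))
    exact ⟨1 ⊗ₜ z, (hΦT z).trans hz⟩
  have hjΦ : ∀ t, ∃ x, Φ x = j t := by
    intro t
    obtain ⟨z, hz⟩ := hs'.mem_range_tensorHom t (x := j t) (Algebra.subset_adjoin (by simp))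
    exact ⟨1 ⊗ₜ z, (hΦT z).trans hz⟩
  have hθi : ∀ t, Commute (θ' i₀) (θ (i' t)) := by
    intro t
    obtain ⟨x, hx⟩ := hi'Φ t
    rw [← hx]
    exact (hiΦ x).map θ'
  have hθj : ∀ t, Commute (θ' i₀) (θ (j t)) := by
    intro t
    obtain ⟨x, hx⟩ := hjΦ t
    rw [← hx]
    exact (hiΦ x).map θ'
  have hfam := (hs'.map θ).cons (i₀ := θ' i₀) (j₀ := θ' j₀) (c₀ := c₀) (b₀ := algebraMap F E a)
      (by rw [← map_pow, ← map_sub, hi₀, AlgEquiv.commutes])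
      (by rw [← map_pow, hj₀, AlgEquiv.commutes])
      (by
        rintro h0
        rw [h0, map_zero] at hyE
        exact hy0 (pow_eq_zero_iff (by norm_num) |>.1 hyE))
      (by rw [← map_mul, hij₀, map_mul, map_sub, map_one]) hθi hθj
      (fun t => (hjX _).map θ') (fun t => (hjX _).map θ')
  refine ⟨(θ.restrictScalars F).comp ρ, Fin.cons (θ' i₀) fun t => θ (i' t),
    Fin.cons (θ' j₀) fun t => θ (j t), Fin.cons c₀ c', Fin.cons a b, ?_, ?_, ?_⟩
  · convert hfam using 1
    funext t
    refine Fin.cases ?_ (fun t => ?_) t <;> simp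
  · intro x t
    refine Fin.cases ?_ (fun t => ?_) t
    · have hx : Φ ((1 ⊗ₜ x) ⊗ₜ 1) = ρ x := by
        rw [hΦf]
        exact (Algebra.TensorProduct.lift_tmul _ _ _ _ _).trans (by rw [map_one, one_mul])
      have := ((hiΦ ((1 ⊗ₜ x) ⊗ₜ 1)).map θ').symm
      rw [hx] at this
      exact this
    · exact ((hi x t).add_right (hcc t _).symm).map θ
  · intro x t
    refine Fin.cases ?_ (fun t => ?_) t
    · exact ((hjX (ρ x)).map θ').symm
    · exact (hj x t).map θ
end

theorem exists_pow_basis_adjoin_cube_root {E Ω : Type*} [Field E] [Field Ω] [Algebra E Ω]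
    [CharP E 3] {y : Ω} {b : E} (hy : y ^ 3 = algebraMap E Ω b)
    (hyE : y ∉ Set.range (algebraMap E Ω)) :
    ∃ yb : Module.Basis (Fin 3) E (IntermediateField.adjoin E {y}),
      ∀ k, yb k = (IntermediateField.AdjoinSimple.gen E y) ^ (k : ℕ) := by
  have : CharP Ω 3 := charP_of_injective_algebraMap (algebraMap E Ω).injective 3
  have hirr : Irreducible (Polynomial.X ^ 3 - Polynomial.C b) := by
    refine X_pow_sub_C_irreducible_of_prime Nat.prime_three fun c hc => hyE ⟨c, ?_⟩
    have : (algebraMap E Ω c - y) ^ 3 = 0 := by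
      rw [sub_pow_char (p := 3), hy, ← hc, map_pow, sub_self]
    exact sub_eq_zero.1 (pow_eq_zero_iff (by norm_num) |>.1 this)
  have hmin : Polynomial.X ^ 3 - Polynomial.C b = minpoly E y :=
    minpoly.eq_of_irreducible_of_monic hirr (by simp [hy])
      (Polynomial.monic_X_pow_sub_C _ (by norm_num))
  have h_integral : IsIntegral E y := by
    refine ⟨_, Polynomial.monic_X_pow_sub_C b (by norm_num : 3 ≠ 0), ?_⟩
    simp [hy]
  let pb := IntermediateField.adjoin.powerBasis h_integral
  have hdim : pb.dim = 3 := by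
    rw [IntermediateField.adjoin.powerBasis_dim, ← hmin, Polynomial.natDegree_X_pow_sub_C]
  refine ⟨pb.basis.reindex (finCongr hdim), fun k => ?_⟩
  rw [Module.Basis.reindex_apply, pb.basis_eq_pow, IntermediateField.adjoin.powerBasis_gen]
  simp

section
variable {F A : Type*} [Field F] [Ring A] [Algebra F A]

theorem IsSplitBySymbols.exists_of_adjoin {Ω : Type*} [Field Ω] [Algebra F Ω]
    [Algebra.IsCentral F A] [IsSimpleRing A] [FiniteDimensional F A]
    [CharP F 3] {d : ℕ} (hd : d ^ 2 = Module.finrank F A) (S : Finset Ω)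
    (hS : ∀ y ∈ S, y ^ 3 ∈ Set.range (algebraMap F Ω)) {k : ℕ}
    (h : IsSplitBySymbols F A (IntermediateField.adjoin F (S : Set Ω)) d k) :
    ∃ k' ≤ k + S.card, IsSplitBySymbols F A F d k' := by
  classical
  induction S using Finset.induction_on generalizing k with
  | empty =>
    rw [Finset.coe_empty, IntermediateField.adjoin_empty] at h
    exact ⟨k, by simp, h.map (IntermediateField.botEquiv F Ω).toAlgHom⟩
  | insert y S hyS ih =>
    have hS' : ∀ y ∈ S, y ^ 3 ∈ Set.range (algebraMap F Ω) := fun z hz =>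
      hS z (Finset.mem_insert_of_mem hz)
    rw [Finset.card_insert_of_notMem hyS]
    by_cases hy : y ∈ IntermediateField.adjoin F (S : Set Ω)
    · obtain ⟨k', hk', h'⟩ := ih hS' (h.map (IntermediateField.inclusion (by
        rw [IntermediateField.adjoin_le_iff, Finset.coe_insert, Set.insert_subset_iff]
        exact ⟨hy, IntermediateField.subset_adjoin F _⟩)))
      exact ⟨k', by omega, h'⟩
    · obtain ⟨a, ha⟩ := hS y (Finset.mem_insert_self y S)
      let E := IntermediateField.adjoin F (S : Set Ω)
      have : CharP E 3 := charP_of_injective_algebraMap (algebraMap F E).injective 3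
      obtain ⟨yb, hyb⟩ := exists_pow_basis_adjoin_cube_root (E := E) (y := y)
        (b := algebraMap F E a) (by rw [← ha]; rfl)
        (by rintro ⟨x, hx⟩; exact hy (hx ▸ x.2))
      have h1 := h.map (E' := IntermediateField.adjoin E {y})
        (IntermediateField.inclusion (E := IntermediateField.adjoin F ((insert y S : Finset Ω) : Set Ω))
          (F := (IntermediateField.adjoin E {y}).restrictScalars F) (by
        rw [IntermediateField.adjoin_le_iff, Finset.coe_insert, Set.insert_subset_iff]
        refine ⟨IntermediateField.mem_adjoin_simple_self E y, fun z hz => ?_⟩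
        exact (IntermediateField.adjoin E {y}).algebraMap_mem
          ⟨z, IntermediateField.subset_adjoin F _ hz⟩))
      have h2 := h1.descend hd (E := E) (y := IntermediateField.AdjoinSimple.gen E y) (a := a)
        (by apply Subtype.ext; exact ha.symm)
        (by
          intro h0
          apply hy
          have : y = 0 := congrArg Subtype.val h0
          rw [this]; exact zero_mem _) yb hyb
      obtain ⟨k', hk', h'⟩ := ih hS' h2
      exact ⟨k', by omega, h'⟩
end

section
variable {F A : Type*} [Field F] [Ring A] [Algebra F A] [Algebra.IsCentral F A]

instance isCentral_mulOpposite : Algebra.IsCentral F Aᵐᵒᵖ := by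
  refine ⟨fun x hx => ?_⟩
  have : x.unop ∈ Subalgebra.center F A := by
    rw [Subalgebra.mem_center_iff] at hx ⊢
    intro b
    simpa using (congrArg MulOpposite.unop (hx (MulOpposite.op b))).symm
  obtain ⟨c, hc⟩ := Algebra.mem_bot.1 (Algebra.IsCentral.out this)
  exact Algebra.mem_bot.2 ⟨c, MulOpposite.unop_injective (by simpa using hc)⟩

variable [IsSimpleRing A] [FiniteDimensional F A]

theorem nonempty_algEquiv_tensor_mulOpposite :
    Nonempty (A ⊗[F] Aᵐᵒᵖ ≃ₐ[F] Module.End F A) := by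
  have : IsSimpleRing (A ⊗[F] Aᵐᵒᵖ) := isSimpleRing_tensorProduct Aᵐᵒᵖ
  have hinj : Function.Injective (AlgHom.mulLeftRight F A) :=
    RingHom.injective (AlgHom.mulLeftRight F A).toRingHom
  refine ⟨AlgEquiv.ofBijective (AlgHom.mulLeftRight F A) ⟨hinj, ?_⟩⟩
  refine (LinearMap.injective_iff_surjective_of_finrank_eq_finrank
    (f := (AlgHom.mulLeftRight F A).toLinearMap) ?_).1 hinj
  rw [Module.finrank_tensorProduct, Module.finrank_linearMap,
    (MulOpposite.opLinearEquiv F (M := A)).finrank_eq.symm]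
end

section
variable {F A : Type} [Field F] [CharP F 3] [Ring A] [Algebra F A] [Algebra.IsCentral F A]
  [IsSimpleRing A] [FiniteDimensional F A]

theorem IsSplitBySymbols.symbolLengthLE {d k : ℕ} (hd : d ^ 2 = Module.finrank F A)
    (h : IsSplitBySymbols F Aᵐᵒᵖ F d k) : SymbolLengthLE 3 F A k := by
  obtain ⟨ρ, i, j, c, b, hs, hi, hj⟩ := h
  have hdpos : 0 < d := by
    have : 0 < Module.finrank F A := Module.finrank_pos
    rw [← hd] at this
    exact Nat.pos_of_ne_zero (by rintro rfl; simp at this)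
  have hNpos : 0 < d * 3 ^ k := by positivity
  obtain ⟨N, hN⟩ : ∃ N, N = d * 3 ^ k := ⟨_, rfl⟩
  rw [← hN] at hNpos
  revert ρ i j
  rw [← hN]
  intro ρ i j hs hi hj
  have : NeZero N := ⟨hNpos.ne'⟩
  have : CharP (Matrix (Fin N) (Fin N) F) 3 :=
    charP_of_injective_algebraMap (algebraMap F _).injective 3
  let bC := Module.finBasis F Aᵐᵒᵖ
  obtain ⟨Φ, β, -, -, hΦβ⟩ := hs.exists_basis_tensor ρ hi hj bC (E' := F)
    (linearIndependent_map_of_central_simple ρ bC.linearIndependent)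
  have hcard : Fintype.card (Fin (Module.finrank F Aᵐᵒᵖ) × (Fin k → Fin 3 × Fin 3))
      = Module.finrank F (Matrix (Fin N) (Fin N) F) := by
    rw [Module.finrank_matrix, (MulOpposite.opLinearEquiv F (M := A)).finrank_eq.symm]
    simp [← hd, hN]
    have : (9 : ℕ) ^ k = 3 ^ k * 3 ^ k := by rw [← mul_pow]; norm_num
    rw [this]; ring
  let bs := Module.Basis.mk hΦβ (hΦβ.span_eq_top_of_card_eq_finrank' hcard).ge
  have hbij : Function.Bijective Φ := by
    have : Φ.toLinearMap = (β.equiv bs (Equiv.refl _)).toLinearMap := by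
      refine β.ext fun q => ?_
      simp [bs]
    have h2 : (Φ : _ → _) = β.equiv bs (Equiv.refl _) := congrArg DFunLike.coe this
    rw [h2]; exact (β.equiv bs (Equiv.refl _)).bijective
  let Φe := AlgEquiv.ofBijective Φ hbij
  obtain ⟨θ⟩ := nonempty_algEquiv_tensor_mulOpposite (F := F) (A := A)
  let T := ⨂[F] t, IsSymbolFamily.factor F i j t
  let m := Module.finrank F A
  let e : Matrix (Fin N) (Fin N) A ≃ₐ[F] Matrix (Fin m) (Fin m) T :=
    (matrixEquivTensor (Fin N) F A).trans <|
    (Algebra.TensorProduct.congr AlgEquiv.refl Φe.symm).trans <|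
    (Algebra.TensorProduct.assoc F F F A Aᵐᵒᵖ T).symm.trans <|
    (Algebra.TensorProduct.congr
      (θ.trans (LinearMap.toMatrixAlgEquiv (Module.finBasis F A))) AlgEquiv.refl).trans <|
    (Algebra.TensorProduct.comm F (Matrix (Fin m) (Fin m) F) T).trans
    (matrixEquivTensor (Fin m) F T).symm
  exact ⟨k, le_rfl, fun t => IsSymbolFamily.factor F i j t, inferInstance, inferInstance,
    fun t => hs.isCyclicPAlg_factor t, N, m, hNpos, Module.finrank_pos, ⟨e⟩⟩

theorem symbolLengthLE_of_split_adjoin {Ω : Type} [Field Ω] [Algebra F Ω] {d : ℕ}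
    (hd : d ^ 2 = Module.finrank F A) (S : Finset Ω)
    (hS : ∀ y ∈ S, y ^ 3 ∈ Set.range (algebraMap F Ω)) (ρ : A →ₐ[F] Matrix (Fin d) (Fin d) Ω)
    (hρ : ∀ a k l, ρ a k l ∈ IntermediateField.adjoin F (S : Set Ω)) :
    SymbolLengthLE 3 F A S.card := by
  obtain ⟨ρ', -⟩ := exists_algHom_matrix_lift (IntermediateField.adjoin F (S : Set Ω)).val ρ
    fun a k l => ⟨⟨_, hρ a k l⟩, rfl⟩
  have hd' : d ^ 2 = Module.finrank F Aᵐᵒᵖ := by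
    rw [(MulOpposite.opLinearEquiv F (M := A)).finrank_eq.symm, hd]
  have h0 : IsSplitBySymbols F Aᵐᵒᵖ (IntermediateField.adjoin F (S : Set Ω)) d 0 := by
    unfold IsSplitBySymbols
    rw [pow_zero, mul_one]
    exact ⟨((Matrix.transposeAlgEquiv (Fin d) F _).symm.toAlgHom.comp (AlgHom.op ρ')),
      Fin.elim0, Fin.elim0, Fin.elim0, Fin.elim0,
      ⟨fun t => t.elim0, fun t => t.elim0, fun t => t.elim0, fun t => t.elim0,
      fun t => t.elim0, fun t => t.elim0, fun t => t.elim0⟩, fun _ t => t.elim0, fun _ t => t.elim0⟩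
  obtain ⟨k, hk, h⟩ := h0.exists_of_adjoin hd' S hS
  obtain ⟨k', hk', h'⟩ := h.symbolLengthLE hd
  exact ⟨k', by omega, h'⟩
end

theorem exists_conj_of_algHom_matrix {F Ω I : Type*} [Field F] [Field Ω] [Algebra F Ω] [Fintype I]
    [DecidableEq I] {N : ℕ} (hN : 0 < N) (hI : Fintype.card I = N)
    (f : Matrix (Fin N) (Fin N) F →ₐ[F] Matrix I I Ω) :
    ∃ (G : Matrix I (Fin N) Ω) (G' : Matrix (Fin N) I Ω), G * G' = 1 ∧ G' * G = 1 ∧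
      ∀ X, G * X.map (algebraMap F Ω) = f X * G := by
  let z : Fin N := ⟨0, hN⟩
  have : NeZero N := ⟨hN.ne'⟩
  have : Nonempty I := Fintype.card_pos_iff.1 (by omega)
  have hf : Function.Injective f := RingHom.injective f.toRingHom
  have hz : f (Matrix.single z z 1) ≠ 0 := by
    rw [Ne, map_eq_zero_iff f hf]
    intro h
    simpa using congrFun (congrFun h z) z
  obtain ⟨v, hv⟩ : ∃ v, f (Matrix.single z z 1) *ᵥ v ≠ 0 := by
    by_contra! h
    exact hz (Matrix.ext_of_mulVec_single fun i => by rw [h, Matrix.zero_mulVec])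
  let G : Matrix I (Fin N) Ω := Matrix.of fun k l => (f (Matrix.single l z 1) *ᵥ v) k
  have hGc : ∀ c, G *ᵥ c = ∑ l, c l • (f (Matrix.single l z 1) *ᵥ v) := by
    intro c
    ext k
    simp [Matrix.mulVec_eq_sum, G, Finset.sum_apply]
  have hG : ∀ X, G * X.map (algebraMap F Ω) = f X * G := by
    intro X
    refine Matrix.ext_of_mulVec_single fun l => ?_
    have h1 : ∀ l, G *ᵥ Pi.single l 1 = f (Matrix.single l z 1) *ᵥ v := by
      intro l; ext k; simp [G]
    rw [← Matrix.mulVec_mulVec, ← Matrix.mulVec_mulVec, h1, Matrix.mulVec_mulVec v, ← map_mul]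
    have h2 : X * Matrix.single l z 1 = ∑ i, X i l • Matrix.single i z 1 := by
      ext p q
      rw [Matrix.sum_apply]
      by_cases hq : z = q
      · subst hq; simp [Matrix.single_apply]
      · simp [Matrix.mul_single_apply_of_ne _ _ _ _ _ (Ne.symm hq), hq]
    rw [h2, map_sum, hGc, Matrix.sum_mulVec]
    refine Finset.sum_congr rfl fun i _ => ?_
    rw [map_smul, Matrix.smul_mulVec, ← algebraMap_smul Ω]
    simp
  have hinj : Function.Injective G.mulVecLin := by
    rw [injective_iff_map_eq_zero]
    intro c hc
    ext l
    have h3 : f (Matrix.single z l 1) *ᵥ (G *ᵥ c) = c l • (f (Matrix.single z z 1) *ᵥ v) := by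
      rw [hGc, Matrix.mulVec_sum, Finset.sum_eq_single l]
      · rw [Matrix.mulVec_smul, Matrix.mulVec_mulVec, ← map_mul]
        simp
      · intro i _ hi
        rw [Matrix.mulVec_smul, Matrix.mulVec_mulVec, ← map_mul]
        simp [Matrix.single_mul_single_of_ne _ _ _ _ hi.symm]
      · simp
    have hc' : G *ᵥ c = 0 := hc
    rw [hc', Matrix.mulVec_zero] at h3
    exact (smul_eq_zero.1 h3.symm).resolve_right hv
  have hdim : Module.finrank Ω (Fin N → Ω) = Module.finrank Ω (I → Ω) := by simp [hI]
  let T := LinearMap.linearEquivOfInjective G.mulVecLin hinj hdim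
  have hT : (T : (Fin N → Ω) →ₗ[Ω] _) = G.mulVecLin := rfl
  refine ⟨G, LinearMap.toMatrix' T.symm.toLinearMap, ?_, ?_, hG⟩
  · apply (Matrix.toLin' (R := Ω)).injective
    rw [Matrix.toLin'_mul, Matrix.toLin'_toMatrix', Matrix.toLin'_one]
    exact LinearMap.ext fun x => T.apply_symm_apply x
  · apply (Matrix.toLin' (R := Ω)).injective
    rw [Matrix.toLin'_mul, Matrix.toLin'_toMatrix', Matrix.toLin'_one]
    exact LinearMap.ext fun x => T.symm_apply_apply x

section
variable {F A Ω : Type*} [Field F] [Ring A] [Algebra F A] [Field Ω] [Algebra F Ω] {d : ℕ}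

/-- The Kronecker product of three matrices of a representation, as a multilinear map. -/
noncomputable def kroneckerCube (γ : A →ₐ[F] Matrix (Fin d) (Fin d) Ω) :
    MultilinearMap F (fun _ : Fin 3 => A) (Matrix (Fin 3 → Fin d) (Fin 3 → Fin d) Ω) :=
  MultilinearMap.pi fun u => MultilinearMap.pi fun v =>
    (MultilinearMap.mkPiAlgebra F (Fin 3) Ω).compLinearMap fun t =>
      (Matrix.entryLinearMap F Ω (u t) (v t)).comp γ.toLinearMap

theorem kroneckerCube_apply (γ : A →ₐ[F] Matrix (Fin d) (Fin d) Ω) (a : Fin 3 → A)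
    (u v : Fin 3 → Fin d) : kroneckerCube γ a u v = ∏ t, γ (a t) (u t) (v t) :=
  MultilinearMap.mkPiAlgebra_apply (R := F) (fun t => γ (a t) (u t) (v t))

/-- The action of the tensor cube of `A` on the tensor cube of a matrix representation. -/
noncomputable def tensorCube (γ : A →ₐ[F] Matrix (Fin d) (Fin d) Ω) :
    (⨂[F] _ : Fin 3, A) →ₐ[F] Matrix (Fin 3 → Fin d) (Fin 3 → Fin d) Ω :=
  PiTensorProduct.liftAlgHom (kroneckerCube γ)
    (by
      ext u v
      rw [kroneckerCube_apply]
      by_cases huv : u = v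
      · subst huv
        simp
      · obtain ⟨t, ht⟩ := Function.ne_iff.1 huv
        rw [Matrix.one_apply_ne huv]
        exact Finset.prod_eq_zero (Finset.mem_univ t) (by simp [ht]))
    (by
      intro x y
      ext u v
      simp only [kroneckerCube_apply, Matrix.mul_apply, ← Finset.prod_mul_distrib, Pi.mul_apply,
        map_mul, Finset.prod_univ_sum, Fintype.piFinset_univ])

theorem tensorCube_tprod (γ : A →ₐ[F] Matrix (Fin d) (Fin d) Ω) (a : Fin 3 → A)
    (u v : Fin 3 → Fin d) :
    tensorCube γ (PiTensorProduct.tprod F a) u v = ∏ t, γ (a t) (u t) (v t) := by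
  rw [← kroneckerCube_apply]
  have : tensorCube γ (PiTensorProduct.tprod F a) = kroneckerCube γ a :=
    PiTensorProduct.lift.tprod a
  rw [this]
end

section
variable {F A Ω : Type*} [Field F] [Ring A] [Algebra F A] [Field Ω] [Algebra F Ω] {d : ℕ}

/-- Permutation of the factors of a tensor cube. -/
noncomputable def permuteCube (F A : Type*) [Field F] [Ring A] [Algebra F A]
    (σ : Equiv.Perm (Fin 3)) : (⨂[F] _ : Fin 3, A) →ₐ[F] (⨂[F] _ : Fin 3, A) :=
  PiTensorProduct.liftAlgHom
    ((PiTensorProduct.tprod F (s := fun _ : Fin 3 => A)).domDomCongr σ)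
    rfl
    (fun x y => (PiTensorProduct.tprod_mul_tprod (fun i => x (σ i)) (fun i => y (σ i))).symm)

theorem permuteCube_tprod (σ : Equiv.Perm (Fin 3)) (a : Fin 3 → A) :
    permuteCube F A σ (PiTensorProduct.tprod F a) = PiTensorProduct.tprod F fun t => a (σ t) :=
  PiTensorProduct.lift.tprod a

/-- The matrix permuting the coordinates of a tensor cube. -/
def permuteMatrix (Ω : Type*) [Field Ω] (d : ℕ) (σ : Equiv.Perm (Fin 3)) :
    Matrix (Fin 3 → Fin d) (Fin 3 → Fin d) Ω :=
  (σ.arrowCongr (Equiv.refl (Fin d))).toPEquiv.toMatrix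

theorem permuteMatrix_mul (σ τ : Equiv.Perm (Fin 3)) :
    permuteMatrix Ω d σ * permuteMatrix Ω d τ = permuteMatrix Ω d (τ * σ) := by
  rw [permuteMatrix, permuteMatrix, ← PEquiv.toMatrix_trans, ← Equiv.toPEquiv_trans]
  rfl

theorem permuteMatrix_one : permuteMatrix Ω d 1 = 1 :=
  PEquiv.toMatrix_refl

theorem permuteMatrix_mulVec (σ : Equiv.Perm (Fin 3)) (w : (Fin 3 → Fin d) → Ω) :
    permuteMatrix Ω d σ *ᵥ w = fun u => w (u ∘ σ.symm) := by
  rw [permuteMatrix, PEquiv.toMatrix_toPEquiv_mulVec]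
  rfl

theorem permuteMatrix_mul_tensorCube (γ : A →ₐ[F] Matrix (Fin d) (Fin d) Ω)
    (σ : Equiv.Perm (Fin 3)) (x : ⨂[F] _ : Fin 3, A) :
    permuteMatrix Ω d σ * tensorCube γ x
      = tensorCube γ (permuteCube F A σ x) * permuteMatrix Ω d σ := by
  induction x using PiTensorProduct.induction_on with
  | smul_tprod r a =>
    rw [map_smul, map_smul, map_smul, Matrix.mul_smul, Matrix.smul_mul]
    congr 1
    rw [permuteCube_tprod, permuteMatrix, PEquiv.toMatrix_toPEquiv_mul,
      PEquiv.mul_toMatrix_toPEquiv]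
    ext u v
    simp only [Matrix.submatrix_apply, id, tensorCube_tprod]
    refine (Fintype.prod_equiv σ _ _ fun t => ?_).symm
    simp
  | add x y hx hy => rw [map_add, map_add, map_add, mul_add, add_mul, hx, hy]

theorem exists_implements_permutation {N : ℕ} (hN : 0 < N)
    (β : (⨂[F] _ : Fin 3, A) ≃ₐ[F] Matrix (Fin N) (Fin N) F)
    (γ : A →ₐ[F] Matrix (Fin d) (Fin d) Ω) {G : Matrix (Fin 3 → Fin d) (Fin N) Ω}
    {G' : Matrix (Fin N) (Fin 3 → Fin d) Ω} (h1 : G * G' = 1) (h2 : G' * G = 1)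
    (hG : ∀ X, G * X.map (algebraMap F Ω) = tensorCube γ (β.symm X) * G)
    (σ : Equiv.Perm (Fin 3)) :
    ∃ (g g' : Matrix (Fin N) (Fin N) F) (μ : Ω), g * g' = 1 ∧ μ ≠ 0 ∧
      G * g.map (algebraMap F Ω) = μ • (permuteMatrix Ω d σ * G) ∧
      G * g'.map (algebraMap F Ω) = μ⁻¹ • (permuteMatrix Ω d σ⁻¹ * G) := by
  obtain ⟨g, g', hgg, hgg', hg⟩ := exists_conj_of_algHom_matrix (Ω := F) hN (Fintype.card_fin N)
    ((β.toAlgHom.comp (permuteCube F A σ)).comp β.symm.toAlgHom)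
  have hg : ∀ X, g * X = β (permuteCube F A σ (β.symm X)) * g := by
    intro X
    have := hg X
    simpa using this
  let P := permuteMatrix Ω d σ
  let P' := permuteMatrix Ω d σ⁻¹
  have hPP : P * P' = 1 := by
    simp only [P, P']; rw [permuteMatrix_mul, inv_mul_cancel, permuteMatrix_one]
  have hPP' : P' * P = 1 := by
    simp only [P, P']; rw [permuteMatrix_mul, mul_inv_cancel, permuteMatrix_one]
  let m : Matrix (Fin N) (Fin N) F →+* Matrix (Fin N) (Fin N) Ω := (algebraMap F Ω).mapMatrix
  have hG : ∀ X, G * m X = tensorCube γ (β.symm X) * G := hG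
  let Q := G' * P' * G * m g
  have hQ : ∀ X, Commute (m X) Q := by
    intro X
    have e1 : m X * G' = G' * tensorCube γ (β.symm X) := by
      calc m X * G' = G' * (G * m X) * G' := by rw [← Matrix.mul_assoc G', h2, Matrix.one_mul]
        _ = _ := by rw [hG, ← Matrix.mul_assoc, Matrix.mul_assoc, h1, Matrix.mul_one]
    have e2 : tensorCube γ (β.symm X) * P' = P' * tensorCube γ (permuteCube F A σ (β.symm X)) := by
      have := permuteMatrix_mul_tensorCube γ σ (β.symm X)
      calc tensorCube γ (β.symm X) * P' = P' * (P * tensorCube γ (β.symm X)) * P' := by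
            rw [← Matrix.mul_assoc P', hPP', Matrix.one_mul]
        _ = _ := by rw [this, ← Matrix.mul_assoc, Matrix.mul_assoc, hPP, Matrix.mul_one]
    have e3 : tensorCube γ (permuteCube F A σ (β.symm X)) * G
        = G * m (β (permuteCube F A σ (β.symm X))) := by rw [hG, AlgEquiv.symm_apply_apply]
    calc m X * (G' * P' * G * m g) = (m X * G') * P' * G * m g := by simp only [Matrix.mul_assoc]
      _ = G' * (tensorCube γ (β.symm X) * P') * G * m g := by rw [e1]; simp only [Matrix.mul_assoc]
      _ = G' * P' * (tensorCube γ (permuteCube F A σ (β.symm X)) * G) * m g := by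
        rw [e2]; simp only [Matrix.mul_assoc]
      _ = G' * P' * G * (m (β (permuteCube F A σ (β.symm X))) * m g) := by
        rw [e3]; simp only [Matrix.mul_assoc]
      _ = G' * P' * G * m g * m X := by rw [← map_mul, ← hg, map_mul]; simp only [Matrix.mul_assoc]
  obtain ⟨μ, hμ⟩ := Matrix.mem_range_scalar_of_commute_single (M := Q) (by
    intro k l _
    have := hQ (Matrix.single k l 1)
    have hm : m (Matrix.single k l 1) = Matrix.single k l 1 := by
      simp [m, Matrix.map_single]
    rwa [hm] at this)
  have hμ' : Q = μ • 1 := by rw [← hμ, Matrix.scalar_apply, Matrix.smul_one_eq_diagonal]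
  have hGg : G * m g = μ • (P * G) := by
    have : P * G * Q = G * m g := by
      simp only [Q]
      calc P * G * (G' * P' * G * m g) = P * (G * G') * P' * G * m g := by simp only [Matrix.mul_assoc]
        _ = _ := by rw [h1, Matrix.mul_one, hPP, Matrix.one_mul]
    rw [← this, hμ']; simp
  have hμ0 : μ ≠ 0 := by
    rintro rfl
    have : m g = 0 := by
      rw [zero_smul] at hGg
      rw [← Matrix.one_mul (m g), ← h2, Matrix.mul_assoc, hGg, Matrix.mul_zero]
    have h3 : m (g * g') = 0 := by rw [map_mul, this, Matrix.zero_mul]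
    rw [hgg, map_one] at h3
    have := congrFun (congrFun h3 ⟨0, hN⟩) ⟨0, hN⟩
    simp at this
  refine ⟨g, g', μ, hgg, hμ0, hGg, ?_⟩
  change G * m g' = _
  have : P' * G = μ • (G * m g') := by
    calc P' * G = P' * (G * m (g * g')) := by rw [hgg, map_one, Matrix.mul_one]
      _ = P' * (G * m g) * m g' := by rw [map_mul]; simp only [Matrix.mul_assoc]
      _ = _ := by
        rw [hGg, Matrix.mul_smul, Matrix.smul_mul, ← Matrix.mul_assoc P', hPP', Matrix.one_mul]
  simp only [P'] at this
  rw [this, smul_smul, inv_mul_cancel₀ hμ0, one_smul]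

theorem exists_implements_rotation {N : ℕ} (hN : 0 < N)
    (β : (⨂[F] _ : Fin 3, A) ≃ₐ[F] Matrix (Fin N) (Fin N) F)
    (γ : A →ₐ[F] Matrix (Fin d) (Fin d) Ω) {G : Matrix (Fin 3 → Fin d) (Fin N) Ω}
    {G' : Matrix (Fin N) (Fin 3 → Fin d) Ω} (h1 : G * G' = 1) (h2 : G' * G = 1)
    (hG : ∀ X, G * X.map (algebraMap F Ω) = tensorCube γ (β.symm X) * G) :
    ∃ h : Matrix (Fin N) (Fin N) F,
      G * h.map (algebraMap F Ω) = permuteMatrix Ω d (finRotate 3)⁻¹ * G := by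
  obtain ⟨g, g', μ, -, hμ, hg, hg'⟩ :=
    exists_implements_permutation hN β γ h1 h2 hG (Equiv.swap 1 2)
  obtain ⟨k, k', ν, -, hν, hk, hk'⟩ :=
    exists_implements_permutation hN β γ h1 h2 hG (Equiv.swap 0 1)
  refine ⟨g * k * g' * k', ?_⟩
  let m : Matrix (Fin N) (Fin N) F →+* Matrix (Fin N) (Fin N) Ω := (algebraMap F Ω).mapMatrix
  change G * m _ = _
  change G * m _ = _ at hg hg' hk hk'
  have hsmul : ∀ (c : Ω) (X Y : Matrix (Fin 3 → Fin d) (Fin 3 → Fin d) Ω),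
      X * (c • (Y * G)) = c • (X * Y * G) := fun c X Y => by rw [Matrix.mul_smul, Matrix.mul_assoc]
  rw [map_mul, map_mul, map_mul, ← Matrix.mul_assoc, ← Matrix.mul_assoc, ← Matrix.mul_assoc, hg, Matrix.smul_mul,
    Matrix.mul_assoc _ G, hk, hsmul, smul_smul, Matrix.smul_mul, Matrix.mul_assoc _ G, hg', hsmul, smul_smul,
    Matrix.smul_mul, Matrix.mul_assoc _ G, hk', hsmul, smul_smul, permuteMatrix_mul, permuteMatrix_mul,
    permuteMatrix_mul]
  have e1 : μ * ν * μ⁻¹ * ν⁻¹ = 1 := by field_simp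
  rw [e1, one_smul]
  congr 2
  decide
end

section
variable {Ω : Type*} [Field Ω] {d : ℕ}

/-- Exactly one rotation of a nonconstant word of length three satisfies this predicate. -/
def IsLeadingRotation (u : Fin 3 → Fin d) : Prop := u 0 ≤ u 1 ∧ u 0 < u 2

instance : DecidablePred (IsLeadingRotation (d := d)) := fun u =>
  inferInstanceAs (Decidable (u 0 ≤ u 1 ∧ u 0 < u 2))

theorem exists_eq_const_add_rotations {w : (Fin 3 → Fin d) → Ω}
    (hw : ∀ u, w (u ∘ finRotate 3) = w u) : ∃ z : (Fin 3 → Fin d) → Ω, ∀ u,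
      w u = (if u = fun _ => u 0 then w u else 0)
        + (z u + z (u ∘ finRotate 3) + z (u ∘ finRotate 3 ∘ finRotate 3)) := by
  refine ⟨fun u => if IsLeadingRotation u then w u else 0, fun u => ?_⟩
  have h2 : w (u ∘ finRotate 3 ∘ finRotate 3) = w u := by
    rw [← Function.comp_assoc, hw, hw]
  dsimp only
  rw [hw, h2]
  have hc : (u = fun _ => u 0) ↔ u 1 = u 0 ∧ u 2 = u 0 := by
    constructor
    · intro h; exact ⟨congrFun h 1, congrFun h 2⟩
    · rintro ⟨h1, h2⟩
      funext t
      fin_cases t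
      · rfl
      · exact h1
      · exact h2
  have r0 : finRotate 3 0 = 1 := by decide
  have r1 : finRotate 3 1 = 2 := by decide
  have r2 : finRotate 3 2 = 0 := by decide
  simp only [hc, IsLeadingRotation, Function.comp_apply, r0, r1, r2]
  simp only [Fin.ext_iff, Fin.le_def, Fin.lt_def]
  split_ifs <;> first | omega | simp

theorem sum_eq_sum_const [CharP Ω 3] {w : (Fin 3 → Fin d) → Ω}
    (hw : ∀ u, w (u ∘ finRotate 3) = w u) : ∑ u, w u = ∑ i, w fun _ => i := by
  obtain ⟨z, hz⟩ := exists_eq_const_add_rotations hw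
  rw [Finset.sum_congr rfl fun u _ => hz u, Finset.sum_add_distrib, Finset.sum_add_distrib,
    Finset.sum_add_distrib]
  have e1 : ∑ u : Fin 3 → Fin d, z (u ∘ finRotate 3) = ∑ u, z u :=
    Fintype.sum_equiv ((finRotate 3).symm.arrowCongr (Equiv.refl _)) _ _ fun u => rfl
  have e2 : ∑ u : Fin 3 → Fin d, z (u ∘ finRotate 3 ∘ finRotate 3) = ∑ u, z u :=
    Fintype.sum_equiv (((finRotate 3).trans (finRotate 3)).symm.arrowCongr (Equiv.refl _)) _ _
      fun u => rfl
  have e3 : ∑ u, z u + ∑ u, z u + ∑ u, z u = 0 := by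
    have : (3 : Ω) = 0 := by exact_mod_cast CharP.cast_eq_zero Ω 3
    linear_combination (∑ u, z u) * this
  rw [e1, e2, e3, add_zero, ← Finset.sum_filter]
  refine Finset.sum_bij' (fun u _ => u 0) (fun i _ => fun _ => i) ?_ ?_ ?_ ?_ ?_
  · simp
  · simp
  · intro u hu; exact (Finset.mem_filter.1 hu).2.symm
  · simp
  · intro u hu; congr 1; exact (Finset.mem_filter.1 hu).2

end

theorem comp_map_mulVec {F Ω n : Type*} [Field F] [Field Ω] [Algebra F Ω] [Fintype n]
    (π : Ω →ₗ[F] F) (X : Matrix n n F) (u : n → Ω) :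
    (fun k => π ((X.map (algebraMap F Ω) *ᵥ u) k)) = X *ᵥ fun k => π (u k) := by
  ext k
  simp only [Matrix.mulVec, dotProduct, map_sum, Matrix.map_apply, ← Algebra.smul_def, map_smul,
    smul_eq_mul]

theorem mem_span_fixed_of_mulVec_eq {F Ω n : Type*} [Field F] [Field Ω] [Algebra F Ω] [Fintype n]
    {h : Matrix n n F} {y : n → Ω} (hy : h.map (algebraMap F Ω) *ᵥ y = y) :
    y ∈ Submodule.span Ω ((fun x : n → F => fun k => algebraMap F Ω (x k)) '' {x | h *ᵥ x = x}) := by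
  classical
  let b := Module.Basis.ofVectorSpace F Ω
  let s := Finset.univ.biUnion fun k => (b.repr (y k)).support
  have hsum : y = ∑ r ∈ s, b r • fun k => algebraMap F Ω (b.repr (y k) r) := by
    ext k
    conv_lhs => rw [← b.linearCombination_repr (y k), Finsupp.linearCombination_apply]
    rw [Finsupp.sum_of_support_subset (s := s) _ (by
      exact Finset.subset_biUnion_of_mem (fun k => (b.repr (y k)).support) (Finset.mem_univ k))
      _ (by simp), Finset.sum_apply]
    refine Finset.sum_congr rfl fun r _ => ?_
    rw [Algebra.smul_def, mul_comm]; rfl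
  rw [hsum]
  refine Submodule.sum_mem _ fun r _ => Submodule.smul_mem _ _ (Submodule.subset_span ⟨_, ?_, rfl⟩)
  have := comp_map_mulVec (b.coord r) h y
  rw [hy] at this
  exact this.symm

theorem exists_conj_pow_mem_range {F A Ω : Type*} [Field F] [Ring A] [Algebra F A] [Field Ω]
    [Algebra F Ω] [IsAlgClosed Ω] [CharP Ω 3] {d : ℕ} (γ : A →ₐ[F] Matrix (Fin d) (Fin d) Ω)
    {V : Matrix (Fin d) (Fin d) Ω} (hV : IsUnit V)
    (h : ∀ a, ∃ M : Matrix (Fin d) (Fin d) F,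
      (γ a).map (frobenius Ω 3) * V = V * M.map (algebraMap F Ω)) :
    ∃ ρ : A →ₐ[F] Matrix (Fin d) (Fin d) Ω,
      ∀ a k l, ρ a k l ^ 3 ∈ Set.range (algebraMap F Ω) := by
  let φ : Matrix (Fin d) (Fin d) Ω →+* Matrix (Fin d) (Fin d) Ω := (frobenius Ω 3).mapMatrix
  have hφ : Function.Injective φ := Matrix.map_injective (frobenius Ω 3).injective
  have hsurj : ∀ X, ∃ Y, φ Y = X := fun X => by
    choose r hr using fun k l => IsAlgClosed.exists_pow_nat_eq (X k l) (n := 3) (by norm_num)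
    exact ⟨Matrix.of r, by ext k l; exact hr k l⟩
  obtain ⟨u, rfl⟩ := hV
  obtain ⟨W, hW⟩ := hsurj u
  obtain ⟨W', hW'⟩ := hsurj ↑u⁻¹
  have h1 : W * W' = 1 := hφ (by rw [map_mul, hW, hW', Units.mul_inv, map_one])
  have h2 : W' * W = 1 := hφ (by rw [map_mul, hW, hW', Units.inv_mul, map_one])
  refine ⟨AlgHom.ofLinearMap ((LinearMap.mulLeftRight F (W', W)).comp γ.toLinearMap) ?_ ?_, ?_⟩
  · simp [h2]
  · intro a b
    simp only [LinearMap.comp_apply, AlgHom.toLinearMap_apply, LinearMap.mulLeftRight_apply,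
      map_mul]
    calc W' * (γ a * γ b) * W = W' * γ a * 1 * γ b * W := by noncomm_ring
      _ = _ := by rw [← h1]; noncomm_ring
  · intro a k l
    obtain ⟨M, hM⟩ := h a
    have e : φ (W' * γ a * W) = M.map (algebraMap F Ω) := by
      rw [map_mul, map_mul, hW, hW', mul_assoc]
      rw [show φ (γ a) = (γ a).map (frobenius Ω 3) from rfl, hM, Units.inv_mul_cancel_left]
    exact ⟨M k l, (congrFun (congrFun e k) l).symm⟩

theorem exists_split_cube_roots {F A Ω : Type} [Field F] [CharP F 3] [Ring A] [Algebra F A]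
    [FiniteDimensional F A] [Nontrivial A] [Field Ω] [Algebra F Ω] [IsAlgClosed Ω] {d : ℕ}
    (hd : d ^ 2 = Module.finrank F A)
    (γ : A →ₐ[F] Matrix (Fin d) (Fin d) Ω) (hsplit : IsSplitAlg F (⨂[F] _ : Fin 3, A)) :
    ∃ ρ : A →ₐ[F] Matrix (Fin d) (Fin d) Ω,
      ∀ a k l, ρ a k l ^ 3 ∈ Set.range (algebraMap F Ω) := by
  have : CharP Ω 3 := charP_of_injective_algebraMap (algebraMap F Ω).injective 3
  have h3 : (3 : Ω) = 0 := by exact_mod_cast CharP.cast_eq_zero Ω 3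
  obtain ⟨N, hN, ⟨β⟩⟩ := hsplit
  have hcard : Fintype.card (Fin 3 → Fin d) = N := by
    have e1 := β.toLinearEquiv.finrank_eq
    rw [Module.finrank_eq_card_basis (Basis.piTensorProduct fun _ : Fin 3 => Module.finBasis F A),
      Module.finrank_matrix] at e1
    simp [← hd] at e1
    simp
    have : (d ^ 3) ^ 2 = N ^ 2 := by linarith [e1, show (d^2)^3 = (d^3)^2 by ring]
    exact Nat.pow_left_injective (n := 2) (by norm_num) this
  obtain ⟨G, G', h1, h2, hG⟩ := exists_conj_of_algHom_matrix (Ω := Ω) hN hcard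
    ((tensorCube γ).comp β.symm.toAlgHom)
  have hG : ∀ X, G * X.map (algebraMap F Ω) = tensorCube γ (β.symm X) * G := hG
  obtain ⟨h, hh⟩ := exists_implements_rotation hN β γ h1 h2 hG
  let P := permuteMatrix Ω d (finRotate 3)⁻¹
  have hP : ∀ w, P *ᵥ w = fun u => w (u ∘ finRotate 3) := fun w => permuteMatrix_mulVec _ w
  have hhG' : G' * P = h.map (algebraMap F Ω) * G' := by
    calc G' * P = G' * (P * G) * G' := by
          rw [← Matrix.mul_assoc, Matrix.mul_assoc _ G, h1, Matrix.mul_one]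
      _ = _ := by rw [← hh, ← Matrix.mul_assoc G', h2, Matrix.one_mul]
  let j : (Fin N → F) →ₗ[F] (Fin N → Ω) := (Algebra.linearMap F Ω).compLeft (Fin N)
  have hj : ∀ X x, X.map (algebraMap F Ω) *ᵥ j x = j (X *ᵥ x) := fun X x => by
    ext k; exact (RingHom.map_mulVec (algebraMap F Ω) X x k).symm
  have hPj : ∀ x, P *ᵥ (G *ᵥ j x) = G *ᵥ j (h *ᵥ x) := fun x => by
    rw [← hj, Matrix.mulVec_mulVec, Matrix.mulVec_mulVec, hh]
  have hinv : ∀ w, P *ᵥ w = w → ∀ u, w (u ∘ finRotate 3) = w u := fun w hw u => by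
    rw [hP] at hw; exact congrFun hw u
  let δ : ((Fin 3 → Fin d) → Ω) →ₗ[Ω] (Fin d → Ω) := LinearMap.funLeft Ω Ω fun i _ => i
  let K : Set (Fin N → F) := {x | h *ᵥ x = x}
  let D : (Fin N → F) →ₗ[F] (Fin d → Ω) := ((δ.comp G.mulVecLin).restrictScalars F).comp j
  have hDapp : ∀ x, D x = δ (G *ᵥ j x) := fun _ => rfl
  have hKP : ∀ x ∈ K, P *ᵥ (G *ᵥ j x) = G *ᵥ j x := fun x hx => by
    rw [hPj]; rw [show h *ᵥ x = x from hx]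
  -- the values of `D` on `K` span
  have hspan : Submodule.span Ω (D '' K) = ⊤ := by
    rw [eq_top_iff, ← (Pi.basisFun Ω (Fin d)).span_eq, Submodule.span_le]
    rintro _ ⟨i, rfl⟩
    let e : (Fin 3 → Fin d) → Ω := Pi.single (fun _ => i) 1
    have he : P *ᵥ e = e := by
      rw [hP]
      ext u
      simp only [e, Pi.single_apply]
      refine if_congr ⟨fun hu => ?_, fun hu => ?_⟩ rfl rfl
      · funext t
        have := congrFun hu ((finRotate 3).symm t)
        simpa using this
      · rw [hu]; rfl
    have hy : h.map (algebraMap F Ω) *ᵥ (G' *ᵥ e) = G' *ᵥ e := by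
      rw [Matrix.mulVec_mulVec, ← hhG', ← Matrix.mulVec_mulVec, he]
    have hmem := Submodule.mem_map_of_mem (f := δ.comp G.mulVecLin) (mem_span_fixed_of_mulVec_eq hy)
    rw [Submodule.map_span, ← Set.image_comp] at hmem
    have e2 : (δ.comp G.mulVecLin) (G' *ᵥ e) = Pi.basisFun Ω (Fin d) i := by
      rw [LinearMap.comp_apply, Matrix.mulVecLin_apply, Matrix.mulVec_mulVec, h1, Matrix.one_mulVec]
      ext l
      simp only [δ, LinearMap.funLeft_apply, e, Pi.basisFun_apply, Pi.single_apply]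
      exact if_congr ⟨fun hu => congrFun hu 0, fun hu => by rw [hu]⟩ rfl rfl
    rw [e2] at hmem
    exact hmem
  obtain ⟨v, hv, hvspan, hvli⟩ : ∃ v : Fin d → (Fin d → Ω), (∀ s, v s ∈ D '' K) ∧
      Submodule.span Ω (Set.range v) = ⊤ ∧ LinearIndependent Ω v := by
    have := Submodule.exists_fun_fin_finrank_span_eq Ω (D '' K)
    rw [hspan, finrank_top, Module.finrank_fin_fun] at this
    exact this
  choose x hxK hxv using hv
  -- a fixed vector has its image in the `F`-span
  have hD : ∀ y ∈ K, ∃ c : Fin d → F, D y = ∑ s, c s • v s := by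
    intro y hy
    obtain ⟨c, hc⟩ := (Submodule.mem_span_range_iff_exists_fun Ω).1
      (hvspan ▸ Submodule.mem_top : D y ∈ Submodule.span Ω (Set.range v))
    let w := G *ᵥ (j y - ∑ s, c s • j (x s))
    have hw : P *ᵥ w = w := by
      simp only [w]
      rw [Matrix.mulVec_sub, Matrix.mulVec_sub, hKP y hy, Matrix.mulVec_sum, Matrix.mulVec_sum]
      congr 1
      refine Finset.sum_congr rfl fun s _ => ?_
      rw [Matrix.mulVec_smul, Matrix.mulVec_smul, hKP _ (hxK s)]
    have hδw : δ w = 0 := by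
      simp only [w]
      rw [Matrix.mulVec_sub, map_sub, ← hDapp, ← hc, Matrix.mulVec_sum, map_sum, sub_eq_zero]
      refine Finset.sum_congr rfl fun s _ => ?_
      rw [Matrix.mulVec_smul, map_smul, ← hDapp, hxv]
    obtain ⟨z, hz⟩ := exists_eq_const_add_rotations (hinv w hw)
    have hz' : w = z + P *ᵥ z + P *ᵥ (P *ᵥ z) := by
      ext u
      rw [hz u, hP, hP]
      have : (if u = fun _ => u 0 then w u else 0) = 0 := by
        split_ifs with hu
        · have := congrFun hδw (u 0)
          rw [hu]; exact this
        · rfl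
      rw [this, zero_add]
      rfl
    have hhG : ∀ z, G' *ᵥ (P *ᵥ z) = h.map (algebraMap F Ω) *ᵥ (G' *ᵥ z) := fun z => by
      rw [Matrix.mulVec_mulVec, Matrix.mulVec_mulVec, hhG']
    have hq : j y = ∑ s, c s • j (x s) + (G' *ᵥ z + h.map (algebraMap F Ω) *ᵥ (G' *ᵥ z)
        + h.map (algebraMap F Ω) *ᵥ (h.map (algebraMap F Ω) *ᵥ (G' *ᵥ z))) := by
      rw [← hhG, ← hhG, ← Matrix.mulVec_add, ← Matrix.mulVec_add, ← hz']
      simp only [w]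
      rw [Matrix.mulVec_mulVec, h2, Matrix.one_mulVec]
      abel
    obtain ⟨π, hπ⟩ := LinearMap.exists_leftInverse_of_injective (Algebra.linearMap F Ω)
      (LinearMap.ker_eq_bot.2 (algebraMap F Ω).injective)
    have hπ' : ∀ r, π (algebraMap F Ω r) = r := fun r => LinearMap.congr_fun hπ r
    let q : Fin N → F := fun k => π ((G' *ᵥ z) k)
    have hy' : y = ∑ s, π (c s) • x s + (q + h *ᵥ q + h *ᵥ (h *ᵥ q)) := by
      have h5 := congrArg (π.compLeft (Fin N)) hq
      rw [map_add, map_sum, map_add, map_add] at h5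
      have h6 : ∀ r, π.compLeft (Fin N) (j r) = r := fun r => funext fun k => hπ' _
      have h7 : ∀ u, π.compLeft (Fin N) (h.map (algebraMap F Ω) *ᵥ u)
          = h *ᵥ π.compLeft (Fin N) u := fun u => comp_map_mulVec π h u
      rw [h6, h7, h7, h7] at h5
      rw [h5]
      congr 1
      refine Finset.sum_congr rfl fun s _ => ?_
      ext k
      change π (c s * algebraMap F Ω (x s k)) = π (c s) * x s k
      rw [mul_comm, ← Algebra.smul_def, map_smul, smul_eq_mul, mul_comm]
    refine ⟨fun s => π (c s), ?_⟩
    conv_lhs => rw [hy']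
    rw [map_add, map_sum, add_eq_left.2]
    · refine Finset.sum_congr rfl fun s _ => ?_
      rw [map_smul, hxv]
    · rw [map_add, map_add, hDapp, hDapp, hDapp]
      ext i
      have hconst : ∀ r, (G *ᵥ j (h *ᵥ r)) (fun _ => i) = (G *ᵥ j r) fun _ => i := fun r => by
        rw [← hPj, hP]; rfl
      have : ∀ f : (Fin 3 → Fin d) → Ω, δ f i = f fun _ => i := fun _ => rfl
      simp only [Pi.add_apply, this, Pi.zero_apply]
      rw [hconst, hconst, hconst]
      linear_combination ((G *ᵥ j q) fun _ => i) * h3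
  have hγ : ∀ a, ∀ y ∈ K, ∃ y' ∈ K, D y' = ((γ a).map (frobenius Ω 3)) *ᵥ D y := by
    intro a y hy
    let p : ⨂[F] _ : Fin 3, A := PiTensorProduct.tprod F fun _ => a
    have hGp : G *ᵥ j (β p *ᵥ y) = tensorCube γ p *ᵥ (G *ᵥ j y) := by
      rw [← hj, Matrix.mulVec_mulVec, hG, AlgEquiv.symm_apply_apply, Matrix.mulVec_mulVec]
    have hPp : P * tensorCube γ p = tensorCube γ p * P := by
      have := permuteMatrix_mul_tensorCube γ (finRotate 3)⁻¹ p
      simp only [p] at this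
      rwa [permuteCube_tprod] at this
    refine ⟨β p *ᵥ y, ?_, ?_⟩
    · have e1 : G *ᵥ j (h *ᵥ (β p *ᵥ y)) = G *ᵥ j (β p *ᵥ y) := by
        rw [← hPj, hGp, Matrix.mulVec_mulVec, hPp, ← Matrix.mulVec_mulVec, hKP y hy]
      have e2 := congrArg (G' *ᵥ ·) e1
      simp only [Matrix.mulVec_mulVec _ G' G, h2, Matrix.one_mulVec] at e2
      funext k
      exact (algebraMap F Ω).injective (congrFun e2 k)
    · rw [hDapp, hGp]
      ext i
      have hw := hinv _ (hKP y hy)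
      rw [hDapp]
      generalize G *ᵥ j y = w at hw
      change ∑ u, tensorCube γ p (fun _ => i) u * w u = ∑ l, γ a i l ^ 3 * w fun _ => l
      simp only [p, tensorCube_tprod]
      rw [sum_eq_sum_const]
      · simp
      · intro u
        rw [hw]
        congr 1
        exact Fintype.prod_equiv (finRotate 3) _ _ fun t => rfl
  let V : Matrix (Fin d) (Fin d) Ω := Matrix.of fun i s => v s i
  have hV : IsUnit V := Matrix.linearIndependent_cols_iff_isUnit.1 hvli
  refine exists_conj_pow_mem_range γ hV fun a => ?_
  have hcol : ∀ s, ∃ c : Fin d → F, (γ a).map (frobenius Ω 3) *ᵥ v s = ∑ t, c t • v t := by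
    intro s
    obtain ⟨y', hy', h5⟩ := hγ a (x s) (hxK s)
    rw [hxv] at h5
    exact h5 ▸ hD y' hy'
  choose c hc using hcol
  refine ⟨Matrix.of fun t s => c s t, ?_⟩
  ext i s
  have h5 := congrFun (hc s) i
  rw [Finset.sum_apply] at h5
  change ((γ a).map (frobenius Ω 3) *ᵥ v s) i = ∑ t, v t i * algebraMap F Ω (c s t)
  rw [h5]
  exact Finset.sum_congr rfl fun t _ => by rw [Pi.smul_apply, Algebra.smul_def, mul_comm]

section
variable {F A : Type} [Field F] [Ring A] [Algebra F A] [IsSimpleRing A] [FiniteDimensional F A]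

theorem HasIndex.dvd_finrank_of_split {K N : Type} [Field K] [Algebra F K] [Field N] [Algebra F N]
    [Algebra K N] [IsScalarTower F K N] [FiniteDimensional K N] {d q : ℕ} (hd : d ^ 2 = Module.finrank F A)
    (hidx : HasIndex K (K ⊗[F] A) q) (ρ : A →ₐ[F] Matrix (Fin d) (Fin d) N) :
    q ∣ Module.finrank K N := by
  obtain ⟨D, _, _, m, hm, ⟨e⟩, hD⟩ := hidx
  have : NeZero m := ⟨hm.ne'⟩
  have hdm : d = m * q := by
    have h1 := e.toLinearEquiv.finrank_eq
    rw [Module.finrank_matrix, hD, Module.finrank_baseChange, ← hd] at h1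
    apply Nat.pow_left_injective (n := 2) (by norm_num)
    change d ^ 2 = (m * q) ^ 2
    rw [h1]; simp; ring
  have hd0 : 0 < d := by
    have : 0 < d ^ 2 := hd ▸ Module.finrank_pos
    exact Nat.pos_of_ne_zero (by rintro rfl; simp at this)
  let φ : K ⊗[F] A →ₐ[K] Matrix (Fin d) (Fin d) N :=
    Algebra.TensorProduct.lift (Algebra.ofId K _) ρ (fun c a => Algebra.commutes c (ρ a))
  have h2 := card_mul_finrank_dvd_finrank ((mulVecAlgHom K N (Fin d)).comp
    (φ.comp e.symm.toAlgHom))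
  rw [hD, Module.finrank_pi_fintype] at h2
  simp only [Fintype.card_fin, Finset.sum_const, Finset.card_univ, smul_eq_mul] at h2
  have h3 : m * q ^ 2 = d * q := by rw [hdm]; ring
  rw [h3] at h2
  exact Nat.dvd_of_mul_dvd_mul_left hd0 h2

theorem HasIndex.dvd_of_baseChange {K : Type} [Field K] [Algebra F K]
    {q r : ℕ} (hq : HasIndex K (K ⊗[F] A) q) (hr : HasIndex F A r) :
    q ∣ r := by
  obtain ⟨D, _, _, m, hm, ⟨e⟩, hD⟩ := hq
  obtain ⟨D', _, _, m', hm', ⟨e'⟩, hD'⟩ := hr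
  have : NeZero m := ⟨hm.ne'⟩
  have : NeZero m' := ⟨hm'.ne'⟩
  have hdm : m * q = m' * r := by
    have h1 := e.toLinearEquiv.finrank_eq
    have h2 := e'.toLinearEquiv.finrank_eq
    rw [Module.finrank_matrix, hD, Module.finrank_baseChange, h2, Module.finrank_matrix, hD'] at h1
    apply Nat.pow_left_injective (n := 2) (by norm_num)
    simp only [Fintype.card_fin] at h1
    change (m * q) ^ 2 = (m' * r) ^ 2
    linarith [h1, show (m * q) ^ 2 = m * m * q ^ 2 by ring,
      show (m' * r) ^ 2 = m' * m' * r ^ 2 by ring]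
  have hd0 : 0 < m * q := by
    have h1 : 0 < Module.finrank F A := Module.finrank_pos
    rw [e'.toLinearEquiv.finrank_eq, Module.finrank_matrix, hD'] at h1
    rw [hdm]
    exact Nat.pos_of_ne_zero fun h => by
      rcases mul_eq_zero.1 h with h | h <;> simp [h] at h1
  have : FiniteDimensional F D' := Module.finite_of_finrank_pos <| by
    rw [hD']
    exact pow_pos (Nat.pos_of_ne_zero fun h => by simp [hdm, h] at hd0) 2
  let ψ : A →ₐ[F] Module.End K (K ⊗[F] (Fin m' → D')) :=
    (Module.End.baseChangeHom F K (Fin m' → D')).comp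
      ((mulVecAlgHom F D' (Fin m')).comp e'.toAlgHom)
  let φ : K ⊗[F] A →ₐ[K] Module.End K (K ⊗[F] (Fin m' → D')) :=
    Algebra.TensorProduct.lift (Algebra.ofId K _) ψ (fun c a => Algebra.commutes c (ψ a))
  have h2 := card_mul_finrank_dvd_finrank (φ.comp e.symm.toAlgHom)
  rw [hD, Module.finrank_baseChange, Module.finrank_pi_fintype] at h2
  simp only [Fintype.card_fin, Finset.sum_const, Finset.card_univ, smul_eq_mul, hD'] at h2
  have h3 : m * q ^ 2 = m * q * q := by ring
  have h4 : m' * r ^ 2 = m * q * r := by rw [hdm]; ring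
  rw [h3, h4] at h2
  exact Nat.dvd_of_mul_dvd_mul_left hd0 h2

theorem IsSplitAlg.exists_algHom_matrix {K : Type} [Field K] [Algebra F K] {d : ℕ}
    (hd : d ^ 2 = Module.finrank F A) (h : IsSplitAlg K (K ⊗[F] A)) :
    Nonempty (A →ₐ[F] Matrix (Fin d) (Fin d) K) := by
  obtain ⟨m, hm, ⟨e⟩⟩ := h
  have hdm : d = m := by
    have h1 := e.toLinearEquiv.finrank_eq
    rw [Module.finrank_matrix, Module.finrank_baseChange, ← hd] at h1
    apply Nat.pow_left_injective (n := 2) (by norm_num)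
    change d ^ 2 = m ^ 2
    rw [h1]; simp; ring
  subst hdm
  exact ⟨(e.toAlgHom.restrictScalars F).comp Algebra.TensorProduct.includeRight⟩
end

section
variable {F Ω : Type} [Field F] [Field Ω] [Algebra F Ω]

/-- The elements of `Ω` whose cube lies in `L`. -/
def cubeRoots [CharP Ω 3] (L : IntermediateField F Ω) : IntermediateField F Ω :=
  (L.toSubfield.comap (frobenius Ω 3)).toIntermediateField fun x =>
    pow_mem (L.algebraMap_mem x) 3

theorem mem_cubeRoots [CharP Ω 3] {L : IntermediateField F Ω} {t : Ω} :
    t ∈ cubeRoots L ↔ t ^ 3 ∈ L := Iff.rfl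

theorem exists_finset_mem_sup_adjoin [CharP Ω 3] [IsAlgClosed Ω] (L : IntermediateField F Ω)
    [FiniteDimensional F L] [Algebra.IsSeparable F L] {x : Ω} (hx : x ^ 3 ∈ L) :
    ∃ S : Finset Ω, (∀ y ∈ S, y ^ 3 ∈ Set.range (algebraMap F Ω)) ∧
      S.card ≤ Module.finrank F L ∧ x ∈ L ⊔ IntermediateField.adjoin F (S : Set Ω) := by
  classical
  have : CharP F 3 := (algebraMap F Ω).charP (algebraMap F Ω).injective 3
  let b := Module.finBasis F L
  have hspan := Field.span_map_pow_expChar_pow_eq_top_of_isSeparable 3 1 b.span_eq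
  obtain ⟨c, hc⟩ := (Submodule.mem_span_range_iff_exists_fun F).1
    (hspan ▸ Submodule.mem_top : (⟨x ^ 3, hx⟩ : L) ∈ _)
  choose r hr using fun k => IsAlgClosed.exists_pow_nat_eq (algebraMap F Ω (c k)) (n := 3)
    (by norm_num)
  refine ⟨Finset.univ.image r, ?_, ?_, ?_⟩
  · simp only [Finset.mem_image, Finset.mem_univ, true_and, forall_exists_index,
      forall_apply_eq_imp_iff]
    exact fun k => ⟨c k, (hr k).symm⟩
  · exact Finset.card_image_le.trans (by simp)
  · have hxe : x = ∑ k, r k * (b k : Ω) := by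
      apply (frobenius Ω 3).injective
      rw [map_sum]
      have h1 := congrArg (algebraMap L Ω) hc
      rw [map_sum] at h1
      refine h1.symm.trans (Finset.sum_congr rfl fun k _ => ?_)
      rw [frobenius_def, mul_pow, hr, Algebra.smul_def, map_mul,
        ← IsScalarTower.algebraMap_apply, map_pow]
      rfl
    rw [hxe]
    refine sum_mem fun k _ => mul_mem ?_ ?_
    · exact (le_sup_right : _ ≤ L ⊔ _) (IntermediateField.subset_adjoin _ _ (by simp))
    · exact (le_sup_left : L ≤ _) (b k).2

theorem finiteDimensional_adjoin_finset [Algebra.IsAlgebraic F Ω] (S : Finset Ω) :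
    FiniteDimensional F (IntermediateField.adjoin F (S : Set Ω)) :=
  IntermediateField.finiteDimensional_adjoin fun x _ => Algebra.IsIntegral.isIntegral x

theorem relfinrank_sup_le (L K : IntermediateField F Ω) [FiniteDimensional F K] :
    K.relfinrank (L ⊔ K) ≤ Module.finrank F L := by
  have h1 := IntermediateField.finrank_sup_le L K
  have h2 := IntermediateField.relfinrank_mul_relfinrank (A := (⊥ : IntermediateField F Ω))
    (B := K) (C := L ⊔ K) bot_le le_sup_right
  rw [IntermediateField.relfinrank_bot_left, IntermediateField.relfinrank_bot_left] at h2
  have h3 : 0 < Module.finrank F K := Module.finrank_pos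
  rw [← h2, mul_comm] at h1
  exact Nat.le_of_mul_le_mul_right h1 h3
end

/-- The algebra `A`, of dimension `d ^ 2`, is split over the subfield `N` of `Ω`: it has a
`d`-dimensional matrix representation over `Ω` with entries in `N`. -/
def IsSplitIn {F Ω : Type} (A : Type) [Field F] [Field Ω] [Algebra F Ω] [Ring A] [Algebra F A]
    (d : ℕ) (N : IntermediateField F Ω) : Prop :=
  ∃ ρ : A →ₐ[F] Matrix (Fin d) (Fin d) Ω, ∀ a k l, ρ a k l ∈ N

theorem IsCompositum.nonempty_algHom {F L K M : Type} [Field F] [Field L] [Field K] [Field M]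
    [Algebra F L] [Algebra F K] [Algebra F M] [Algebra L M] [Algebra K M]
    [IsScalarTower F L M] [IsScalarTower F K M] [Algebra.IsAlgebraic F L] [Algebra.IsAlgebraic F K]
    (h : IsCompositum F L K M) (Ω : Type) [Field Ω] [IsAlgClosed Ω] [Algebra K Ω] :
    Nonempty (M →ₐ[K] Ω) := by
  have h_integral : Algebra.IsIntegral F M := by
    rw [← integralClosure_eq_top_iff, eq_top_iff, ← show _ = _ from h, sup_le_iff]
    constructor
    · rintro _ ⟨x, rfl⟩
      exact (Algebra.IsIntegral.isIntegral (R := F) x).map (IsScalarTower.toAlgHom F L M)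
    · rintro _ ⟨x, rfl⟩
      exact (Algebra.IsIntegral.isIntegral (R := F) x).map (IsScalarTower.toAlgHom F K M)
  have : Algebra.IsAlgebraic K M := Algebra.IsAlgebraic.tower_top (K := F) K
  exact ⟨IsAlgClosed.lift⟩

section
variable {F Ω A : Type} [Field F] [Field Ω] [Algebra F Ω] [Ring A] [Algebra F A] {d : ℕ}

theorem HasIndex.le_relfinrank [IsSimpleRing A] [FiniteDimensional F A]
    (hd : d ^ 2 = Module.finrank F A) {K N : IntermediateField F Ω} (h : K ≤ N)
    [FiniteDimensional F N] {q : ℕ} (hidx : HasIndex K (K ⊗[F] A) q) (hN : IsSplitIn A d N) :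
    q ≤ K.relfinrank N := by
  obtain ⟨ρ, hρ⟩ := hN
  obtain ⟨ρ', -⟩ := exists_algHom_matrix_lift N.val ρ (fun a k l => ⟨⟨_, hρ a k l⟩, rfl⟩)
  let _ : Algebra K N := (IntermediateField.inclusion h).toRingHom.toAlgebra
  have : IsScalarTower F K N := IsScalarTower.of_algebraMap_eq fun _ => rfl
  have : FiniteDimensional K N := FiniteDimensional.right F K N
  have h1 := Nat.le_of_dvd Module.finrank_pos (hidx.dvd_finrank_of_split hd ρ')
  rw [IntermediateField.relfinrank_eq_finrank_of_le h]
  exact h1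

/-- Reducibility, with all fields realised inside an algebraically closed field. -/
theorem IsPReducible.split_or_exists [CharP F 3] [IsAlgClosed Ω] (hred : IsPReducible 3 F) (hA : IsCSA F A)
    (hexp : HasExponent F A 3) (hd : d ^ 2 = Module.finrank F A) (K : IntermediateField F Ω)
    (hK : ∀ z ∈ K, z ^ 3 ∈ Set.range (algebraMap F Ω)) :
    IsSplitIn A d K ∨ ∃ L : IntermediateField F Ω, FiniteDimensional F L ∧
      Algebra.IsSeparable F L ∧ HasIndex K (K ⊗[F] A) (3 * Module.finrank F L) ∧
      ∃ (M : Type) (_ : Field M) (_ : Algebra F M) (_ : Algebra M Ω) (_ : IsScalarTower F M Ω),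
        Set.range (algebraMap M Ω) = (L ⊔ K : IntermediateField F Ω) ∧
        HasIndex M (M ⊗[F] A) 3 := by
  obtain ⟨_, hsimple, _⟩ := hA
  have hK' : ∀ z : K, z ^ 3 ∈ (algebraMap F K).range := fun z => by
    obtain ⟨r, hr⟩ := hK z z.2
    exact ⟨r, Subtype.ext hr⟩
  have hpi : IsPurelyInseparable F K :=
    (isPurelyInseparable_iff_pow_mem F 3).2 fun z => ⟨1, by simpa using hK' z⟩
  rcases hred A ⟨‹_›, ‹_›, ‹_›⟩ hexp K hpi hK' with hs |
    ⟨e, hidx, L, _, _, hsep, hLe, M, _, _, _, _, _, _, hcomp, hM⟩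
  · left
    obtain ⟨ρ⟩ := hs.exists_algHom_matrix hd
    exact ⟨K.val.mapMatrix.comp ρ, fun a k l => (ρ a k l).2⟩
  right
  have he : 0 < e := by
    obtain ⟨D, _, _, m, hm, ⟨g⟩, hD⟩ := hidx
    have h1 : 0 < Module.finrank K (K ⊗[F] A) := by
      rw [Module.finrank_baseChange]; exact Module.finrank_pos
    rw [g.toLinearEquiv.finrank_eq, Module.finrank_matrix, hD] at h1
    exact Nat.pos_of_ne_zero fun h => by simp [h] at h1
  have hfin : FiniteDimensional F L := Module.finite_of_finrank_pos (hLe ▸ he)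
  obtain ⟨ι⟩ : Nonempty (M →ₐ[K] Ω) := hcomp.nonempty_algHom Ω
  let ιF : M →ₐ[F] Ω := ι.restrictScalars F
  let φ : L →ₐ[F] Ω := ιF.comp (IsScalarTower.toAlgHom F L M)
  let _ : Algebra M Ω := ι.toRingHom.toAlgebra
  have : IsScalarTower F M Ω := IsScalarTower.of_algebraMap_eq fun r => (ιF.commutes r).symm
  have hequiv := AlgEquiv.ofInjectiveField φ
  refine ⟨φ.fieldRange, Module.Finite.equiv hequiv.toLinearEquiv, AlgEquiv.Algebra.isSeparable hequiv, ?_, M,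
    inferInstance, inferInstance, inferInstance, inferInstance, ?_, hM⟩
  · have : Module.finrank F φ.fieldRange = e := by
      rw [← hLe]; exact hequiv.toLinearEquiv.finrank_eq.symm
    rwa [this]
  · have hιK : ∀ z : K, ι (algebraMap K M z) = z := fun z => ι.commutes z
    apply Set.Subset.antisymm
    · have : (IsScalarTower.toAlgHom F L M).range ⊔ (IsScalarTower.toAlgHom F K M).range
          ≤ (φ.fieldRange ⊔ K).toSubalgebra.comap ιF := by
        rw [sup_le_iff]
        constructor
        · rintro _ ⟨x, rfl⟩
          exact (le_sup_left : φ.fieldRange ≤ _) ⟨x, rfl⟩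
        · rintro _ ⟨x, rfl⟩
          refine (le_sup_right : K ≤ φ.fieldRange ⊔ K) ?_
          change ι (algebraMap K M x) ∈ K
          rw [hιK]; exact x.2
      rw [show _ = _ from hcomp] at this
      rintro _ ⟨x, rfl⟩
      exact this (Algebra.mem_top : x ∈ ⊤)
    · have : φ.fieldRange ⊔ K ≤ ιF.fieldRange := by
        rw [sup_le_iff]
        constructor
        · rintro _ ⟨x, rfl⟩
          exact ⟨_, rfl⟩
        · intro z hz
          exact ⟨algebraMap K M ⟨z, hz⟩, hιK ⟨z, hz⟩⟩
      intro z hz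
      exact this hz

theorem mem_of_mem_adjoin_of_range_le {M : Type} [Field M] [Algebra F M] [Algebra M Ω]
    [IsScalarTower F M Ω] {N : IntermediateField F Ω} (hN : Set.range (algebraMap M Ω) ⊆ N)
    {X : Set Ω} (hX : X ⊆ N) {t : Ω} (ht : t ∈ IntermediateField.adjoin M X) : t ∈ N := by
  let N' : IntermediateField M Ω := N.toSubfield.toIntermediateField fun x => hN ⟨x, rfl⟩
  exact (IntermediateField.adjoin_le_iff.2 hX : IntermediateField.adjoin M X ≤ N') ht

theorem pow_mem_range_of_mem_adjoin [CharP Ω 3] {S : Set Ω}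
    (hS : ∀ y ∈ S, y ^ 3 ∈ Set.range (algebraMap F Ω)) {z : Ω}
    (hz : z ∈ IntermediateField.adjoin F S) : z ^ 3 ∈ Set.range (algebraMap F Ω) := by
  have : IntermediateField.adjoin F S ≤ cubeRoots ⊥ :=
    IntermediateField.adjoin_le_iff.2 fun y hy => IntermediateField.mem_bot.2 (hS y hy)
  exact IntermediateField.mem_bot.1 (this hz)

variable [CharP F 3] [IsAlgClosed Ω] [CharP Ω 3] [Algebra.IsAlgebraic F Ω]

theorem exists_finset_split_of_isPReducible (hred : IsPReducible 3 F) (hA : IsCSA F A)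
    (hexp : HasExponent F A 3) (hd : d ^ 2 = Module.finrank F A) (k : ℕ) (S : Finset Ω)
    (hS : ∀ y ∈ S, y ^ 3 ∈ Set.range (algebraMap F Ω)) (N : IntermediateField F Ω)
    (hSN : IntermediateField.adjoin F (S : Set Ω) ≤ N) (hNfin : FiniteDimensional F N)
    (hN : (IntermediateField.adjoin F (S : Set Ω)).relfinrank N ≤ 3 ^ k)
    (hsplit : IsSplitIn A d N) :
    ∃ T : Finset Ω, (∀ y ∈ T, y ^ 3 ∈ Set.range (algebraMap F Ω)) ∧
      T.card ≤ S.card + (3 ^ k - 1) ∧ IsSplitIn A d (IntermediateField.adjoin F (T : Set Ω)) := by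
  classical
  obtain ⟨_, hsimple, _⟩ := id hA
  induction k generalizing S N with
  | zero =>
    refine ⟨S, hS, by simp, ?_⟩
    have h1 : 0 < (IntermediateField.adjoin F (S : Set Ω)).relfinrank N := by
      have h2 := IntermediateField.relfinrank_mul_relfinrank (A := (⊥ : IntermediateField F Ω))
        bot_le hSN
      rw [IntermediateField.relfinrank_bot_left, IntermediateField.relfinrank_bot_left] at h2
      have h3 : 0 < Module.finrank F N := Module.finrank_pos
      exact Nat.pos_of_ne_zero fun h => by simp [h] at h2; omega
    have h2 : N ≤ IntermediateField.adjoin F (S : Set Ω) :=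
      IntermediateField.relfinrank_eq_one_iff.1 (by simp at hN; omega)
    obtain ⟨ρ, hρ⟩ := hsplit
    exact ⟨ρ, fun a k l => h2 (hρ a k l)⟩
  | succ k ih =>
    set K := IntermediateField.adjoin F (S : Set Ω)
    have hK : ∀ z ∈ K, z ^ 3 ∈ Set.range (algebraMap F Ω) := fun z hz =>
      pow_mem_range_of_mem_adjoin (fun y hy => hS y (Finset.mem_coe.1 hy)) hz
    rcases hred.split_or_exists hA hexp hd K hK with hs |
      ⟨L, hLfin, hLsep, hidx, M, _, _, _, _, hrange, hM⟩
    · exact ⟨S, hS, by omega, hs⟩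
    obtain ⟨ρN, hρN⟩ := hsplit
    have he : Module.finrank F L ≤ 3 ^ k := by
      have h1 := hidx.le_relfinrank hd hSN ⟨ρN, hρN⟩
      have := h1.trans hN
      rw [pow_succ] at this
      omega
    obtain ⟨ρ₀, hρ₀⟩ := exists_split_cube_roots hd ρN hexp.2.1
    have hKc : K ≤ cubeRoots L := fun z hz => by
      obtain ⟨r, hr⟩ := hK z hz
      rw [mem_cubeRoots, ← hr]
      exact L.algebraMap_mem r
    have hLc : L ≤ cubeRoots L := fun z hz => pow_mem hz 3
    let E : IntermediateField M Ω := (cubeRoots L).toSubfield.toIntermediateField fun x =>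
      (sup_le hLc hKc) (hrange ▸ ⟨x, rfl⟩ : algebraMap M Ω x ∈ ((L ⊔ K : IntermediateField F Ω) : Set Ω))
    obtain ⟨x₁, hx₁, x₂, hx₂, ρ, hρ⟩ := exists_split_adjoin_two hd hM ρ₀ E
      (fun t ht => hrange ▸ (le_sup_left : L ≤ L ⊔ K) ht)
      (fun a k l => by
        obtain ⟨r, hr⟩ := hρ₀ a k l
        change ρ₀ a k l ^ 3 ∈ L
        rw [← hr]
        exact L.algebraMap_mem r)
    obtain ⟨S₁, hS₁, hc₁, hm₁⟩ := exists_finset_mem_sup_adjoin L hx₁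
    obtain ⟨S₂, hS₂, hc₂, hm₂⟩ := exists_finset_mem_sup_adjoin L hx₂
    let T := S ∪ (S₁ ∪ S₂)
    have hT : ∀ y ∈ T, y ^ 3 ∈ Set.range (algebraMap F Ω) := by
      intro y hy
      simp only [T, Finset.mem_union] at hy
      rcases hy with h | h | h
      exacts [hS y h, hS₁ y h, hS₂ y h]
    have hmono : ∀ U : Finset Ω, U ⊆ T → L ⊔ IntermediateField.adjoin F (U : Set Ω)
        ≤ L ⊔ IntermediateField.adjoin F (T : Set Ω) := fun U hU =>
      sup_le_sup_left (IntermediateField.adjoin.mono F _ _ (Finset.coe_subset.2 hU)) L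
    have hfinT := finiteDimensional_adjoin_finset (F := F) T
    obtain ⟨T', hT', hcard, hsp⟩ := ih T hT (L ⊔ IntermediateField.adjoin F (T : Set Ω))
      le_sup_right inferInstance ((relfinrank_sup_le _ _).trans he) ⟨ρ, fun a k l =>
        mem_of_mem_adjoin_of_range_le
          (hrange ▸ hmono S Finset.subset_union_left) (by
            rintro _ (rfl | rfl)
            · exact hmono S₁ (Finset.subset_union_left.trans Finset.subset_union_right) hm₁
            · exact hmono S₂ (Finset.subset_union_right.trans Finset.subset_union_right) hm₂)
          (hρ a k l)⟩
    refine ⟨T', hT', ?_, hsp⟩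
    have h1 : T.card ≤ S.card + (S₁.card + S₂.card) :=
      (Finset.card_union_le _ _).trans (Nat.add_le_add_left (Finset.card_union_le _ _) _)
    have h2 : 0 < 3 ^ k := by positivity
    rw [pow_succ]
    omega

theorem exists_finset_split_of_hasIndex (hred : IsPReducible 3 F) (hA : IsCSA F A)
    (hexp : HasExponent F A 3) (hd : d ^ 2 = Module.finrank F A)
    (γ : A →ₐ[F] Matrix (Fin d) (Fin d) Ω) (n : ℕ) (hind : HasIndex F A (3 ^ (n + 1))) :
    ∃ T : Finset Ω, (∀ y ∈ T, y ^ 3 ∈ Set.range (algebraMap F Ω)) ∧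
      T.card ≤ 2 * 3 ^ n - 1 ∧ IsSplitIn A d (IntermediateField.adjoin F (T : Set Ω)) := by
  obtain ⟨_, hsimple, _⟩ := id hA
  rcases hred.split_or_exists hA hexp hd (⊥ : IntermediateField F Ω)
    (fun z hz => pow_mem hz 3) with hs |
    ⟨L, hLfin, hLsep, hidx, M, _, _, _, _, hrange, hM⟩
  · exact ⟨∅, by simp, by simp, by simpa using hs⟩
  rw [sup_bot_eq] at hrange
  have he : Module.finrank F L ≤ 3 ^ n := by
    have h1 := Nat.le_of_dvd (by positivity) (hidx.dvd_of_baseChange hind)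
    rw [pow_succ] at h1
    omega
  obtain ⟨β, hβ, ρ, hρ⟩ := exists_split_adjoin_one hd hM γ
  obtain ⟨S, hS, hc, hm⟩ := exists_finset_mem_sup_adjoin L (hrange ▸ hβ : β ^ 3 ∈ (L : Set Ω))
  have hfinS := finiteDimensional_adjoin_finset (F := F) S
  obtain ⟨T, hT, hcard, hsp⟩ := exists_finset_split_of_isPReducible hred hA hexp hd n S hS
    (L ⊔ IntermediateField.adjoin F (S : Set Ω)) le_sup_right inferInstance
    ((relfinrank_sup_le _ _).trans he) ⟨ρ, fun a k l => mem_of_mem_adjoin_of_range_le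
      (hrange ▸ (le_sup_left : L ≤ _)) (by rintro _ rfl; exact hm) (hρ a k l)⟩
  refine ⟨T, hT, ?_, hsp⟩
  have h2 : 0 < 3 ^ n := by positivity
  omega
end

/-- Over a `3`-reducible field `F` of characteristic `3`, a central simple
algebra of exponent `3` and index `3 ^ n` has `3`-symbol length at most
`2 * 3 ^ (n - 1) - 1`. -/
theorem statement9 (F : Type) [Field F] [CharP F 3] (hred : IsPReducible 3 F)
    (A : Type) [Ring A] [Algebra F A] (hA : IsCSA F A) (hexp : HasExponent F A 3)
    (n : ℕ) (hn : 0 < n) (hind : HasIndex F A (3 ^ n)) :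
    SymbolLengthLE 3 F A (2 * 3 ^ (n - 1) - 1) := by
  obtain ⟨n, rfl⟩ := Nat.exists_eq_succ_of_ne_zero hn.ne'
  obtain ⟨_, hsimple, _⟩ := id hA
  let Ω := AlgebraicClosure F
  have : CharP Ω 3 := charP_of_injective_algebraMap (algebraMap F Ω).injective 3
  obtain ⟨d, hd, ⟨γ⟩⟩ := exists_algHom_matrix_of_isAlgClosed (F := F) (A := A) Ω
  obtain ⟨T, hT, hcard, ρ, hρ⟩ := exists_finset_split_of_hasIndex hred hA hexp hd γ n hind
  obtain ⟨k, hk, h⟩ := symbolLengthLE_of_split_adjoin hd T hT ρ hρ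
  exact ⟨k, hk.trans hcard, h⟩
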